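/- Assume (H1), (H2), the Oseledec hypothesis, and the second-space hypothesis. Then for μ-almost every z ∈ B^ℤ there exist e, b, c ∈ B (which may depend on z) such that τ̃_z(e,b,c) = λ2 − λ1. -/

import Mathlib

open Filter MeasureTheory Matrix

noncomputable section

/-- The left shift on bi-infinite sequences: `(shift z) n = z (n+1)`. -/
def shift {l : ℕ} (z : ℤ → Fin l) : ℤ → Fin l := fun n => z (n + 1)

/-- The inverse shift: `(invShift z) n = z (n-1)`. -/
def invShift {l : ℕ} (z : ℤ → Fin l) : ℤ → Fin l := fun n => z (n - 1)

/-- The matrix `(L_z)_{i,j} = q(z_0 | j) * p(j | i)`, where `p i j = p(j|i)` and `q i m = q(m|i)`. -/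
def Lmat {k l : ℕ} (p : Matrix (Fin k) (Fin k) ℝ) (q : Matrix (Fin k) (Fin l) ℝ)
    (z : ℤ → Fin l) : Matrix (Fin k) (Fin k) ℝ :=
  Matrix.of fun i j => q j (z 0) * p i j

/-- `Lpow p q n z = L_{S^{-(n-1)}z} ⋯ L_{S^{-1}z} L_z` (and `= 1` for `n = 0`). -/
def Lpow {k l : ℕ} (p : Matrix (Fin k) (Fin k) ℝ) (q : Matrix (Fin k) (Fin l) ℝ) :
    ℕ → (ℤ → Fin l) → Matrix (Fin k) (Fin k) ℝ
  | 0, _ => 1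
  | n + 1, z => Lmat p q (invShift^[n] z) * Lpow p q n z

/-- Euclidean norm on `ℝ^k`. -/
def enorm2 {k : ℕ} (v : Fin k → ℝ) : ℝ := Real.sqrt (∑ i, v i ^ 2)

/-- The path sum `S^{[n]}_{a,b}(z)`; for `n = m+1 ≥ 1` the sum is over paths
`x : Fin (m+1) → Fin k`, where `x i` stands for `x_{-(n-i)}`. -/
def Spath {k l : ℕ} (p : Matrix (Fin k) (Fin k) ℝ) (q : Matrix (Fin k) (Fin l) ℝ)
    (piv : Fin k → ℝ) : ℕ → Fin k → Fin l → (ℤ → Fin l) → ℝ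
  | 0, _, _, _ => 0
  | m + 1, a, b, z =>
      ∑ x : Fin (m + 1) → Fin k,
        piv (x 0) * q (x 0) b * p (x (Fin.last m)) a *
          ∏ j : Fin m,
            q (x j.succ) (z (((j : ℕ) : ℤ) - (m : ℤ))) * p (x j.castSucc) (x j.succ)

/-- `Δ^{[n]}_{a,b,c}(z)`. -/
def Del {k l : ℕ} (p : Matrix (Fin k) (Fin k) ℝ) (q : Matrix (Fin k) (Fin l) ℝ)
    (piv : Fin k → ℝ) (n : ℕ) (a : Fin k) (b c : Fin l) (z : ℤ → Fin l) : ℝ :=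
  Spath p q piv n a b z / (∑ a' : Fin k, Spath p q piv n a' b z)
    - Spath p q piv n a c z / (∑ a' : Fin k, Spath p q piv n a' c z)

/-- `τ_z(a,b,c) = limsup_n (1/n) log |Δ^{[n]}_{a,b,c}(z)|`. -/
def tau {k l : ℕ} (p : Matrix (Fin k) (Fin k) ℝ) (q : Matrix (Fin k) (Fin l) ℝ)
    (piv : Fin k → ℝ) (z : ℤ → Fin l) (a : Fin k) (b c : Fin l) : ℝ :=
  Filter.limsup (fun n : ℕ => Real.log |Del p q piv n a b c z| / n) Filter.atTop

/-- `μ` is the law of the hidden Markov chain with transitions `p`, emissions `q`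
and initial (invariant) law `piv`: cylinder probabilities. -/
def IsHMMLaw {k l : ℕ} (p : Matrix (Fin k) (Fin k) ℝ) (q : Matrix (Fin k) (Fin l) ℝ)
    (piv : Fin k → ℝ) (μ : Measure (ℤ → Fin l)) : Prop :=
  ∀ (m : ℤ) (n : ℕ) (w : ℕ → Fin l),
    μ {z | ∀ t : ℕ, t ≤ n → z (m + t) = w t} =
      ENNReal.ofReal (∑ x : Fin (n + 1) → Fin k,
        piv (x 0) * q (x 0) (w 0) *
          ∏ j : Fin n, p (x j.castSucc) (x j.succ) * q (x j.succ) (w (j + 1)))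


/-- `Δ̃^{[n]}_{e,b,c}(z) = Σ_{a∈A} q(e|a) Δ^{[n]}_{a,b,c}(z)`. -/
def Delt {k l : ℕ} (p : Matrix (Fin k) (Fin k) ℝ) (q : Matrix (Fin k) (Fin l) ℝ)
    (piv : Fin k → ℝ) (n : ℕ) (e b c : Fin l) (z : ℤ → Fin l) : ℝ :=
  ∑ a : Fin k, q a e * Del p q piv n a b c z

/-- `τ̃_z(e,b,c) = limsup_n (1/n) log |Δ̃^{[n]}_{e,b,c}(z)|`. -/
def taut {k l : ℕ} (p : Matrix (Fin k) (Fin k) ℝ) (q : Matrix (Fin k) (Fin l) ℝ)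
    (piv : Fin k → ℝ) (z : ℤ → Fin l) (e b c : Fin l) : ℝ :=
  Filter.limsup (fun n : ℕ => Real.log |Delt p q piv n e b c z| / n) Filter.atTop

noncomputable section

/-! ### Part A : tensor powers of matrices -/

/-- Tensor product of a family of matrices. -/
def tens {R : Type} [Fintype R] {k : ℕ} (A : R → Matrix (Fin k) (Fin k) ℝ) :
    Matrix (R → Fin k) (R → Fin k) ℝ := Matrix.of fun i j => ∏ r, A r (i r) (j r)

lemma tens_mul {R : Type} [Fintype R] [DecidableEq R] {k : ℕ} (A B : R → Matrix (Fin k) (Fin k) ℝ) :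
    tens A * tens B = tens (fun r => A r * B r) := by
  ext i j
  simp only [tens, Matrix.mul_apply, Matrix.of_apply]
  rw [Finset.prod_univ_sum]
  simp only [Fintype.piFinset_univ, Finset.prod_mul_distrib]

lemma tens_diagonal {R : Type} [Fintype R] [DecidableEq R] {k : ℕ} (d : R → Fin k → ℝ) :
    tens (fun r => Matrix.diagonal (d r)) = Matrix.diagonal (fun i => ∏ r, d r (i r)) := by
  ext i j
  simp only [tens, Matrix.of_apply, Matrix.diagonal_apply]
  by_cases h : i = j
  · subst h; simp
  · rw [if_neg h]
    obtain ⟨r, hr⟩ := Function.ne_iff.mp h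
    exact Finset.prod_eq_zero (Finset.mem_univ r) (if_neg hr)

lemma tens_one {R : Type} [Fintype R] [DecidableEq R] {k : ℕ} :
    tens (fun _ : R => (1 : Matrix (Fin k) (Fin k) ℝ)) = 1 := by
  have := tens_diagonal (R := R) (fun _ => (fun _ : Fin k => (1 : ℝ)))
  simpa using this

/-- `R`-th tensor power. -/
def rho (R : Type) [Fintype R] {k : ℕ} (g : Matrix (Fin k) (Fin k) ℝ) :
    Matrix (R → Fin k) (R → Fin k) ℝ := tens (fun _ => g)

lemma rho_mul (R : Type) [Fintype R] [DecidableEq R] {k : ℕ} (g h : Matrix (Fin k) (Fin k) ℝ) :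
    rho R (g * h) = rho R g * rho R h := by
  simp [rho, tens_mul]

lemma rho_one (R : Type) [Fintype R] [DecidableEq R] {k : ℕ} :
    rho R (1 : Matrix (Fin k) (Fin k) ℝ) = 1 := tens_one

/-- Derivative of the tensor power. -/
def drho (R : Type) [Fintype R] [DecidableEq R] {k : ℕ} (X : Matrix (Fin k) (Fin k) ℝ) :
    Matrix (R → Fin k) (R → Fin k) ℝ :=
  ∑ r, tens (Function.update (fun _ => (1 : Matrix (Fin k) (Fin k) ℝ)) r X)

lemma tens_update_apply {R : Type} [Fintype R] [DecidableEq R] {k : ℕ}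
    (A : R → Matrix (Fin k) (Fin k) ℝ) (r : R) (X : Matrix (Fin k) (Fin k) ℝ) (i j : R → Fin k) :
    tens (Function.update A r X) i j
      = X (i r) (j r) * ∏ s ∈ Finset.univ.erase r, A s (i s) (j s) := by
  simp only [tens, Matrix.of_apply]
  rw [← Finset.mul_prod_erase _ _ (Finset.mem_univ r)]
  congr 1
  · simp
  · apply Finset.prod_congr rfl
    intro s hs
    rw [Function.update_of_ne (Finset.ne_of_mem_erase hs)]

lemma drho_add (R : Type) [Fintype R] [DecidableEq R] {k : ℕ} (X Y : Matrix (Fin k) (Fin k) ℝ) :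
    drho R (X + Y) = drho R X + drho R Y := by
  simp only [drho, ← Finset.sum_add_distrib]
  refine Finset.sum_congr rfl fun r _ => ?_
  ext i j
  simp [tens_update_apply, add_mul]

lemma drho_smul (R : Type) [Fintype R] [DecidableEq R] {k : ℕ} (c : ℝ)
    (X : Matrix (Fin k) (Fin k) ℝ) : drho R (c • X) = c • drho R X := by
  simp only [drho, Finset.smul_sum]
  refine Finset.sum_congr rfl fun r _ => ?_
  ext i j
  simp [tens_update_apply, mul_assoc]

lemma drho_zero (R : Type) [Fintype R] [DecidableEq R] {k : ℕ} :
    drho R (0 : Matrix (Fin k) (Fin k) ℝ) = 0 := by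
  have := drho_smul R 0 (0 : Matrix (Fin k) (Fin k) ℝ)
  simpa using this

lemma update_one_mul {R : Type} [DecidableEq R] {k : ℕ} (r : R) (X : Matrix (Fin k) (Fin k) ℝ)
    (B : R → Matrix (Fin k) (Fin k) ℝ) :
    (fun s => Function.update (fun _ => (1 : Matrix (Fin k) (Fin k) ℝ)) r X s * B s)
      = Function.update B r (X * B r) := by
  funext s
  by_cases h : s = r
  · subst h; simp
  · simp [Function.update_of_ne h]

lemma mul_update_one {R : Type} [DecidableEq R] {k : ℕ} (r : R) (X : Matrix (Fin k) (Fin k) ℝ)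
    (B : R → Matrix (Fin k) (Fin k) ℝ) :
    (fun s => B s * Function.update (fun _ => (1 : Matrix (Fin k) (Fin k) ℝ)) r X s)
      = Function.update B r (B r * X) := by
  funext s
  by_cases h : s = r
  · subst h; simp
  · simp [Function.update_of_ne h]

lemma drho_lie (R : Type) [Fintype R] [DecidableEq R] {k : ℕ} (X Y : Matrix (Fin k) (Fin k) ℝ) :
    drho R X * drho R Y - drho R Y * drho R X = drho R (X * Y - Y * X) := by
  have hsub : drho R (X * Y - Y * X) = drho R (X * Y) - drho R (Y * X) := by
    rw [sub_eq_add_neg, drho_add, ← neg_one_smul ℝ (Y * X), drho_smul]; simp [sub_eq_add_neg]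
  rw [hsub]
  simp only [drho, Finset.sum_mul_sum]
  rw [Finset.sum_comm (f := fun i j => tens (Function.update (fun _ => 1) i Y) *
    tens (Function.update (fun _ => 1) j X))]
  rw [← Finset.sum_sub_distrib, ← Finset.sum_sub_distrib]
  refine Finset.sum_congr rfl fun r _ => ?_
  rw [← Finset.sum_sub_distrib]
  rw [Finset.sum_eq_single r]
  · simp [tens_mul, update_one_mul]
  · intro s _ hs
    rw [tens_mul, tens_mul, update_one_mul, mul_update_one, sub_eq_zero]
    simp [Function.update_of_ne (Ne.symm hs)]
  · simp

lemma rho_drho (R : Type) [Fintype R] [DecidableEq R] {k : ℕ} (g X Y : Matrix (Fin k) (Fin k) ℝ)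
    (h : g * X = Y * g) : rho R g * drho R X = drho R Y * rho R g := by
  simp only [drho, rho, Finset.mul_sum, Finset.sum_mul]
  refine Finset.sum_congr rfl fun r _ => ?_
  rw [tens_mul, tens_mul, update_one_mul, mul_update_one, h]

lemma rho_diagonal (R : Type) [Fintype R] [DecidableEq R] {k : ℕ} (d : Fin k → ℝ) :
    rho R (Matrix.diagonal d) = Matrix.diagonal (fun i => ∏ r, d (i r)) := tens_diagonal _

lemma drho_diagonal (R : Type) [Fintype R] [DecidableEq R] {k : ℕ} (d : Fin k → ℝ) :
    drho R (Matrix.diagonal d) = Matrix.diagonal (fun i => ∑ r, d (i r)) := by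
  ext i j
  simp only [drho, Matrix.sum_apply, tens_update_apply, Matrix.diagonal_apply]
  by_cases h : i = j
  · subst h; simp
  · rw [if_neg h]
    refine Finset.sum_eq_zero fun r _ => ?_
    by_cases hr : i r = j r
    · obtain ⟨s, hs⟩ := Function.ne_iff.mp h
      have hsr : s ≠ r := by rintro rfl; exact hs hr
      rw [Finset.prod_eq_zero (i := s) (by simp [hsr]) (by simp [hs]), mul_zero]
    · simp [hr]

/-- A subspace invariant under a diagonal operator is invariant under functions of it. -/
lemma diag_interp {J : Type} [Fintype J] (F : Submodule ℝ (J → ℝ)) (t : J → ℝ)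
    (hF : ∀ v ∈ F, (fun j => t j * v j) ∈ F) (f : ℝ → ℝ) :
    ∀ v ∈ F, (fun j => f (t j) * v j) ∈ F := by
  classical
  have key : ∀ P : Polynomial ℝ, ∀ v ∈ F, (fun j => P.eval (t j) * v j) ∈ F := by
    intro P
    induction P using Polynomial.induction_on' with
    | add p q hp hq =>
      intro v hv
      have := F.add_mem (hp v hv) (hq v hv)
      convert this using 1
      funext j; simp [add_mul]
    | monomial n a =>
      intro v hv
      induction n with
      | zero =>
        have := F.smul_mem a hv
        convert this using 1
        funext j; simp
      | succ n ih =>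
        have := hF _ ih
        convert this using 1
        funext j; simp [pow_succ]; ring
  intro v hv
  have := key (Lagrange.interpolate (Finset.univ.image t) id f) v hv
  convert this using 1
  funext j
  have := Lagrange.eval_interpolate_at_node (s := Finset.univ.image t) (v := id) f
    (Function.injective_id.injOn) (i := t j) (by simp)
  simp only [id] at this
  rw [← this]

/-- Invariance under diagonal operators with the same level sets. -/
lemma diag_transfer {J : Type} [Fintype J] (F : Submodule ℝ (J → ℝ)) (t s : J → ℝ)
    (hF : ∀ v ∈ F, (fun j => t j * v j) ∈ F) (hts : ∀ i j, t i = t j → s i = s j) :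
    ∀ v ∈ F, (fun j => s j * v j) ∈ F := by
  classical
  intro v hv
  have := diag_interp F t hF (fun x => if h : ∃ j, t j = x then s h.choose else 0) v hv
  convert this using 1
  funext j
  have h : ∃ i, t i = t j := ⟨j, rfl⟩
  rw [dif_pos h, hts _ _ h.choose_spec]

end

noncomputable section

/-! ### Part B : the Lie algebra -/

attribute [local instance] LieRing.ofAssociativeRing

/-- The data extracted from the hidden Markov chain. -/
structure Sys (k l : ℕ) where
  a : Fin l → Matrix (Fin k) (Fin k) ℝ
  o : Fin l
  D : Fin l → Fin k → ℝ
  Dpos : ∀ z i, 0 < D z i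
  ha : ∀ z, a z = a o * Matrix.diagonal (D z)
  apos : ∀ i j, 0 < a o i j
  adet : IsUnit (a o).det
  Dspan : ∀ v : Fin k → ℝ, (∀ z, ∑ i, D z i * v i = 0) → v = 0
  kpos : 0 < k

namespace Sys

variable {k l : ℕ} (S : Sys k l)

/-- Product of the letters of a word (head leftmost). -/
def wd : List (Fin l) → Matrix (Fin k) (Fin k) ℝ
  | [] => 1
  | s :: w => S.a s * wd w

lemma det_a (z : Fin l) : IsUnit (S.a z).det := by
  rw [S.ha z, Matrix.det_mul, Matrix.det_diagonal]
  refine S.adet.mul (isUnit_iff_ne_zero.mpr ?_)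
  exact Finset.prod_ne_zero_iff.mpr fun i _ => (S.Dpos z i).ne'

lemma det_wd (u : List (Fin l)) : IsUnit (S.wd u).det := by
  induction u with
  | nil => simp [wd]
  | cons s u ih => rw [wd, Matrix.det_mul]; exact (S.det_a s).mul ih

lemma wd_append (u v : List (Fin l)) : S.wd (u ++ v) = S.wd u * S.wd v := by
  induction u with
  | nil => simp [wd]
  | cons s u ih => simp [wd, ih, Matrix.mul_assoc]

/-- Traceless logarithm. -/
def hh (z : Fin l) : Fin k → ℝ :=
  fun i => Real.log (S.D z i) - (∑ j, Real.log (S.D z j)) / k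

lemma sum_hh (z : Fin l) : ∑ i, S.hh z i = 0 := by
  have : (k : ℝ) ≠ 0 := by exact_mod_cast S.kpos.ne'
  simp only [hh, Finset.sum_sub_distrib, Finset.sum_const, Finset.card_univ, Fintype.card_fin,
    nsmul_eq_mul]
  field_simp
  ring

/-- Generators of the Lie algebra. -/
def gens : Set (Matrix (Fin k) (Fin k) ℝ) :=
  {X | ∃ (u : List (Fin l)) (z : Fin l),
    X = (S.wd u)⁻¹ * Matrix.diagonal (S.hh z) * S.wd u}

/-- The Lie algebra. -/
def nn : LieSubalgebra ℝ (Matrix (Fin k) (Fin k) ℝ) :=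
  LieSubalgebra.lieSpan ℝ _ S.gens

/-- The group elements. -/
def dl (u : List (Fin l)) (z : Fin l) : Matrix (Fin k) (Fin k) ℝ :=
  (S.wd u)⁻¹ * Matrix.diagonal (S.D z) * S.wd u

lemma trace_nn {X : Matrix (Fin k) (Fin k) ℝ} (hX : X ∈ S.nn) : X.trace = 0 := by
  induction hX using LieSubalgebra.lieSpan_induction with
  | mem X h =>
    obtain ⟨u, z, rfl⟩ := h
    rw [Matrix.trace_mul_comm, ← Matrix.mul_assoc, Matrix.mul_nonsing_inv _ (S.det_wd u),
      Matrix.one_mul, Matrix.trace_diagonal, S.sum_hh]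
  | zero => simp
  | add u v _ _ hu hv => simp [hu, hv]
  | smul t u _ hu => simp [hu]
  | lie u v _ _ _ _ => rw [Ring.lie_def, Matrix.trace_sub, Matrix.trace_mul_comm, sub_self]

lemma conj_nn (s : Fin l) {X : Matrix (Fin k) (Fin k) ℝ} (hX : X ∈ S.nn) :
    (S.a s)⁻¹ * X * S.a s ∈ S.nn := by
  have hd := S.det_a s
  induction hX using LieSubalgebra.lieSpan_induction with
  | mem X h =>
    obtain ⟨u, z, rfl⟩ := h
    apply LieSubalgebra.subset_lieSpan
    refine ⟨u ++ [s], z, ?_⟩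
    rw [wd_append, Matrix.mul_inv_rev]
    simp [wd, Matrix.mul_assoc]
  | zero => simp [LieSubalgebra.zero_mem]
  | add u v _ _ hu hv =>
    rw [Matrix.mul_add, Matrix.add_mul]; exact LieSubalgebra.add_mem _ hu hv
  | smul t u _ hu =>
    rw [Matrix.mul_smul, Matrix.smul_mul]; exact LieSubalgebra.smul_mem _ _ hu
  | lie u v _ _ hu hv =>
    have := LieSubalgebra.lie_mem _ hu hv
    convert this using 1
    simp only [Ring.lie_def, Matrix.mul_sub, Matrix.sub_mul]
    congr 1
    · calc (S.a s)⁻¹ * (u * v) * S.a s = (S.a s)⁻¹ * u * 1 * (v * S.a s) := by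
            simp [Matrix.mul_assoc]
        _ = _ := by rw [← Matrix.mul_nonsing_inv _ hd]; simp only [Matrix.mul_assoc]
    · calc (S.a s)⁻¹ * (v * u) * S.a s = (S.a s)⁻¹ * v * 1 * (u * S.a s) := by
            simp [Matrix.mul_assoc]
        _ = _ := by rw [← Matrix.mul_nonsing_inv _ hd]; simp only [Matrix.mul_assoc]

lemma conj_nn_wd (u : List (Fin l)) {X : Matrix (Fin k) (Fin k) ℝ} (hX : X ∈ S.nn) :
    (S.wd u)⁻¹ * X * S.wd u ∈ S.nn := by
  induction u generalizing X with
  | nil => simpa [wd] using hX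
  | cons s u ih =>
    have := ih (S.conj_nn s hX)
    rw [wd, Matrix.mul_inv_rev]
    simpa [Matrix.mul_assoc] using this

/-- General transfer of invariance between conjugated diagonal operators. -/
lemma conj_transfer {J : Type} [Fintype J] [DecidableEq J] (F : Submodule ℝ (J → ℝ))
    (U V : Matrix J J ℝ) (hUV : V * U = 1) (hVU : U * V = 1) (t s : J → ℝ)
    (hF : ∀ v ∈ F, (V * Matrix.diagonal t * U) *ᵥ v ∈ F)
    (hts : ∀ i j, t i = t j → s i = s j) :
    ∀ v ∈ F, (V * Matrix.diagonal s * U) *ᵥ v ∈ F := by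
  have key := diag_transfer (F.comap V.mulVecLin) t s ?_ hts
  · intro v hv
    have := key (U *ᵥ v) (by simp [Submodule.mem_comap, Matrix.mulVec_mulVec, hUV, hv])
    rw [Submodule.mem_comap, Matrix.mulVecLin_apply] at this
    convert this using 1
    rw [← Matrix.mulVec_mulVec, ← Matrix.mulVec_mulVec]
    congr 1
    funext j
    simp [Matrix.mulVec_diagonal]
  · intro v hv
    rw [Submodule.mem_comap, Matrix.mulVecLin_apply] at hv ⊢
    have := hF _ hv
    rw [Matrix.mulVec_mulVec, Matrix.mul_assoc, hVU, Matrix.mul_one, ← Matrix.mulVec_mulVec] at this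
    have e : (fun j => t j * v j) = Matrix.diagonal t *ᵥ v := by
      funext j; simp [Matrix.mulVec_diagonal]
    rw [e]; exact this

lemma wd_inv_mul (u : List (Fin l)) : (S.wd u)⁻¹ * S.wd u = 1 :=
  Matrix.nonsing_inv_mul _ (S.det_wd u)
lemma wd_mul_inv (u : List (Fin l)) : S.wd u * (S.wd u)⁻¹ = 1 :=
  Matrix.mul_nonsing_inv _ (S.det_wd u)

lemma rho_gen {R : Type} [Fintype R] [DecidableEq R] (u : List (Fin l)) (d : Fin k → ℝ) :
    rho R ((S.wd u)⁻¹ * Matrix.diagonal d * S.wd u)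
      = rho R (S.wd u)⁻¹ * Matrix.diagonal (fun i => ∏ r, d (i r)) * rho R (S.wd u) := by
  rw [rho_mul, rho_mul, rho_diagonal]

lemma drho_gen {R : Type} [Fintype R] [DecidableEq R] (u : List (Fin l)) (d : Fin k → ℝ) :
    drho R ((S.wd u)⁻¹ * Matrix.diagonal d * S.wd u)
      = rho R (S.wd u)⁻¹ * Matrix.diagonal (fun i => ∑ r, d (i r)) * rho R (S.wd u) := by
  have := rho_drho R (S.wd u)⁻¹ (Matrix.diagonal d)
    ((S.wd u)⁻¹ * Matrix.diagonal d * S.wd u) (by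
      rw [Matrix.mul_assoc _ (S.wd u), S.wd_mul_inv, Matrix.mul_one])
  rw [drho_diagonal] at this
  rw [this, Matrix.mul_assoc (drho R _), ← rho_mul, S.wd_inv_mul, rho_one, Matrix.mul_one]

lemma level {R : Type} [Fintype R] (z : Fin l) (i j : R → Fin k) :
    (∏ r, S.D z (i r) = ∏ r, S.D z (j r)) ↔ (∑ r, S.hh z (i r) = ∑ r, S.hh z (j r)) := by
  simp only [hh, Finset.sum_sub_distrib, sub_left_inj]
  rw [← Real.log_prod (fun r _ => (S.Dpos z (i r)).ne'),
    ← Real.log_prod (fun r _ => (S.Dpos z (j r)).ne')]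
  constructor
  · intro h; rw [h]
  · intro h
    exact Real.log_injOn_pos (Set.mem_Ioi.mpr (Finset.prod_pos fun r _ => S.Dpos z _))
      (Set.mem_Ioi.mpr (Finset.prod_pos fun r _ => S.Dpos z _)) h

/-- Lie-invariant subspaces of tensor powers. -/
def LInv {R : Type} [Fintype R] [DecidableEq R] (F : Submodule ℝ ((R → Fin k) → ℝ)) : Prop :=
  ∀ X ∈ S.nn, ∀ v ∈ F, drho R X *ᵥ v ∈ F

lemma linv_iff {R : Type} [Fintype R] [DecidableEq R] (F : Submodule ℝ ((R → Fin k) → ℝ)) :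
    S.LInv F ↔ ∀ u z, ∀ v ∈ F, rho R (S.dl u z) *ᵥ v ∈ F := by
  have e1 : ∀ u, rho R (S.wd u)⁻¹ * rho R (S.wd u) = 1 := fun u => by
    rw [← rho_mul, wd_inv_mul, rho_one]
  have e2 : ∀ u, rho R (S.wd u) * rho R (S.wd u)⁻¹ = 1 := fun u => by
    rw [← rho_mul, wd_mul_inv, rho_one]
  constructor
  · intro h u z v hv
    rw [dl, rho_gen]
    refine conj_transfer F _ _ (e1 u) (e2 u) (fun i => ∑ r, S.hh z (i r)) _ ?_ ?_ v hv
    · intro v hv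
      rw [← drho_gen]
      exact h _ (LieSubalgebra.subset_lieSpan ⟨u, z, rfl⟩) v hv
    · intro i j; exact (S.level z i j).mpr
  · intro h X hX
    induction hX using LieSubalgebra.lieSpan_induction with
    | mem X hX =>
      obtain ⟨u, z, rfl⟩ := hX
      intro v hv
      rw [drho_gen]
      refine conj_transfer F _ _ (e1 u) (e2 u) (fun i => ∏ r, S.D z (i r)) _ ?_ ?_ v hv
      · intro v hv
        rw [← rho_gen]
        exact h u z v hv
      · intro i j; exact (S.level z i j).mp
    | zero => intro v hv; simp [drho_zero]
    | add x y _ _ hx hy =>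
      intro v hv
      rw [drho_add, Matrix.add_mulVec]; exact F.add_mem (hx v hv) (hy v hv)
    | smul t x _ hx =>
      intro v hv
      rw [drho_smul, Matrix.smul_mulVec]; exact F.smul_mem _ (hx v hv)
    | lie x y _ _ hx hy =>
      intro v hv
      rw [Ring.lie_def, ← drho_lie, Matrix.sub_mulVec, ← Matrix.mulVec_mulVec,
        ← Matrix.mulVec_mulVec]
      exact F.sub_mem (hx _ (hy v hv)) (hy _ (hx v hv))

lemma hh_level (z : Fin l) (i j : Fin k) : S.D z i = S.D z j ↔ S.hh z i = S.hh z j := by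
  have := S.level (R := Unit) z (fun _ => i) (fun _ => j)
  simpa using this

/-- The diagonal vectors `D z` span. -/
lemma span_D : Submodule.span ℝ (Set.range S.D) = ⊤ := by
  by_contra hne
  obtain ⟨f, hf, hf'⟩ := Submodule.exists_le_ker_of_lt_top _ (lt_top_iff_ne_top.mpr hne)
  apply hf
  have hv := S.Dspan (fun i => f (Pi.single i 1)) (fun z => by
    have : f (S.D z) = 0 := hf' (Submodule.subset_span ⟨z, rfl⟩)
    rw [← this]
    conv_rhs => rw [← Finset.univ_sum_single (S.D z)]
    rw [map_sum]
    refine Finset.sum_congr rfl fun i _ => ?_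
    rw [← smul_eq_mul, ← map_smul, ← Pi.single_smul, smul_eq_mul, mul_one])
  refine LinearMap.pi_ext' fun i => LinearMap.ext_ring ?_
  simpa using congrFun hv i

lemma all_diag (F : Submodule ℝ (Fin k → ℝ))
    (hF : ∀ z, ∀ v ∈ F, (fun i => S.D z i * v i) ∈ F) (f : Fin k → ℝ) :
    ∀ v ∈ F, (fun i => f i * v i) ∈ F := by
  intro v hv
  have hf : f ∈ Submodule.span ℝ (Set.range S.D) := by rw [span_D]; trivial
  induction hf using Submodule.span_induction with
  | mem x hx => obtain ⟨z, rfl⟩ := hx; exact hF z v hv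
  | zero =>
    have e : (fun i => (0 : Fin k → ℝ) i * v i) = 0 := by funext i; simp
    rw [e]; exact F.zero_mem
  | add x y _ _ hx hy =>
    have := F.add_mem hx hy
    convert this using 1; funext i; simp [add_mul]
  | smul c x _ hx =>
    have := F.smul_mem c hx
    convert this using 1; funext i; simp [mul_assoc]

/-- Irreducibility, group form. -/
lemma irred_dl (F : Submodule ℝ (Fin k → ℝ))
    (hF : ∀ u z, ∀ v ∈ F, S.dl u z *ᵥ v ∈ F) (hne : F ≠ ⊥) : F = ⊤ := by
  obtain ⟨v, hv, hv0⟩ := (Submodule.ne_bot_iff _).mp hne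
  obtain ⟨i, hi⟩ := Function.ne_iff.mp hv0
  have h1 := S.all_diag F (fun z v hv => by
    have := hF [] z v hv
    simp only [dl, wd, inv_one, Matrix.one_mul, Matrix.mul_one] at this
    convert this using 1; funext i; simp [Matrix.mulVec_diagonal])
  have hei : (Pi.single i 1 : Fin k → ℝ) ∈ F := by
    have := h1 (Pi.single i (v i)⁻¹) v hv
    convert this using 1
    funext j
    by_cases h : j = i
    · subst h; simp at hi; simp [hi]
    · simp [h]
  have hA : (S.wd [S.o])⁻¹ * S.wd [S.o] = 1 := S.wd_inv_mul _
  have hA2 : S.wd [S.o] * (S.wd [S.o])⁻¹ = 1 := S.wd_mul_inv _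
  have h2 := S.all_diag (F.comap ((S.wd [S.o])⁻¹).mulVecLin) (fun z v hv => by
    rw [Submodule.mem_comap, Matrix.mulVecLin_apply] at hv ⊢
    have := hF [S.o] z _ hv
    rw [dl, Matrix.mulVec_mulVec, Matrix.mul_assoc, hA2, Matrix.mul_one,
      ← Matrix.mulVec_mulVec] at this
    have e : (fun i => S.D z i * v i) = Matrix.diagonal (S.D z) *ᵥ v := by
      funext j; simp [Matrix.mulVec_diagonal]
    rw [e]; exact this)
  have hall : ∀ w, w ∈ (F.comap ((S.wd [S.o])⁻¹).mulVecLin) := by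
    intro w
    have := h2 (fun j => w j / S.a S.o j i) (S.wd [S.o] *ᵥ Pi.single i 1) (by
      rw [Submodule.mem_comap, Matrix.mulVecLin_apply, Matrix.mulVec_mulVec, hA, Matrix.one_mulVec]; exact hei)
    convert this using 1
    funext j
    have := (S.apos j i).ne'
    simp [wd]
    field_simp
  rw [eq_top_iff]
  intro w _
  have := hall (S.wd [S.o] *ᵥ w)
  rw [Submodule.mem_comap, Matrix.mulVecLin_apply, Matrix.mulVec_mulVec, hA] at this
  simpa using this

/-- Irreducibility, Lie form. -/
lemma irred_nn (F : Submodule ℝ (Fin k → ℝ))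
    (hF : ∀ X ∈ S.nn, ∀ v ∈ F, X *ᵥ v ∈ F) (hne : F ≠ ⊥) : F = ⊤ := by
  refine S.irred_dl F (fun u z => ?_) hne
  refine conj_transfer F _ _ (S.wd_inv_mul u) (S.wd_mul_inv u) (S.hh z) _ ?_ ?_
  · intro v hv
    exact hF _ (LieSubalgebra.subset_lieSpan ⟨u, z, rfl⟩) v hv
  · intro i j; exact (S.hh_level z i j).mpr

lemma diag_hh_mem (z : Fin l) : Matrix.diagonal (S.hh z) ∈ S.nn :=
  LieSubalgebra.subset_lieSpan ⟨[], z, by simp [wd]⟩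

/-- The diagonal vectors of the Lie algebra. -/
def hs : Submodule ℝ (Fin k → ℝ) where
  carrier := {d | Matrix.diagonal d ∈ S.nn}
  zero_mem' := by
    show Matrix.diagonal (0 : Fin k → ℝ) ∈ S.nn
    have e : Matrix.diagonal (0 : Fin k → ℝ) = 0 := Matrix.diagonal_zero
    rw [e]; exact S.nn.zero_mem
  add_mem' := by
    intro x y hx hy
    have := S.nn.add_mem hx hy
    rwa [Matrix.diagonal_add] at this
  smul_mem' := by
    intro c x hx
    have := S.nn.smul_mem c hx
    rwa [← Matrix.diagonal_smul] at this

lemma mem_hs {d : Fin k → ℝ} : d ∈ S.hs ↔ Matrix.diagonal d ∈ S.nn := Iff.rfl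

lemma sep {i j : Fin k} (h : ∀ d ∈ S.hs, d i = d j) : i = j := by
  by_contra hij
  have : (Pi.single i 1 - Pi.single j 1 : Fin k → ℝ) = 0 := S.Dspan _ (fun z => by
      have h2 := (S.hh_level z i j).mpr (h _ (S.diag_hh_mem z))
      simp [mul_sub, Finset.sum_sub_distrib, Pi.single_apply, h2])
  have := congrFun this i
  simp [Pi.single_apply, hij] at this

/-- A generic diagonal element. -/
lemma exists_generic : ∃ h : Fin k → ℝ, h ∈ S.hs ∧ Function.Injective h ∧
    ∀ i j m n, h i - h j = h m - h n → ∀ d ∈ S.hs, d i - d j = d m - d n := by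
  let g : Fin k × Fin k × Fin k × Fin k → Module.Dual ℝ (Fin k → ℝ) := fun x =>
    ((LinearMap.proj x.1 : (Fin k → ℝ) →ₗ[ℝ] ℝ) - LinearMap.proj x.2.1) -
      ((LinearMap.proj x.2.2.1 : (Fin k → ℝ) →ₗ[ℝ] ℝ) - LinearMap.proj x.2.2.2)
  let f : {x : Fin k × Fin k × Fin k × Fin k // ∃ d ∈ S.hs, g x d ≠ 0} →
    Module.Dual ℝ (Fin k → ℝ) := fun x => g x.1
  obtain ⟨h, hp, hf⟩ := Module.Dual.exists_forall_mem_ne_zero_of_forall_exists S.hs f (fun x => x.2)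
  have key : ∀ i j m n, h i - h j = h m - h n → ∀ d ∈ S.hs, d i - d j = d m - d n := by
    intro i j m n hh d hd
    by_contra hne
    refine hf ⟨(i, j, m, n), d, hd, ?_⟩ ?_
    · simpa [g, sub_eq_zero] using hne
    · simpa [f, g, sub_eq_zero] using hh
  refine ⟨h, hp, ?_, key⟩
  intro i j hij
  apply S.sep
  intro d hd
  have := key i j i i (by simp [hij]) d hd
  simpa [sub_eq_zero] using this

/-- `ad` of a diagonal matrix, functional calculus on a stable subspace of matrices. -/
lemma ad_interp (Q : Submodule ℝ (Matrix (Fin k) (Fin k) ℝ)) (h : Fin k → ℝ)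
    (hQ : ∀ X ∈ Q, Matrix.diagonal h * X - X * Matrix.diagonal h ∈ Q) (f : ℝ → ℝ) :
    ∀ X ∈ Q, (Matrix.of fun i j => f (h i - h j) * X i j) ∈ Q := by
  let e : (Fin k × Fin k → ℝ) ≃ₗ[ℝ] Matrix (Fin k) (Fin k) ℝ := LinearEquiv.curry ℝ ℝ (Fin k) (Fin k)
  intro X hX
  have := diag_interp (Q.comap e.toLinearMap) (fun x => h x.1 - h x.2) ?_ f (e.symm X) (by simpa using hX)
  · exact this
  · intro v hv
    have h1 := hQ _ hv
    rw [Submodule.mem_comap]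
    have h2 : e (fun x => (h x.1 - h x.2) * v x) = Matrix.diagonal h * e v - e v * Matrix.diagonal h := by
      ext i j
      rw [Matrix.sub_apply, Matrix.diagonal_mul, Matrix.mul_diagonal]
      show (h i - h j) * v (i, j) = h i * v (i, j) - v (i, j) * h j
      ring
    rw [LinearEquiv.coe_coe, h2]
    exact h1

end Sys
end

noncomputable section

attribute [local instance] LieRing.ofAssociativeRing

namespace Sys

variable {k l : ℕ} (S : Sys k l)

/-- A generic diagonal element with a marked top index. -/
structure Gen (h : Fin k → ℝ) (t : Fin k) : Prop where
  mem : h ∈ S.hs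
  inj : Function.Injective h
  gen : ∀ i j m n, h i - h j = h m - h n → ∀ d ∈ S.hs, d i - d j = d m - d n
  top : ∀ i, h i ≤ h t

lemma exists_gen : ∃ h t, S.Gen h t := by
  obtain ⟨h, h1, h2, h3⟩ := S.exists_generic
  have : Nonempty (Fin k) := ⟨⟨0, S.kpos⟩⟩
  obtain ⟨t, ht⟩ := Finite.exists_max h
  exact ⟨h, t, h1, h2, h3, ht⟩

variable {S} {h : Fin k → ℝ} {t : Fin k}

lemma lie_mem' {X Y : Matrix (Fin k) (Fin k) ℝ} (hX : X ∈ S.nn) (hY : Y ∈ S.nn) :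
    X * Y - Y * X ∈ S.nn := S.nn.lie_mem hX hY

lemma Gen.comp (g : S.Gen h t) {X : Matrix (Fin k) (Fin k) ℝ} (hX : X ∈ S.nn) (f : ℝ → ℝ) :
    (Matrix.of fun i j => f (h i - h j) * X i j) ∈ S.nn :=
  ad_interp S.nn.toSubmodule h (fun _ hX => lie_mem' g.mem hX) f X hX

/-- Splitting into upper and lower part. -/
lemma Gen.split (g : S.Gen h t) {X : Matrix (Fin k) (Fin k) ℝ} (hX : X ∈ S.nn) :
    ∃ A ∈ S.nn, ∃ B ∈ S.nn, X = A + B ∧ (∀ i j, A i j ≠ 0 → h j ≤ h i) ∧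
      (∀ i j, B i j ≠ 0 → h i ≤ h j) := by
  refine ⟨_, g.comp hX (fun c => if 0 ≤ c then 1 else 0), _,
    g.comp hX (fun c => if 0 ≤ c then 0 else 1), ?_, ?_, ?_⟩
  · ext i j
    simp only [Matrix.add_apply, Matrix.of_apply]
    split_ifs <;> simp
  · intro i j hij
    simp only [Matrix.of_apply] at hij
    split_ifs at hij with h1
    · linarith
    · simp at hij
  · intro i j hij
    simp only [Matrix.of_apply] at hij
    split_ifs at hij with h1
    · simp at hij
    · linarith

lemma Gen.lemT (g : S.Gen h t) (U : Submodule ℝ (Fin k → ℝ))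
    (hU : ∀ X ∈ S.nn, (∀ i j, X i j ≠ 0 → h j ≤ h i) → ∀ v ∈ U, X *ᵥ v ∈ U)
    (hUt : ∀ v ∈ U, v t = 0) : U = ⊥ := by
  let C : Set (Submodule ℝ (Fin k → ℝ)) := {G | U ≤ G ∧
    ∀ Y ∈ S.nn, (∀ i j, Y i j ≠ 0 → h i ≤ h j) → ∀ v ∈ G, Y *ᵥ v ∈ G}
  let F := sInf C
  have hUF : U ≤ F := le_sInf fun G hG => hG.1
  have hFl : ∀ Y ∈ S.nn, (∀ i j, Y i j ≠ 0 → h i ≤ h j) → ∀ v ∈ F, Y *ᵥ v ∈ F := by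
    intro Y hY hYl v hv
    rw [Submodule.mem_sInf] at hv ⊢
    intro G hG
    exact hG.2 Y hY hYl v (hv G hG)
  let F' : Submodule ℝ (Fin k → ℝ) :=
    { carrier := {v | v ∈ F ∧ ∀ Z ∈ S.nn, (∀ i j, Z i j ≠ 0 → h j ≤ h i) → Z *ᵥ v ∈ F}
      zero_mem' := ⟨F.zero_mem, fun Z _ _ => by rw [Matrix.mulVec_zero]; exact F.zero_mem⟩
      add_mem' := fun {x y} hx hy => ⟨F.add_mem hx.1 hy.1, fun Z h1 h2 => by
        rw [Matrix.mulVec_add]; exact F.add_mem (hx.2 Z h1 h2) (hy.2 Z h1 h2)⟩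
      smul_mem' := fun c x hx => ⟨F.smul_mem _ hx.1, fun Z h1 h2 => by
        rw [Matrix.mulVec_smul]; exact F.smul_mem _ (hx.2 Z h1 h2)⟩ }
  have hF' : F ≤ F' := by
    refine sInf_le ⟨fun v hv => ⟨hUF hv, fun Z h1 h2 => hUF (hU Z h1 h2 v hv)⟩, ?_⟩
    rintro Y hY hYl v ⟨hv1, hv2⟩
    refine ⟨hFl Y hY hYl v hv1, fun Z h1 h2 => ?_⟩
    obtain ⟨A, hA, B, hB, hAB, hAu, hBl⟩ := g.split (lie_mem' h1 hY)
    have : Z *ᵥ (Y *ᵥ v) = Y *ᵥ (Z *ᵥ v) + (A *ᵥ v + B *ᵥ v) := by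
      rw [← Matrix.add_mulVec, ← hAB, Matrix.sub_mulVec, Matrix.mulVec_mulVec, Matrix.mulVec_mulVec]
      abel
    rw [this]
    exact F.add_mem (hFl Y hY hYl _ (hv2 Z h1 h2)) (F.add_mem (hv2 A hA hAu) (hFl B hB hBl v hv1))
  have hFn : ∀ X ∈ S.nn, ∀ v ∈ F, X *ᵥ v ∈ F := by
    intro X hX v hv
    obtain ⟨A, hA, B, hB, hAB, hAu, hBl⟩ := g.split hX
    rw [hAB, Matrix.add_mulVec]
    exact F.add_mem ((hF' hv).2 A hA hAu) (hFl B hB hBl v hv)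
  have hFt : F ≤ LinearMap.ker (LinearMap.proj t : (Fin k → ℝ) →ₗ[ℝ] ℝ) := by
    refine sInf_le ⟨fun v hv => by simpa using hUt v hv, ?_⟩
    intro Y hY hYl v hv
    simp only [LinearMap.mem_ker, LinearMap.proj_apply] at hv ⊢
    rw [Matrix.mulVec, dotProduct]
    refine Finset.sum_eq_zero fun j _ => ?_
    by_cases hj : Y t j = 0
    · simp [hj]
    · have : j = t := g.inj (le_antisymm (g.top j) (hYl t j hj))
      simp [this, hv]
  by_contra hne
  have hFne : F ≠ ⊥ := fun h0 => hne (le_bot_iff.mp (h0 ▸ hUF))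
  have := S.irred_nn F hFn hFne
  have h1 : (Pi.single t 1 : Fin k → ℝ) ∈ F := by rw [this]; trivial
  have := hFt h1
  simp at this

/-- Nondegeneracy of the trace form. -/
lemma Gen.nondeg (g : S.Gen h t) {X : Matrix (Fin k) (Fin k) ℝ} (hX : X ∈ S.nn)
    (hX0 : ∀ Y ∈ S.nn, (X * Y).trace = 0) : X = 0 := by
  let K : Submodule ℝ (Matrix (Fin k) (Fin k) ℝ) :=
    { carrier := {X | X ∈ S.nn ∧ ∀ Y ∈ S.nn, (X * Y).trace = 0}
      zero_mem' := ⟨S.nn.zero_mem, fun Y _ => by simp⟩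
      add_mem' := fun {x y} hx hy => ⟨S.nn.add_mem hx.1 hy.1, fun Z h1 => by
        rw [Matrix.add_mul, Matrix.trace_add, hx.2 Z h1, hy.2 Z h1, add_zero]⟩
      smul_mem' := fun c x hx => ⟨S.nn.smul_mem _ hx.1, fun Z h1 => by
        rw [Matrix.smul_mul, Matrix.trace_smul, hx.2 Z h1, smul_zero]⟩ }
  have hK : ∀ Z ∈ S.nn, ∀ X ∈ K, Z * X - X * Z ∈ K := by
    rintro Z hZ X ⟨hX1, hX2⟩
    refine ⟨lie_mem' hZ hX1, fun Y hY => ?_⟩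
    have := hX2 _ (lie_mem' hY hZ)
    rw [Matrix.sub_mul, Matrix.trace_sub, Matrix.mul_assoc, Matrix.trace_mul_comm Z, ← this,
      Matrix.mul_sub, Matrix.trace_sub]
    simp only [Matrix.mul_assoc]
  have hKd : ∀ X ∈ K, ∀ i, X i i = 0 := by
    intro X hX i
    have h1 := ad_interp K h (fun X hX => hK _ g.mem X hX) (fun c => if c = 0 then 1 else 0) X hX
    have h2 := h1.2 _ h1.1
    have h3 : (Matrix.of fun i j => (if h i - h j = 0 then (1:ℝ) else 0) * X i j)
        = Matrix.diagonal (fun i => X i i) := by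
      ext a b
      by_cases hab : a = b
      · subst hab; simp
      · have : h a - h b ≠ 0 := fun h0 => hab (g.inj (sub_eq_zero.mp h0))
        simp [hab, this]
    rw [h3, Matrix.diagonal_mul_diagonal, Matrix.trace_diagonal] at h2
    have := (Finset.sum_eq_zero_iff_of_nonneg (fun i _ => mul_self_nonneg _)).mp h2 i (Finset.mem_univ _)
    simpa using this
  have hcol : ∀ X ∈ K, X *ᵥ Pi.single t 1 = 0 := by
    let φ : Matrix (Fin k) (Fin k) ℝ →ₗ[ℝ] (Fin k → ℝ) :=
      { toFun := fun X => X *ᵥ Pi.single t 1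
        map_add' := fun X Y => Matrix.add_mulVec _ _ _
        map_smul' := fun c X => Matrix.smul_mulVec _ _ _ }
    have := g.lemT (K.map φ) ?_ ?_
    · intro X hX
      have h1 : φ X ∈ K.map φ := Submodule.mem_map_of_mem hX
      rw [this] at h1
      exact (Submodule.mem_bot ℝ).mp h1
    · rintro Z hZ hZu _ ⟨X, hX, rfl⟩
      have e1 : Z *ᵥ Pi.single t 1 = Z t t • (Pi.single t 1 : Fin k → ℝ) := by
        funext i
        by_cases hi : i = t
        · subst hi; simp
        · have : Z i t = 0 := by
            by_contra h0
            exact hi (g.inj (le_antisymm (g.top i) (hZu i t h0)))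
          simp [hi, this]
      have e2 : Z *ᵥ φ X = φ (Z * X - X * Z) + Z t t • φ X := by
        show Z *ᵥ (X *ᵥ _) = (Z * X - X * Z) *ᵥ _ + Z t t • (X *ᵥ _)
        rw [← Matrix.mulVec_smul, ← e1, Matrix.sub_mulVec, Matrix.mulVec_mulVec, Matrix.mulVec_mulVec]
        abel
      rw [e2]
      exact Submodule.add_mem _ (Submodule.mem_map_of_mem (hK Z hZ X hX))
        (Submodule.smul_mem _ _ (Submodule.mem_map_of_mem hX))
    · rintro _ ⟨X, hX, rfl⟩
      show (X *ᵥ Pi.single t 1) t = 0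
      simp [hKd X hX]
  let F : Submodule ℝ (Fin k → ℝ) :=
    { carrier := {v | ∀ X ∈ K, X *ᵥ v = 0}
      zero_mem' := fun X _ => Matrix.mulVec_zero _
      add_mem' := fun {x y} hx hy X hX => by rw [Matrix.mulVec_add, hx X hX, hy X hX, add_zero]
      smul_mem' := fun c x hx X hX => by rw [Matrix.mulVec_smul, hx X hX, smul_zero] }
  have hF := S.irred_nn F (fun Z hZ v hv X hX => by
    have h1 := hv _ (hK Z hZ X hX)
    rw [Matrix.sub_mulVec, ← Matrix.mulVec_mulVec, hv X hX, Matrix.mulVec_zero, zero_sub,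
      neg_eq_zero, ← Matrix.mulVec_mulVec] at h1
    exact h1) (by
      rw [Submodule.ne_bot_iff]
      exact ⟨Pi.single t 1, hcol, by simp⟩)
  ext i j
  have h1 : (Pi.single j 1 : Fin k → ℝ) ∈ F := by rw [hF]; trivial
  have := congrFun (h1 X ⟨hX, hX0⟩) i
  simpa using this

lemma Gen.center (g : S.Gen h t) {X : Matrix (Fin k) (Fin k) ℝ} (hX : X ∈ S.nn)
    (hX0 : ∀ Y ∈ S.nn, X * Y = Y * X) : X = 0 := by
  have hd : ∀ i j, i ≠ j → X i j = 0 := by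
    intro i j hij
    have := congrFun (congrFun (hX0 _ g.mem) i) j
    rw [Matrix.mul_diagonal, Matrix.diagonal_mul] at this
    have h2 : h i - h j ≠ 0 := fun h0 => hij (g.inj (sub_eq_zero.mp h0))
    have h3 : (h i - h j) * X i j = 0 := by linarith
    exact (mul_eq_zero.mp h3).resolve_left h2
  let F : Submodule ℝ (Fin k → ℝ) := LinearMap.ker (X.mulVecLin - X t t • LinearMap.id)
  have hF := S.irred_nn F (fun Z hZ v hv => by
    simp only [F, LinearMap.mem_ker, LinearMap.sub_apply, Matrix.mulVecLin_apply,
      LinearMap.smul_apply, LinearMap.id_apply, sub_eq_zero] at hv ⊢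
    rw [Matrix.mulVec_mulVec, hX0 Z hZ, ← Matrix.mulVec_mulVec, hv, Matrix.mulVec_smul]) (by
      rw [Submodule.ne_bot_iff]
      refine ⟨Pi.single t 1, ?_, by simp⟩
      simp only [F, LinearMap.mem_ker, LinearMap.sub_apply, Matrix.mulVecLin_apply,
        LinearMap.smul_apply, LinearMap.id_apply, sub_eq_zero]
      funext i
      by_cases hi : i = t
      · subst hi; simp
      · simp [hi, hd i t hi])
  have hX1 : ∀ i j, X i j = X t t * (if i = j then 1 else 0) := by
    intro i j
    have h1 : (Pi.single j 1 : Fin k → ℝ) ∈ F := by rw [hF]; trivial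
    simp only [F, LinearMap.mem_ker, LinearMap.sub_apply, Matrix.mulVecLin_apply,
        LinearMap.smul_apply, LinearMap.id_apply, sub_eq_zero] at h1
    have := congrFun h1 i
    simpa [Pi.single_apply] using this
  have htr := S.trace_nn hX
  have hk : (k : ℝ) ≠ 0 := by exact_mod_cast S.kpos.ne'
  have h0 : X t t = 0 := by
    rw [Matrix.trace] at htr
    have : ∀ i, X.diag i = X t t := fun i => by rw [Matrix.diag_apply, hX1]; simp
    simp only [this, Finset.sum_const, Finset.card_univ, Fintype.card_fin, nsmul_eq_mul] at htr
    exact (mul_eq_zero.mp htr).resolve_left hk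
  ext i j
  rw [hX1, h0]; simp

/-- The Lie algebra is perfect. -/
lemma perfect : Submodule.span ℝ {Z | ∃ X ∈ S.nn, ∃ Y ∈ S.nn, Z = X * Y - Y * X}
    = S.nn.toSubmodule := by
  obtain ⟨h, t, g⟩ := S.exists_gen
  set B := Submodule.span ℝ {Z | ∃ X ∈ S.nn, ∃ Y ∈ S.nn, Z = X * Y - Y * X} with hB
  have hle : B ≤ S.nn.toSubmodule := by
    rw [hB, Submodule.span_le]
    rintro _ ⟨X, hX, Y, hY, rfl⟩
    exact lie_mem' hX hY
  refine Submodule.eq_of_le_of_finrank_le hle ?_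
  let Φ : S.nn.toSubmodule →ₗ[ℝ] Module.Dual ℝ B :=
    LinearMap.mk₂ ℝ (fun x b => ((x : Matrix (Fin k) (Fin k) ℝ) * (b : Matrix (Fin k) (Fin k) ℝ)).trace)
      (fun x y b => by simp [Matrix.add_mul])
      (fun c x b => by simp)
      (fun x b c => by simp [Matrix.mul_add])
      (fun c x b => by simp)
  have hinj : Function.Injective Φ := by
    rw [← LinearMap.ker_eq_bot, Submodule.eq_bot_iff]
    rintro ⟨x, hx⟩ hx0
    have h1 : ∀ b ∈ B, (x * b).trace = 0 := fun b hb => LinearMap.congr_fun hx0 ⟨b, hb⟩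
    have : x = 0 := by
      refine g.center hx fun Y hY => ?_
      rw [← sub_eq_zero]
      refine g.nondeg (lie_mem' hx hY) fun Z hZ => ?_
      have := h1 _ (Submodule.subset_span ⟨Y, hY, Z, hZ, rfl⟩)
      rw [← this, Matrix.sub_mul, Matrix.trace_sub, Matrix.mul_sub, Matrix.trace_sub,
        Matrix.mul_assoc Y x Z, Matrix.trace_mul_comm Y]
      simp only [Matrix.mul_assoc]
    simpa using this
  calc Module.finrank ℝ S.nn.toSubmodule ≤ Module.finrank ℝ (Module.Dual ℝ B) :=
        LinearMap.finrank_le_finrank_of_injective hinj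
    _ = Module.finrank ℝ B := Subspace.dual_finrank_eq

end Sys
end

noncomputable section

attribute [local instance] LieRing.ofAssociativeRing

namespace Sys

variable {k l : ℕ} {S : Sys k l} {h : Fin k → ℝ} {t : Fin k}

/-- Homogeneous component. -/
lemma Gen.hom (g : S.Gen h t) {X : Matrix (Fin k) (Fin k) ℝ} (hX : X ∈ S.nn) (c : ℝ) :
    ∃ Y ∈ S.nn, (∀ i j, Y i j ≠ 0 → h i - h j = c) ∧ (∀ i j, h i - h j = c → Y i j = X i j) := by
  refine ⟨_, g.comp hX (fun x => if x = c then 1 else 0), ?_, ?_⟩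
  · intro i j hij
    by_contra hne
    simp [hne] at hij
  · intro i j hij
    simp [hij]

/-- The root lemma. -/
lemma Gen.root (g : S.Gen h t) {X : Matrix (Fin k) (Fin k) ℝ} (hX : X ∈ S.nn) (hX0 : X ≠ 0)
    {i j : Fin k} (hij : i ≠ j) (hc : ∀ a b, X a b ≠ 0 → h a - h b = h i - h j) :
    X i j ≠ 0 ∧ ∃ Y ∈ S.nn, (∀ a b, Y a b ≠ 0 → h a - h b = h j - h i) ∧ Y j i ≠ 0 := by
  obtain ⟨Y0, hY0, hτ0⟩ : ∃ Y ∈ S.nn, (X * Y).trace ≠ 0 := by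
    by_contra hcon
    push Not at hcon
    exact hX0 (g.nondeg hX hcon)
  obtain ⟨Y, hY, hYc, hYe⟩ := g.hom hY0 (h j - h i)
  have hc0 : h i - h j ≠ 0 := fun h0 => hij (g.inj (sub_eq_zero.mp h0))
  have hτ : (X * Y).trace ≠ 0 := by
    convert hτ0 using 1
    simp only [Matrix.trace, Matrix.diag_apply, Matrix.mul_apply]
    refine Finset.sum_congr rfl fun a _ => Finset.sum_congr rfl fun b _ => ?_
    by_cases hab : X a b = 0
    · simp [hab]
    · rw [hYe b a (by linarith [hc a b hab])]
  set τ := (X * Y).trace with hτdef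
  have hτs : τ = ∑ a, ∑ b, X a b * Y b a := by
    simp only [hτdef, Matrix.trace, Matrix.diag_apply, Matrix.mul_apply]
  let d : Fin k → ℝ := fun a => ∑ b, (X a b * Y b a - Y a b * X b a)
  have hH : X * Y - Y * X = Matrix.diagonal d := by
    ext a b
    by_cases hab : a = b
    · subst hab
      simp [d, Matrix.mul_apply]
    · rw [Matrix.diagonal_apply_ne _ hab, Matrix.sub_apply, Matrix.mul_apply, Matrix.mul_apply,
        ← Finset.sum_sub_distrib]
      refine Finset.sum_eq_zero fun m _ => ?_
      have e1 : X a m * Y m b = 0 := by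
        by_contra hne
        have h1 := hc a m (left_ne_zero_of_mul hne)
        have h2 := hYc m b (right_ne_zero_of_mul hne)
        exact hab (g.inj (by linarith))
      have e2 : Y a m * X m b = 0 := by
        by_contra hne
        have h1 := hYc a m (left_ne_zero_of_mul hne)
        have h2 := hc m b (right_ne_zero_of_mul hne)
        exact hab (g.inj (by linarith))
      rw [e1, e2, sub_zero]
  have hdm : d ∈ S.hs := by rw [mem_hs, ← hH]; exact lie_mem' hX hY
  have key : ∀ w : Fin k → ℝ, ∑ a, w a * d a = ∑ a, ∑ b, (w a - w b) * (X a b * Y b a) := by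
    intro w
    have e1 : ∑ a, ∑ b, w a * (Y a b * X b a) = ∑ a, ∑ b, w b * (X a b * Y b a) := by
      rw [Finset.sum_comm]
      refine Finset.sum_congr rfl fun a _ => Finset.sum_congr rfl fun b _ => by ring
    simp only [d, Finset.mul_sum, mul_sub, sub_mul, Finset.sum_sub_distrib, e1]
  set s := d i - d j with hs
  have hXd : ∀ a b, X a b ≠ 0 → d a - d b = s := fun a b hab => g.gen a b i j (hc a b hab) d hdm
  have h1 : ∑ a, h a * d a = (h i - h j) * τ := by
    rw [key, hτs, Finset.mul_sum]
    refine Finset.sum_congr rfl fun a _ => ?_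
    rw [Finset.mul_sum]
    refine Finset.sum_congr rfl fun b _ => ?_
    by_cases hab : X a b = 0
    · simp [hab]
    · rw [hc a b hab]
  have h2 : ∑ a, d a * d a = s * τ := by
    rw [key, hτs, Finset.mul_sum]
    refine Finset.sum_congr rfl fun a _ => ?_
    rw [Finset.mul_sum]
    refine Finset.sum_congr rfl fun b _ => ?_
    by_cases hab : X a b = 0
    · simp [hab]
    · rw [hXd a b hab]
  have hs0 : s ≠ 0 := by
    intro h0
    rw [h0, zero_mul] at h2
    have h3 := (Finset.sum_eq_zero_iff_of_nonneg (fun i _ => mul_self_nonneg _)).mp h2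
    have h4 : ∑ a, h a * d a = 0 := Finset.sum_eq_zero fun a ha => by
      rw [mul_self_eq_zero.mp (h3 a ha), mul_zero]
    rw [h1] at h4
    exact (mul_ne_zero hc0 hτ) h4
  have main : X i j * Y j i ≠ 0 := by
    intro h0
    classical
    let P : Fin k → Prop := fun a => ∃ n : ℕ, h a = h i + n * (h i - h j) ∧ d a = d i + n * s
    let P2 : Fin k → Prop := fun a => ∃ n : ℕ, h a = h j - n * (h i - h j) ∧ d a = d j - n * s
    have hz : ∀ w : Fin k → ℝ, (∀ a b, X a b * Y b a ≠ 0 → w a = w b) → ∑ a, w a * d a = 0 := by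
      intro w hw
      rw [key]
      refine Finset.sum_eq_zero fun a _ => Finset.sum_eq_zero fun b _ => ?_
      by_cases hab : X a b * Y b a = 0
      · rw [hab, mul_zero]
      · rw [hw a b hab, sub_self, zero_mul]
    have hP : ∀ a b, X a b * Y b a ≠ 0 → (P a ↔ P b) := by
      intro a b hab
      have e1 := hc a b (left_ne_zero_of_mul hab)
      have e2 := hXd a b (left_ne_zero_of_mul hab)
      constructor
      · rintro ⟨n, hn1, hn2⟩
        rcases n with _ | n
        · have : a = i := g.inj (by simpa using hn1)
          subst this
          have : b = j := g.inj (by linarith)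
          subst this
          exact absurd h0 hab
        · refine ⟨n, ?_, ?_⟩ <;> push_cast at hn1 hn2 <;> linarith
      · rintro ⟨n, hn1, hn2⟩
        refine ⟨n + 1, ?_, ?_⟩ <;> push_cast <;> linarith
    have hP2 : ∀ a b, X a b * Y b a ≠ 0 → (P2 a ↔ P2 b) := by
      intro a b hab
      have e1 := hc a b (left_ne_zero_of_mul hab)
      have e2 := hXd a b (left_ne_zero_of_mul hab)
      constructor
      · rintro ⟨n, hn1, hn2⟩
        refine ⟨n + 1, ?_, ?_⟩ <;> push_cast <;> linarith
      · rintro ⟨n, hn1, hn2⟩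
        rcases n with _ | n
        · have : b = j := g.inj (by simpa using hn1)
          subst this
          have : a = i := g.inj (by linarith)
          subst this
          exact absurd h0 hab
        · refine ⟨n, ?_, ?_⟩ <;> push_cast at hn1 hn2 <;> linarith
    have s1 := hz (fun a => if P a then 1 else 0) (fun a b hab => by simp only [hP a b hab])
    have s2 := hz (fun a => if P2 a then 1 else 0) (fun a b hab => by simp only [hP2 a b hab])
    have hsi : s * d i ≤ 0 := by
      by_contra hpos
      push Not at hpos
      have : 0 < ∑ a, s * ((if P a then 1 else 0) * d a) := by
        refine Finset.sum_pos' (fun a _ => ?_) ⟨i, Finset.mem_univ _, ?_⟩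
        · by_cases ha : P a
          · simp only [ha, if_true, one_mul]
            obtain ⟨n, _, hn⟩ := ha
            rw [hn]
            have : 0 ≤ (n : ℝ) * s ^ 2 := by positivity
            nlinarith
          · simp [ha]
        · have : P i := ⟨0, by simp, by simp⟩
          simp [this, hpos]
      rw [← Finset.mul_sum, s1, mul_zero] at this
      exact lt_irrefl _ this
    have hdj : d j = d i - s := by rw [hs]; ring
    have hss : 0 < s ^ 2 := by positivity
    have : ∑ a, s * ((if P2 a then 1 else 0) * d a) < 0 := by
      rw [← neg_pos, ← Finset.sum_neg_distrib]
      refine Finset.sum_pos' (fun a _ => ?_) ⟨j, Finset.mem_univ _, ?_⟩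
      · by_cases ha : P2 a
        · simp only [ha, if_true, one_mul]
          obtain ⟨n, _, hn⟩ := ha
          rw [hn, hdj]
          have : 0 ≤ (n : ℝ) * s ^ 2 := by positivity
          nlinarith
        · simp [ha]
      · have : P2 j := ⟨0, by simp, by simp⟩
        simp only [this, if_true, one_mul, hdj]
        nlinarith
    rw [← Finset.mul_sum, s2, mul_zero] at this
    exact lt_irrefl _ this
  exact ⟨left_ne_zero_of_mul main, Y, hY, hYc, right_ne_zero_of_mul main⟩

/-- Indices just below the top. -/
def Lam (S : Sys k l) (h : Fin k → ℝ) (t : Fin k) (m : Fin k) : Prop :=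
  m ≠ t ∧ ∀ X ∈ S.nn, ∀ j, h m < h j → j ≠ t → X j m = 0

lemma Gen.lamX (g : S.Gen h t) {m : Fin k} (hm : Lam S h t m) :
    ∃ X ∈ S.nn, (∀ a b, X a b ≠ 0 → h a - h b = h t - h m) ∧ X t m ≠ 0 := by
  by_contra hcon
  push Not at hcon
  have h0 : ∀ X ∈ S.nn, X t m = 0 := by
    intro X hX
    obtain ⟨Y, hY, hYc, hYe⟩ := g.hom hX (h t - h m)
    rw [← hYe t m rfl]
    exact hcon Y hY hYc
  have := g.lemT (Submodule.span ℝ {Pi.single m 1}) ?_ ?_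
  · rw [Submodule.span_singleton_eq_bot] at this
    simp at this
  · intro X hX hXu v hv
    obtain ⟨c, rfl⟩ := Submodule.mem_span_singleton.mp hv
    rw [Submodule.mem_span_singleton]
    refine ⟨c * X m m, ?_⟩
    funext i
    by_cases hi : i = m
    · subst hi; simp [Matrix.mulVec_smul]
    · have : X i m = 0 := by
        by_cases hit : i = t
        · rw [hit]; exact h0 X hX
        · by_contra hne
          have h1 := hXu i m hne
          have h2 : h m < h i := lt_of_le_of_ne h1 (fun h => hi (g.inj h.symm))
          exact hne (hm.2 X hX i h2 hit)
      simp [Matrix.mulVec_smul, hi, this]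
  · intro v hv
    obtain ⟨c, rfl⟩ := Submodule.mem_span_singleton.mp hv
    simp [Ne.symm hm.1]

lemma Gen.lamComm (g : S.Gen h t) {m n : Fin k} (hm : Lam S h t m) (hn : Lam S h t n)
    (hmn : m ≠ n) {X Y : Matrix (Fin k) (Fin k) ℝ} (hX : X ∈ S.nn) (hY : Y ∈ S.nn)
    (hXc : ∀ a b, X a b ≠ 0 → h a - h b = h t - h m)
    (hYc : ∀ a b, Y a b ≠ 0 → h a - h b = h n - h t) : X * Y = Y * X := by
  by_contra hne
  have hZ := lie_mem' hX hY
  have hZ0 : X * Y - Y * X ≠ 0 := fun h0 => hne (sub_eq_zero.mp h0)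
  have hZc : ∀ a b, (X * Y - Y * X) a b ≠ 0 → h a - h b = h n - h m := by
    intro a b hab
    by_contra hcon
    apply hab
    rw [Matrix.sub_apply, Matrix.mul_apply, Matrix.mul_apply, ← Finset.sum_sub_distrib]
    refine Finset.sum_eq_zero fun c _ => ?_
    have e1 : X a c * Y c b = 0 := by
      by_contra h1
      have h2 := hXc a c (left_ne_zero_of_mul h1)
      have h3 := hYc c b (right_ne_zero_of_mul h1)
      exact hcon (by linarith)
    have e2 : Y a c * X c b = 0 := by
      by_contra h1
      have h2 := hYc a c (left_ne_zero_of_mul h1)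
      have h3 := hXc c b (right_ne_zero_of_mul h1)
      exact hcon (by linarith)
    rw [e1, e2, sub_zero]
  obtain ⟨h1, Y', hY', _, h2⟩ := g.root hZ hZ0 hmn.symm hZc
  rcases lt_trichotomy (h m) (h n) with h3 | h3 | h3
  · exact h1 (hm.2 _ hZ n h3 hn.1)
  · exact hmn (g.inj h3)
  · exact h2 (hn.2 _ hY' m h3 hm.1)

lemma Gen.mulVec_hom (g : S.Gen h t) {X : Matrix (Fin k) (Fin k) ℝ} {i j : Fin k}
    (hXc : ∀ a b, X a b ≠ 0 → h a - h b = h i - h j) :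
    X *ᵥ Pi.single j 1 = X i j • (Pi.single i 1 : Fin k → ℝ) := by
  funext a
  by_cases ha : a = i
  · subst ha; simp
  · have : X a j = 0 := by
      by_contra h0
      exact ha (g.inj (by linarith [hXc a j h0]))
    simp [ha, this]

/-- Existence of the cube of weights. -/
lemma Gen.cube (g : S.Gen h t) : ∀ L : List (Fin k), L.Nodup → (∀ m ∈ L, Lam S h t m) →
    ∃ i, ∀ d ∈ S.hs, d i = d t - (L.map fun m => d t - d m).sum := by
  intro L hL hLam
  have hXY : ∀ m, ∃ X Y : Matrix (Fin k) (Fin k) ℝ, Lam S h t m → X ∈ S.nn ∧ Y ∈ S.nn ∧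
      (∀ a b, X a b ≠ 0 → h a - h b = h t - h m) ∧ (∀ a b, Y a b ≠ 0 → h a - h b = h m - h t) ∧
      X t m ≠ 0 ∧ Y m t ≠ 0 := by
    intro m
    by_cases hm : Lam S h t m
    · obtain ⟨X, hX, hXc, hX0⟩ := g.lamX hm
      obtain ⟨_, Y, hY, hYc, hY0⟩ := g.root hX (fun h0 => hX0 (by simp [h0])) hm.1.symm hXc
      exact ⟨X, Y, fun _ => ⟨hX, hY, hXc, hYc, hX0, hY0⟩⟩
    · exact ⟨0, 0, fun h => absurd h hm⟩
  choose X Y hXY using hXY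
  -- existence of a nonzero weight vector
  have main : ∃ A : Matrix (Fin k) (Fin k) ℝ, A *ᵥ Pi.single t 1 ≠ 0 ∧
      (∀ n, Lam S h t n → n ∉ L → X n * A = A * X n) ∧
      ∀ d ∈ S.hs, Matrix.diagonal d * A - A * Matrix.diagonal d
        = (-(L.map fun m => d t - d m).sum) • A := by
    induction L with
    | nil =>
      refine ⟨1, by rw [Matrix.one_mulVec]; simp, fun n _ _ => by simp, fun d hd => by simp⟩
    | cons m L ih =>
      rw [List.nodup_cons] at hL
      have hm : Lam S h t m := hLam m (by simp)
      obtain ⟨A, hv0, hA, hv⟩ := ih hL.2 (fun n hn => hLam n (by simp [hn]))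
      obtain ⟨hXm, hYm, hXc, hYc, hX0, hY0⟩ := hXY m hm
      refine ⟨A * Y m, ?_, ?_, ?_⟩
      · intro h0
        have h1 : X m *ᵥ ((A * Y m) *ᵥ Pi.single t 1)
            = (X m t m * Y m m t) • (A *ᵥ Pi.single t 1) := by
          rw [Matrix.mulVec_mulVec, ← Matrix.mul_assoc, hA m hm hL.1, Matrix.mul_assoc,
            ← Matrix.mulVec_mulVec, ← Matrix.mulVec_mulVec, g.mulVec_hom hYc, Matrix.mulVec_smul,
            g.mulVec_hom hXc, smul_smul, Matrix.mulVec_smul, mul_comm]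
        rw [h0, Matrix.mulVec_zero] at h1
        exact (smul_ne_zero (mul_ne_zero hX0 hY0) hv0) h1.symm
      · intro n hn hnL
        simp only [List.mem_cons, not_or] at hnL
        obtain ⟨hXn, _, hXnc, _, _, _⟩ := hXY n hn
        rw [← Matrix.mul_assoc, hA n hn hnL.2, Matrix.mul_assoc,
          g.lamComm hn hm hnL.1 hXn hYm hXnc hYc, Matrix.mul_assoc]
      · intro d hd
        have e1 := hv d hd
        have e2 : Matrix.diagonal d * Y m - Y m * Matrix.diagonal d = (-(d t - d m)) • Y m := by
          ext a b
          rw [Matrix.sub_apply, Matrix.diagonal_mul, Matrix.mul_diagonal, Matrix.smul_apply,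
            smul_eq_mul]
          by_cases hab : Y m a b = 0
          · simp [hab]
          · have := g.gen a b m t (hYc a b hab) d hd
            linear_combination (Y m a b) * this
        rw [List.map_cons, List.sum_cons, neg_add, add_smul]
        have e3 : Matrix.diagonal d * (A * Y m) - A * Y m * Matrix.diagonal d
            = (Matrix.diagonal d * A - A * Matrix.diagonal d) * Y m
              + A * (Matrix.diagonal d * Y m - Y m * Matrix.diagonal d) := by
          noncomm_ring
        rw [e3, e1, e2, Matrix.smul_mul, Matrix.mul_smul, add_comm]
  obtain ⟨A, hv0, _, hA⟩ := main
  obtain ⟨i, hi⟩ := Function.ne_iff.mp hv0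
  refine ⟨i, fun d hd => ?_⟩
  have := congrFun (congrFun (hA d hd) i) t
  rw [Matrix.sub_apply, Matrix.diagonal_mul, Matrix.mul_diagonal, Matrix.smul_apply,
    smul_eq_mul] at this
  have hi' : A i t ≠ 0 := by simpa using hi
  apply mul_right_cancel₀ hi'
  linear_combination this

/-- The full pair lemma. -/
lemma Gen.full (g : S.Gen h t) (b : Fin l) : ∃ c, ∀ m, Lam S h t m →
    S.D b t * S.D c m ≠ S.D b m * S.D c t := by
  classical
  by_contra hcon
  push Not at hcon
  let Λ : Finset (Fin k) := Finset.univ.filter fun m => Lam S h t m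
  have hcube : ∀ T : Finset (Fin k), ∃ i, T ⊆ Λ → ∀ d ∈ S.hs, d i = d t - ∑ m ∈ T, (d t - d m) := by
    intro T
    by_cases hT : T ⊆ Λ
    · obtain ⟨i, hi⟩ := g.cube T.toList T.nodup_toList (fun m hm => by
        have := hT (Finset.mem_toList.mp hm)
        simpa [Λ] using this)
      refine ⟨i, fun _ d hd => ?_⟩
      rw [hi d hd, Finset.sum_map_toList]
    · exact ⟨t, fun h => absurd h hT⟩
  choose I hI using hcube
  let r : Fin l → Fin k → ℝ := fun c i => S.D c i / S.D b i
  have hr0 : ∀ c i, r c i ≠ 0 := fun c i => (div_pos (S.Dpos c i) (S.Dpos b i)).ne'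
  have hr : ∀ c, ∀ T ⊆ Λ, r c (I T) = r c t * ∏ m ∈ T, (r c m / r c t) := by
    intro c T hT
    have h1 := hI T hT _ (S.diag_hh_mem c)
    have h2 := hI T hT _ (S.diag_hh_mem b)
    have hrpos : ∀ i, 0 < r c i := fun i => div_pos (S.Dpos c i) (S.Dpos b i)
    apply Real.log_injOn_pos (Set.mem_Ioi.mpr (hrpos _))
      (Set.mem_Ioi.mpr (mul_pos (hrpos _) (Finset.prod_pos fun m _ => div_pos (hrpos _) (hrpos _))))
    rw [Real.log_mul (hr0 c t) (Finset.prod_ne_zero_iff.mpr fun m _ => div_ne_zero (hr0 c m) (hr0 c t)),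
      Real.log_prod (fun m _ => div_ne_zero (hr0 c m) (hr0 c t))]
    have e : ∀ i, Real.log (r c i) = Real.log (S.D c i) - Real.log (S.D b i) := fun i =>
      Real.log_div (S.Dpos c i).ne' (S.Dpos b i).ne'
    simp only [Real.log_div (hr0 c _) (hr0 c _), e]
    simp only [hh, sub_sub_sub_cancel_right, Finset.sum_sub_distrib] at h1 h2 ⊢
    linarith
  let α : Fin k → ℝ := fun i => ∑ T ∈ Λ.powerset, if I T = i then (-1) ^ T.card / S.D b i else 0
  have hα : α = 0 := by
    apply S.Dspan
    intro c
    obtain ⟨m, hm, hmc⟩ := hcon c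
    have e1 : ∑ i, S.D c i * α i = ∑ T ∈ Λ.powerset, (-1) ^ T.card * r c (I T) := by
      simp only [α, Finset.mul_sum]
      rw [Finset.sum_comm]
      refine Finset.sum_congr rfl fun T _ => ?_
      simp only [mul_ite, mul_zero, Finset.sum_ite_eq, Finset.mem_univ, if_true, r]
      ring
    have e2 : ∑ T ∈ Λ.powerset, (-1) ^ T.card * r c (I T)
        = r c t * ∏ m ∈ Λ, (1 - r c m / r c t) := by
      rw [Finset.prod_sub, Finset.mul_sum]
      refine Finset.sum_congr rfl fun T hT => ?_
      simp only [Finset.prod_const_one, mul_one]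
      rw [hr c T (Finset.mem_powerset.mp hT)]
      ring
    rw [e1, e2, Finset.prod_eq_zero (i := m) (by simp [Λ, hm]), mul_zero]
    rw [sub_eq_zero, eq_comm, div_eq_one_iff_eq (hr0 c t)]
    simp only [r]
    rw [div_eq_div_iff (S.Dpos b m).ne' (S.Dpos b t).ne']
    linarith
  have hαt := congrFun hα t
  have : α t = 1 / S.D b t := by
    simp only [α]
    rw [Finset.sum_eq_single ∅]
    · have : I ∅ = t := by
        apply g.inj
        have := hI ∅ (by simp) h g.mem
        simpa using this
      simp [this]
    · intro T hT hne
      rw [if_neg]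
      intro hIt
      have h1 := hI T (Finset.mem_powerset.mp hT) h g.mem
      rw [hIt] at h1
      have h2 : 0 < ∑ m ∈ T, (h t - h m) := by
        refine Finset.sum_pos (fun m hm => ?_) (Finset.nonempty_iff_ne_empty.mpr hne)
        have h3 : Lam S h t m := by
          have := (Finset.mem_powerset.mp hT) hm
          simpa [Λ] using this
        have := lt_of_le_of_ne (g.top m) (fun h0 => h3.1 (g.inj h0))
        linarith
      linarith
    · simp
  rw [this] at hαt
  exact (one_div_pos.mpr (S.Dpos b t)).ne' hαt

end Sys
end

noncomputable section
attribute [local instance] LieRing.ofAssociativeRing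

/-- Pure tensors. -/
def pt {R : Type} [Fintype R] {k : ℕ} (x : R → Fin k → ℝ) : (R → Fin k) → ℝ :=
  fun i => ∏ r, x r (i r)

lemma tens_pt {R : Type} [Fintype R] [DecidableEq R] {k : ℕ} (A : R → Matrix (Fin k) (Fin k) ℝ)
    (x : R → Fin k → ℝ) : tens A *ᵥ pt x = pt (fun r => A r *ᵥ x r) := by
  funext i
  simp only [Matrix.mulVec, dotProduct, pt, tens, Matrix.of_apply]
  rw [Finset.prod_univ_sum]
  simp [Finset.prod_mul_distrib]

lemma rho_pt (R : Type) [Fintype R] [DecidableEq R] {k : ℕ} (g : Matrix (Fin k) (Fin k) ℝ)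
    (x : R → Fin k → ℝ) : rho R g *ᵥ pt x = pt (fun r => g *ᵥ x r) := tens_pt _ _

lemma drho_pt (R : Type) [Fintype R] [DecidableEq R] {k : ℕ} (g : Matrix (Fin k) (Fin k) ℝ)
    (x : R → Fin k → ℝ) : drho R g *ᵥ pt x = ∑ r, pt (Function.update x r (g *ᵥ x r)) := by
  rw [drho, Matrix.sum_mulVec]
  refine Finset.sum_congr rfl fun r _ => ?_
  rw [tens_pt]
  congr 1
  funext s
  by_cases hs : s = r
  · subst hs; simp
  · simp [hs]

/-- The wedge of two vectors. -/
def wedge {k : ℕ} (x y : Fin k → ℝ) : (Fin 2 → Fin k) → ℝ :=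
  fun i => x (i 0) * y (i 1) - y (i 0) * x (i 1)

lemma wedge_eq {k : ℕ} (x y : Fin k → ℝ) : wedge x y = pt ![x, y] - pt ![y, x] := by
  funext i
  simp [wedge, pt, Fin.prod_univ_two]

lemma rho_wedge {k : ℕ} (g : Matrix (Fin k) (Fin k) ℝ) (x y : Fin k → ℝ) :
    rho (Fin 2) g *ᵥ wedge x y = wedge (g *ᵥ x) (g *ᵥ y) := by
  rw [wedge_eq, wedge_eq, Matrix.mulVec_sub, rho_pt, rho_pt]
  congr 1 <;> (congr 1; funext r; fin_cases r <;> rfl)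

lemma drho_wedge {k : ℕ} (g : Matrix (Fin k) (Fin k) ℝ) (x y : Fin k → ℝ) :
    drho (Fin 2) g *ᵥ wedge x y = wedge (g *ᵥ x) y + wedge x (g *ᵥ y) := by
  rw [wedge_eq, Matrix.mulVec_sub, drho_pt, drho_pt]
  funext i
  simp [wedge, pt, Fin.prod_univ_two]
  ring

lemma rho_inv_mul {R : Type} [Fintype R] [DecidableEq R] {k : ℕ} {g : Matrix (Fin k) (Fin k) ℝ}
    (hg : IsUnit g.det) : rho R g⁻¹ * rho R g = 1 := by
  rw [← rho_mul, Matrix.nonsing_inv_mul _ hg, rho_one]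

lemma rho_mul_inv {R : Type} [Fintype R] [DecidableEq R] {k : ℕ} {g : Matrix (Fin k) (Fin k) ℝ}
    (hg : IsUnit g.det) : rho R g * rho R g⁻¹ = 1 := by
  rw [← rho_mul, Matrix.mul_nonsing_inv _ hg, rho_one]

lemma rho_inj {R : Type} [Fintype R] [DecidableEq R] {k : ℕ} {g : Matrix (Fin k) (Fin k) ℝ}
    (hg : IsUnit g.det) {v : (R → Fin k) → ℝ} (h : rho R g *ᵥ v = 0) : v = 0 := by
  have : rho R g⁻¹ *ᵥ (rho R g *ᵥ v) = 0 := by rw [h, Matrix.mulVec_zero]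
  rwa [Matrix.mulVec_mulVec, rho_inv_mul hg, Matrix.one_mulVec] at this

namespace Sys
variable {k l : ℕ} {S : Sys k l} {h : Fin k → ℝ} {t : Fin k}

lemma det_dl (S : Sys k l) (u : List (Fin l)) (z : Fin l) : IsUnit (S.dl u z).det := by
  rw [dl, Matrix.det_mul, Matrix.det_mul, Matrix.det_diagonal]
  refine IsUnit.mul (IsUnit.mul ?_ ?_) (S.det_wd u)
  · rw [Matrix.det_nonsing_inv]
    exact (S.det_wd u).ringInverse
  · exact (Finset.prod_pos fun i _ => S.Dpos z i).ne'.isUnit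

/-- A subspace of the tensor square without Lie-invariant subspaces containing wedges. -/
def Thin (S : Sys k l) (E : Submodule ℝ ((Fin 2 → Fin k) → ℝ)) : Prop :=
  ∀ Q, S.LInv Q → Q ≤ E → ∀ x y, wedge x y ∈ Q → wedge x y = 0

lemma Gen.subA (g : S.Gen h t) {Q : Submodule ℝ ((Fin 2 → Fin k) → ℝ)} (hQ : S.LInv Q)
    {x y : Fin k → ℝ} (hxy : wedge x y ∈ Q) (h0 : wedge x y ≠ 0) :
    ∃ m, Lam S h t m ∧ wedge (Pi.single t 1) (Pi.single m 1) ∈ Q := by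
  have hQ' := (S.linv_iff Q).mp hQ
  -- step 1
  have s1 : ∃ x y, wedge x y ∈ Q ∧ wedge x y ≠ 0 ∧ x t ≠ 0 := by
    by_contra hcon
    push Not at hcon
    let F : Submodule ℝ (Fin k → ℝ) := Submodule.span ℝ {x | ∃ y, wedge x y ∈ Q ∧ wedge x y ≠ 0}
    have hF : F = ⊤ := by
      apply S.irred_dl
      · intro u z v hv
        have : F ≤ F.comap (S.dl u z).mulVecLin := by
          rw [Submodule.span_le]
          rintro x ⟨y, h1, h2⟩
          refine Submodule.subset_span ⟨S.dl u z *ᵥ y, ?_, ?_⟩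
          · have := hQ' u z _ h1
            rwa [rho_wedge] at this
          · intro h3
            apply h2
            apply rho_inj (S.det_dl u z)
            rw [rho_wedge]
            exact h3
        exact this hv
      · intro hb
        have : x ∈ F := Submodule.subset_span ⟨y, hxy, h0⟩
        rw [hb, Submodule.mem_bot] at this
        apply h0
        subst this
        funext i; simp [wedge]
    have hF2 : F ≤ LinearMap.ker (LinearMap.proj t : (Fin k → ℝ) →ₗ[ℝ] ℝ) := by
      rw [Submodule.span_le]
      rintro x ⟨y, h1, h2⟩
      exact hcon x y h1 h2
    have : (Pi.single t 1 : Fin k → ℝ) ∈ F := by rw [hF]; trivial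
    have := hF2 this
    simp at this
  obtain ⟨x, y, hxy, h0, hxt⟩ := s1
  -- step 2
  have s2 : ∃ y, wedge x y ∈ Q ∧ y ≠ 0 ∧ y t = 0 := by
    refine ⟨y - (y t / x t) • x, ?_, ?_, ?_⟩
    · convert hxy using 1
      funext i; simp [wedge]; ring
    · intro h1
      apply h0
      rw [sub_eq_zero] at h1
      rw [h1]
      funext i; simp [wedge]; ring
    · simp; field_simp; simp
  obtain ⟨y, hxy, hy0, hyt⟩ := s2
  -- step 3
  have s3 : ∃ m, m ≠ t ∧ wedge (Pi.single t 1) (Pi.single m 1) ∈ Q := by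
    obtain ⟨i0, hi0⟩ := Function.ne_iff.mp hy0
    obtain ⟨m, hm, hmax⟩ := Finset.exists_max_image (Finset.univ.filter fun i => y i ≠ 0) h
      ⟨i0, by simpa using hi0⟩
    simp only [Finset.mem_filter, Finset.mem_univ, true_and] at hm hmax
    have hmt : m ≠ t := by rintro rfl; exact hm hyt
    refine ⟨m, hmt, ?_⟩
    have := diag_interp Q (fun i => ∑ r, h (i r)) (fun v hv => by
      have := hQ _ g.mem v hv
      rw [drho_diagonal] at this
      convert this using 1
      funext i; simp [Matrix.mulVec_diagonal]) (fun s => if s = h t + h m then 1 else 0) _ hxy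
    have := Q.smul_mem (x t * y m)⁻¹ this
    convert this using 1
    funext i
    have hne : x t * y m ≠ 0 := mul_ne_zero hxt hm
    have key : ∀ a b, x a * y b ≠ 0 → h a + h b = h t + h m → a = t ∧ b = m := by
      intro a b hab hs
      have h1 := g.top a
      have h2 := hmax b (right_ne_zero_of_mul hab)
      exact ⟨g.inj (by linarith), g.inj (by linarith)⟩
    simp only [wedge, Fin.sum_univ_two, Pi.smul_apply, smul_eq_mul, Pi.single_apply]
    have e1 : ∀ a b, (if h a + h b = h t + h m then 1 else 0) * (x a * y b) =
        x t * y m * ((if a = t then 1 else 0) * (if b = m then 1 else 0)) := by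
      intro a b
      by_cases c : a = t ∧ b = m
      · simp [c.1, c.2]
      · have hr : (if a = t then (1:ℝ) else 0) * (if b = m then 1 else 0) = 0 := by
          by_cases c1 : a = t
          · simp [show b ≠ m from fun hb => c ⟨c1, hb⟩]
          · simp [c1]
        rw [hr, mul_zero]
        by_cases c2 : h a + h b = h t + h m
        · rw [if_pos c2, one_mul]
          by_contra c3
          exact c (key a b c3 c2)
        · rw [if_neg c2, zero_mul]
    have e2 := e1 (i 0) (i 1)
    have e3 := e1 (i 1) (i 0)
    rw [add_comm (h (i 1))] at e3
    rw [mul_sub, e2, mul_comm (y _), e3]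
    field_simp
  -- step 4
  obtain ⟨m0, hm0⟩ := s3
  obtain ⟨m, hm, hmax⟩ := Finset.exists_max_image
    (Set.Finite.toFinset (Set.toFinite {m | m ≠ t ∧ wedge (Pi.single t 1) (Pi.single m 1) ∈ Q})) h
      ⟨m0, by simpa using hm0⟩
  simp only [Set.Finite.mem_toFinset, Set.mem_setOf_eq] at hm hmax
  refine ⟨m, ⟨hm.1, ?_⟩, hm.2⟩
  intro X hX j hj hjt
  by_contra hne
  obtain ⟨Y, hY, hY1, hY2⟩ := g.hom hX (h j - h m)
  have hYjm : Y j m ≠ 0 := by rw [hY2 _ _ rfl]; exact hne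
  have e1 : Y *ᵥ (Pi.single t 1) = 0 := by
    funext i
    simp only [Matrix.mulVec_single, MulOpposite.op_one, one_smul, Matrix.col_apply, Pi.zero_apply]
    by_contra h1
    have := hY1 i t h1
    have := g.top i
    linarith
  have e2 : Y *ᵥ (Pi.single m 1) = Y j m • Pi.single j 1 := by
    funext i
    simp only [Matrix.mulVec_single, MulOpposite.op_one, one_smul, Matrix.col_apply, Pi.smul_apply,
      smul_eq_mul, Pi.single_apply]
    by_cases hij : i = j
    · simp [hij]
    · simp only [hij, if_false, mul_zero]
      by_contra h1
      have := hY1 i m h1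
      exact hij (g.inj (by linarith))
  have := hQ Y hY _ hm.2
  rw [drho_wedge, e1, e2] at this
  have := Q.smul_mem (Y j m)⁻¹ this
  have h3 := hmax j ⟨hjt, by
    convert this using 1
    funext i; simp [wedge]; field_simp⟩
  linarith

/-- The functional `u_b ⊗ u_c` with weights. -/
def Xf (S : Sys k l) (κ : Fin k → ℝ) (b c : Fin l) : ((Fin 2 → Fin k) → ℝ) →ₗ[ℝ] ℝ :=
  ∑ i : Fin 2 → Fin k, (κ (i 0) * S.D b (i 0) * (κ (i 1) * S.D c (i 1))) • LinearMap.proj i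

lemma Xf_apply (S : Sys k l) (κ : Fin k → ℝ) (b c : Fin l) (v : (Fin 2 → Fin k) → ℝ) :
    S.Xf κ b c v = ∑ i, κ (i 0) * S.D b (i 0) * (κ (i 1) * S.D c (i 1)) * v i := by
  simp [Xf]

lemma Xf_pt (S : Sys k l) (κ : Fin k → ℝ) (b c : Fin l) (x : Fin 2 → Fin k → ℝ) :
    S.Xf κ b c (pt x) = (∑ i, κ i * S.D b i * x 0 i) * (∑ i, κ i * S.D c i * x 1 i) := by
  have := Finset.prod_univ_sum (fun _ : Fin 2 => (Finset.univ : Finset (Fin k)))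
    (fun r i => ![fun i => κ i * S.D b i * x 0 i, fun i => κ i * S.D c i * x 1 i] r i)
  simp only [Fin.prod_univ_two, Fintype.piFinset_univ] at this
  rw [Xf_apply]
  simp only [Matrix.cons_val_zero, Matrix.cons_val_one] at this
  rw [this]
  refine Finset.sum_congr rfl fun i _ => ?_
  simp [pt, Fin.prod_univ_two]
  ring

lemma Xf_wedge (S : Sys k l) (κ : Fin k → ℝ) (b c : Fin l) (x y : Fin k → ℝ) :
    S.Xf κ b c (wedge x y) = (∑ i, κ i * S.D b i * x i) * (∑ i, κ i * S.D c i * y i)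
      - (∑ i, κ i * S.D b i * y i) * (∑ i, κ i * S.D c i * x i) := by
  rw [wedge_eq, map_sub, Xf_pt, Xf_pt]
  simp

theorem exists_thin (S : Sys k l) (κ : Fin k → ℝ) (hκ : ∀ i, 0 < κ i) (b : Fin l) :
    ∃ c, S.Thin (LinearMap.ker (S.Xf κ b c)) := by
  obtain ⟨h, t, g⟩ := S.exists_gen
  obtain ⟨c, hc⟩ := g.full b
  refine ⟨c, ?_⟩
  intro Q hQ hQE x y hxy
  by_contra h0
  obtain ⟨m, hm, hmQ⟩ := g.subA hQ hxy h0
  have h1 := hQE hmQ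
  rw [LinearMap.mem_ker, Xf_wedge] at h1
  simp only [Pi.single_apply, mul_ite, mul_one, mul_zero, Finset.sum_ite_eq', Finset.mem_univ,
    if_true] at h1
  apply hc m hm
  have : κ t * κ m * (S.D b t * S.D c m - S.D b m * S.D c t) = 0 := by linarith
  have h2 := (mul_eq_zero.mp this).resolve_left (mul_pos (hκ t) (hκ m)).ne'
  linarith

lemma Thin.mono {E E' : Submodule ℝ ((Fin 2 → Fin k) → ℝ)} (hE : S.Thin E) (h : E' ≤ E) :
    S.Thin E' := fun Q hQ hQE => hE Q hQ (hQE.trans h)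

/-- Conjugation in the other direction. -/
lemma conj_nn_wd' (S : Sys k l) (u : List (Fin l)) {X : Matrix (Fin k) (Fin k) ℝ}
    (hX : X ∈ S.nn) : S.wd u * X * (S.wd u)⁻¹ ∈ S.nn := by
  let φ : Matrix (Fin k) (Fin k) ℝ →ₗ[ℝ] Matrix (Fin k) (Fin k) ℝ :=
    LinearMap.mulLeft ℝ (S.wd u)⁻¹ ∘ₗ LinearMap.mulRight ℝ (S.wd u)
  have hφ : ∀ X, φ X = (S.wd u)⁻¹ * X * S.wd u := fun X => by
    simp [φ, Matrix.mul_assoc]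
  have hinj : Function.Injective φ := by
    intro X Y hXY
    rw [hφ, hφ] at hXY
    have := congrArg (fun Z => S.wd u * Z * (S.wd u)⁻¹) hXY
    simp only [Matrix.mul_assoc, S.wd_mul_inv, Matrix.mul_one] at this
    simp only [← Matrix.mul_assoc, S.wd_mul_inv, Matrix.one_mul] at this
    exact this
  have hle : S.nn.toSubmodule.map φ ≤ S.nn.toSubmodule := by
    rintro _ ⟨Y, hY, rfl⟩
    rw [hφ]
    exact S.conj_nn_wd u hY
  have heq := Submodule.eq_of_le_of_finrank_eq hle
    (LinearEquiv.finrank_eq (Submodule.equivMapOfInjective φ hinj _)).symm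
  have hX' : X ∈ S.nn.toSubmodule.map φ := by rw [heq]; exact hX
  obtain ⟨Y, hY, hYX⟩ := hX'
  have : S.wd u * X * (S.wd u)⁻¹ = Y := by
    rw [← hYX, hφ]
    simp only [Matrix.mul_assoc, S.wd_mul_inv, Matrix.mul_one]
    simp only [← Matrix.mul_assoc, S.wd_mul_inv, Matrix.one_mul]
  rw [this]
  exact hY

/-- The action of words on subspaces. -/
def act (S : Sys k l) (R : Type) [Fintype R] [DecidableEq R] (u : List (Fin l))
    (E : Submodule ℝ ((R → Fin k) → ℝ)) : Submodule ℝ ((R → Fin k) → ℝ) :=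
  E.map (rho R (S.wd u)).mulVecLin

lemma mem_act {R : Type} [Fintype R] [DecidableEq R] (u : List (Fin l))
    (E : Submodule ℝ ((R → Fin k) → ℝ)) (v : (R → Fin k) → ℝ) :
    v ∈ S.act R u E ↔ rho R (S.wd u)⁻¹ *ᵥ v ∈ E := by
  constructor
  · rintro ⟨w, hw, rfl⟩
    rw [Matrix.mulVecLin_apply, Matrix.mulVec_mulVec, rho_inv_mul (S.det_wd u), Matrix.one_mulVec]
    exact hw
  · intro hv
    refine ⟨_, hv, ?_⟩
    rw [Matrix.mulVecLin_apply, Matrix.mulVec_mulVec, rho_mul_inv (S.det_wd u), Matrix.one_mulVec]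

lemma act_mem {R : Type} [Fintype R] [DecidableEq R] (u : List (Fin l))
    (E : Submodule ℝ ((R → Fin k) → ℝ)) (v : (R → Fin k) → ℝ) :
    rho R (S.wd u) *ᵥ v ∈ S.act R u E ↔ v ∈ E := by
  rw [mem_act, Matrix.mulVec_mulVec, rho_inv_mul (S.det_wd u), Matrix.one_mulVec]

lemma LInv.act {R : Type} [Fintype R] [DecidableEq R] {Q : Submodule ℝ ((R → Fin k) → ℝ)}
    (hQ : S.LInv Q) (u : List (Fin l)) : S.LInv (S.act R u Q) := by
  rintro X hX _ ⟨v, hv, rfl⟩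
  rw [Matrix.mulVecLin_apply, Matrix.mulVec_mulVec, ← rho_drho R (S.wd u)
    ((S.wd u)⁻¹ * X * S.wd u) X, ← Matrix.mulVec_mulVec]
  · exact (act_mem u Q _).mpr (hQ _ (S.conj_nn_wd u hX) v hv)
  · simp only [← Matrix.mul_assoc, S.wd_mul_inv, Matrix.one_mul]

lemma LInv.of_act {R : Type} [Fintype R] [DecidableEq R] {Q : Submodule ℝ ((R → Fin k) → ℝ)}
    (u : List (Fin l)) (hQ : S.LInv (S.act R u Q)) : S.LInv Q := by
  intro X hX v hv
  have := hQ _ (S.conj_nn_wd' u hX) _ ((act_mem u Q v).mpr hv)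
  rw [Matrix.mulVec_mulVec, ← rho_drho R (S.wd u) X, ← Matrix.mulVec_mulVec] at this
  · exact (act_mem u Q _).mp this
  · rw [Matrix.mul_assoc _ _ (S.wd u), S.wd_inv_mul, Matrix.mul_one]

/-- The inverse action of words on subspaces. -/
def iact (S : Sys k l) (R : Type) [Fintype R] [DecidableEq R] (u : List (Fin l))
    (E : Submodule ℝ ((R → Fin k) → ℝ)) : Submodule ℝ ((R → Fin k) → ℝ) :=
  E.comap (rho R (S.wd u)).mulVecLin

lemma act_iact {R : Type} [Fintype R] [DecidableEq R] (u : List (Fin l))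
    (E : Submodule ℝ ((R → Fin k) → ℝ)) : S.act R u (S.iact R u E) = E := by
  ext v
  rw [mem_act, iact, Submodule.mem_comap, Matrix.mulVecLin_apply, Matrix.mulVec_mulVec,
    rho_mul_inv (S.det_wd u), Matrix.one_mulVec]

lemma iact_act {R : Type} [Fintype R] [DecidableEq R] (u : List (Fin l))
    (E : Submodule ℝ ((R → Fin k) → ℝ)) : S.iact R u (S.act R u E) = E := by
  ext v
  rw [iact, Submodule.mem_comap, Matrix.mulVecLin_apply, act_mem]

lemma Thin.iact {E : Submodule ℝ ((Fin 2 → Fin k) → ℝ)} (hE : S.Thin E) (u : List (Fin l)) :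
    S.Thin (S.iact (Fin 2) u E) := by
  intro Q hQ hQE x y hxy
  have h1 := hE _ (hQ.act u) (by
    rintro _ ⟨v, hv, rfl⟩
    exact hQE hv) (S.wd u *ᵥ x) (S.wd u *ᵥ y) (by
    rw [← rho_wedge]; exact (act_mem u Q _).mpr hxy)
  rw [← rho_wedge] at h1
  exact rho_inj (S.det_wd u) h1

lemma finrank_act {R : Type} [Fintype R] [DecidableEq R] (u : List (Fin l))
    (E : Submodule ℝ ((R → Fin k) → ℝ)) :
    Module.finrank ℝ (S.act R u E) = Module.finrank ℝ E := by
  apply LinearEquiv.finrank_eq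
  symm
  apply Submodule.equivMapOfInjective
  intro v w h
  rw [← sub_eq_zero] at h ⊢
  rw [← map_sub, Matrix.mulVecLin_apply] at h
  exact rho_inj (S.det_wd u) h

lemma finrank_iact {R : Type} [Fintype R] [DecidableEq R] (u : List (Fin l))
    (E : Submodule ℝ ((R → Fin k) → ℝ)) :
    Module.finrank ℝ (S.iact R u E) = Module.finrank ℝ E := by
  rw [← finrank_act (S := S) u (S.iact R u E), act_iact]

lemma act_append {R : Type} [Fintype R] [DecidableEq R] (u v : List (Fin l))
    (E : Submodule ℝ ((R → Fin k) → ℝ)) :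
    S.act R (u ++ v) E = S.act R u (S.act R v E) := by
  rw [act, act, act, ← Submodule.map_comp, wd_append, rho_mul, Matrix.mulVecLin_mul]

lemma act_nil {R : Type} [Fintype R] [DecidableEq R]
    (E : Submodule ℝ ((R → Fin k) → ℝ)) : S.act R [] E = E := by
  ext v
  rw [mem_act]
  simp [wd, rho_one]

end Sys
end

noncomputable section

/-- Averages over words with independent letters. -/
def Ex {l : ℕ} : List (Fin l → ℝ) → (List (Fin l) → ℝ) → ℝ
  | [], F => F []
  | θ :: θs, F => ∑ s, θ s * Ex θs (fun w => F (s :: w))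

/-- Probability vectors with entries bounded below. -/
def Good {l : ℕ} (δ : ℝ) (θs : List (Fin l → ℝ)) : Prop :=
  ∀ θ ∈ θs, (∀ s, δ ≤ θ s) ∧ ∑ s, θ s = 1

section ExLemmas
variable {l : ℕ}

lemma Good.tail {δ : ℝ} {θ : Fin l → ℝ} {θs : List (Fin l → ℝ)} (h : Good δ (θ :: θs)) :
    Good δ θs := fun t ht => h t (List.mem_cons_of_mem _ ht)

lemma Good.head {δ : ℝ} {θ : Fin l → ℝ} {θs : List (Fin l → ℝ)} (h : Good δ (θ :: θs)) :
    (∀ s, δ ≤ θ s) ∧ ∑ s, θ s = 1 := h θ (List.mem_cons_self)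

lemma Good.left {δ : ℝ} {θs θs' : List (Fin l → ℝ)} (h : Good δ (θs ++ θs')) :
    Good δ θs := fun t ht => h t (List.mem_append_left _ ht)

lemma Good.right {δ : ℝ} {θs θs' : List (Fin l → ℝ)} (h : Good δ (θs ++ θs')) :
    Good δ θs' := fun t ht => h t (List.mem_append_right _ ht)

lemma Ex_add (θs : List (Fin l → ℝ)) (F G : List (Fin l) → ℝ) :
    Ex θs (fun w => F w + G w) = Ex θs F + Ex θs G := by
  induction θs generalizing F G with
  | nil => rfl
  | cons θ θs ih =>
    simp only [Ex]
    rw [← Finset.sum_add_distrib]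
    exact Finset.sum_congr rfl fun s _ => by rw [ih, mul_add]

lemma Ex_smul (θs : List (Fin l → ℝ)) (c : ℝ) (F : List (Fin l) → ℝ) :
    Ex θs (fun w => c * F w) = c * Ex θs F := by
  induction θs generalizing F with
  | nil => rfl
  | cons θ θs ih =>
    simp only [Ex]
    rw [Finset.mul_sum]
    exact Finset.sum_congr rfl fun s _ => by rw [ih]; ring

lemma Ex_const {δ : ℝ} {θs : List (Fin l → ℝ)} (h : Good δ θs) (c : ℝ) :
    Ex θs (fun _ => c) = c := by
  induction θs with
  | nil => rfl
  | cons θ θs ih =>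
    simp only [Ex]
    rw [ih h.tail, ← Finset.sum_mul, h.head.2, one_mul]

lemma Ex_append (θs θs' : List (Fin l → ℝ)) (F : List (Fin l) → ℝ) :
    Ex (θs ++ θs') F = Ex θs (fun w => Ex θs' (fun w' => F (w ++ w'))) := by
  induction θs generalizing F with
  | nil => rfl
  | cons θ θs ih =>
    simp only [Ex, List.cons_append]
    exact Finset.sum_congr rfl fun s _ => by rw [ih]

lemma Ex_comm (θs θs' : List (Fin l → ℝ)) (F : List (Fin l) → List (Fin l) → ℝ) :
    Ex θs (fun w => Ex θs' (fun w' => F w w')) = Ex θs' (fun w' => Ex θs (fun w => F w w')) := by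
  induction θs generalizing F with
  | nil => rfl
  | cons θ θs ih =>
    simp only [Ex]
    have : ∀ (A : Finset (Fin l)) (G : Fin l → List (Fin l) → ℝ),
        ∑ s ∈ A, θ s * Ex θs' (G s) = Ex θs' (fun w' => ∑ s ∈ A, θ s * G s w') := by
      intro A G
      classical
      induction A using Finset.induction_on with
      | empty =>
        simp only [Finset.sum_empty]
        have := Ex_smul θs' 0 (fun _ => 0)
        simpa using this.symm
      | insert a A ha ih => 
        simp only [Finset.sum_insert ha]
        rw [Ex_add, Ex_smul, ih]
    rw [← this]
    exact Finset.sum_congr rfl fun s _ => by rw [ih]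

lemma Ex_mono {δ : ℝ} (hδ : 0 ≤ δ) {θs : List (Fin l → ℝ)} (h : Good δ θs)
    {F G : List (Fin l) → ℝ} (hFG : ∀ w, w.length = θs.length → F w ≤ G w) :
    Ex θs F ≤ Ex θs G := by
  induction θs generalizing F G with
  | nil => exact hFG _ rfl
  | cons θ θs ih =>
    simp only [Ex]
    refine Finset.sum_le_sum fun s _ => ?_
    exact mul_le_mul_of_nonneg_left (ih h.tail fun w hw => hFG _ (by simp [hw]))
      (hδ.trans (h.head.1 s))

lemma Ex_congr {θs : List (Fin l → ℝ)}
    {F G : List (Fin l) → ℝ} (hFG : ∀ w, w.length = θs.length → F w = G w) :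
    Ex θs F = Ex θs G := by
  induction θs generalizing F G with
  | nil => exact hFG _ rfl
  | cons θ θs ih =>
    simp only [Ex]
    refine Finset.sum_congr rfl fun s _ => ?_
    rw [ih fun w hw => hFG _ (by simp [hw])]

lemma Ex_nonneg {δ : ℝ} (hδ : 0 ≤ δ) {θs : List (Fin l → ℝ)} (h : Good δ θs)
    {F : List (Fin l) → ℝ} (hF : ∀ w, 0 ≤ F w) : 0 ≤ Ex θs F := by
  have := Ex_mono hδ h (F := fun _ => 0) (G := F) (fun w _ => hF w)
  rwa [Ex_const h] at this

lemma Ex_ge {δ : ℝ} (hδ : 0 ≤ δ) {θs : List (Fin l → ℝ)} (h : Good δ θs)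
    {F : List (Fin l) → ℝ} (hF : ∀ w, 0 ≤ F w) (w : List (Fin l)) (hw : w.length = θs.length) :
    δ ^ θs.length * F w ≤ Ex θs F := by
  induction θs generalizing F w with
  | nil => simp at hw; subst hw; simp [Ex]
  | cons θ θs ih =>
    cases w with
    | nil => simp at hw
    | cons s w =>
      simp only [Ex, List.length_cons]
      have h1 := ih h.tail (F := fun w => F (s :: w)) (fun w => hF _) w (by simpa using hw)
      calc δ ^ (θs.length + 1) * F (s :: w) = δ * (δ ^ θs.length * F (s :: w)) := by ring
        _ ≤ θ s * Ex θs (fun w => F (s :: w)) := 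
          mul_le_mul (h.head.1 s) h1 (mul_nonneg (pow_nonneg hδ _) (hF _)) (hδ.trans (h.head.1 s))
        _ ≤ _ := Finset.single_le_sum (f := fun s => θ s * Ex θs (fun w => F (s :: w)))
          (fun s _ => mul_nonneg (hδ.trans (h.head.1 s)) (Ex_nonneg hδ h.tail fun w => hF _))
          (Finset.mem_univ s)

/-- Variance inequality. -/
lemma Ex_var {δ : ℝ} (hδ : 0 ≤ δ) {θs : List (Fin l → ℝ)} (h : Good δ θs)
    (a : List (Fin l) → ℝ) (w w' : List (Fin l)) (hw : w.length = θs.length)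
    (hw' : w'.length = θs.length) :
    (Ex θs a) ^ 2 + δ ^ θs.length / 4 * (a w - a w') ^ 2 ≤ Ex θs (fun w => a w ^ 2) := by
  set M := Ex θs a with hM
  have h1 : Ex θs (fun w => (a w - M) ^ 2) = Ex θs (fun w => a w ^ 2) - M ^ 2 := by
    have : (fun w => (a w - M) ^ 2) = fun w => (a w ^ 2 + (-2 * M) * a w) + M ^ 2 := by
      funext w; ring
    rw [this, Ex_add, Ex_add, Ex_smul, Ex_const h, ← hM]
    ring
  have h2 := Ex_ge hδ h (F := fun w => (a w - M) ^ 2) (fun w => sq_nonneg _) w hw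
  have h3 := Ex_ge hδ h (F := fun w => (a w - M) ^ 2) (fun w => sq_nonneg _) w' hw'
  rw [h1] at h2 h3
  have h4 : 0 ≤ δ ^ θs.length := pow_nonneg hδ _
  have h5 : δ ^ θs.length * (a w - a w') ^ 2 ≤
      δ ^ θs.length * (2 * (a w - M) ^ 2 + 2 * (a w' - M) ^ 2) :=
    mul_le_mul_of_nonneg_left (by nlinarith [sq_nonneg (a w - M + (a w' - M))]) h4
  linarith

lemma Ex_sq_le {δ : ℝ} (hδ : 0 ≤ δ) {θs : List (Fin l → ℝ)} (h : Good δ θs)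
    (a : List (Fin l) → ℝ) : (Ex θs a) ^ 2 ≤ Ex θs (fun w => a w ^ 2) := by
  cases θs with
  | nil => simp [Ex]
  | cons θ θs =>
    rcases Nat.eq_zero_or_pos l with rfl | hl
    · have := h.head.2
      simp at this
    · have := Ex_var hδ h a (List.replicate (θs.length + 1) ⟨0, hl⟩)
        (List.replicate (θs.length + 1) ⟨0, hl⟩) (by simp) (by simp)
      simpa using this

lemma Ex_summable {Ω : Type} (θs : List (Fin l → ℝ)) (G : List (Fin l) → Ω → ℝ)
    (hG : ∀ w, Summable (G w)) :
    Summable (fun ω => Ex θs (fun w => G w ω)) ∧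
      ∑' ω, Ex θs (fun w => G w ω) = Ex θs (fun w => ∑' ω, G w ω) := by
  induction θs generalizing G with
  | nil => exact ⟨hG _, rfl⟩
  | cons θ θs ih =>
    simp only [Ex]
    have h1 := fun s => ih (fun w => G (s :: w)) (fun w => hG _)
    have h2 : ∀ s ∈ (Finset.univ : Finset (Fin l)),
        Summable (fun ω => θ s * Ex θs (fun w => G (s :: w) ω)) := fun s _ => (h1 s).1.mul_left _
    refine ⟨summable_sum h2, ?_⟩
    rw [Summable.tsum_finsetSum h2]
    refine Finset.sum_congr rfl fun s _ => ?_
    rw [tsum_mul_left, (h1 s).2]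

end ExLemmas

section Gap
variable {l : ℕ} {Ω : Type} (T : Fin l → Equiv.Perm Ω)

/-- Permutation of a word. -/
def Tw : List (Fin l) → Equiv.Perm Ω
  | [] => 1
  | s :: w => T s * Tw w

lemma Tw_append (u v : List (Fin l)) : Tw T (u ++ v) = Tw T u * Tw T v := by
  induction u with
  | nil => simp [Tw]
  | cons s u ih => simp [Tw, ih, mul_assoc]

/-- Averaging operator. -/
def Avg (θs : List (Fin l → ℝ)) (f : Ω → ℝ) : Ω → ℝ :=
  fun ω => Ex θs (fun w => f ((Tw T w)⁻¹ ω))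

lemma Avg_append (θs θs' : List (Fin l → ℝ)) (f : Ω → ℝ) :
    Avg T (θs ++ θs') f = Avg T θs (Avg T θs' f) := by
  funext ω
  simp only [Avg, Ex_append, Tw_append, _root_.mul_inv_rev, Equiv.Perm.mul_apply]

lemma summable_perm (σ : Equiv.Perm Ω) {f : Ω → ℝ} (hf : Summable f) :
    Summable (fun ω => f (σ ω)) := σ.summable_iff.mpr hf

lemma Avg_contr {δ : ℝ} (hδ : 0 ≤ δ) {θs : List (Fin l → ℝ)} (h : Good δ θs) {f : Ω → ℝ}
    (hf : Summable (fun ω => f ω ^ 2)) :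
    Summable (fun ω => Avg T θs f ω ^ 2) ∧ ∑' ω, Avg T θs f ω ^ 2 ≤ ∑' ω, f ω ^ 2 := by
  have h1 := Ex_summable θs (fun w ω => f ((Tw T w)⁻¹ ω) ^ 2)
    (fun w => summable_perm (Tw T w)⁻¹ (f := fun ω => f ω ^ 2) hf)
  have h2 : ∀ ω, Avg T θs f ω ^ 2 ≤ Ex θs (fun w => f ((Tw T w)⁻¹ ω) ^ 2) :=
    fun ω => Ex_sq_le hδ h _
  have h3 : Summable (fun ω => Avg T θs f ω ^ 2) :=
    Summable.of_nonneg_of_le (fun _ => sq_nonneg _) h2 h1.1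
  refine ⟨h3, (h3.tsum_le_tsum h2 h1.1).trans ?_⟩
  rw [h1.2]
  have : ∀ w, ∑' ω, f ((Tw T w)⁻¹ ω) ^ 2 = ∑' ω, f ω ^ 2 :=
    fun w => (Tw T w)⁻¹.tsum_eq (fun ω => f ω ^ 2)
  simp only [this]
  rw [Ex_const h]

lemma summable_sub_sq {f g : Ω → ℝ} (hf : Summable (fun ω => f ω ^ 2))
    (hg : Summable (fun ω => g ω ^ 2)) : Summable (fun ω => (f ω - g ω) ^ 2) :=
  Summable.of_nonneg_of_le (fun _ => sq_nonneg _)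
    (fun ω => by nlinarith [sq_nonneg (f ω + g ω)] :
      ∀ ω, (f ω - g ω) ^ 2 ≤ 2 * f ω ^ 2 + 2 * g ω ^ 2) ((hf.mul_left 2).add (hg.mul_left 2))

lemma Avg_block {δ : ℝ} (hδ : 0 ≤ δ) {θs : List (Fin l → ℝ)} (h : Good δ θs) {f : Ω → ℝ}
    (hf : Summable (fun ω => f ω ^ 2)) (v u : List (Fin l)) (o z : Fin l)
    (hl : v.length + 1 + u.length = θs.length) :
    ∑' ω, Avg T θs f ω ^ 2 + δ ^ θs.length / 4 *
      ∑' ω, (f ω - f (((Tw T u)⁻¹ * (T o)⁻¹ * T z * Tw T u)⁻¹ ω)) ^ 2 ≤ ∑' ω, f ω ^ 2 := by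
  have h1 := Ex_summable θs (fun w ω => f ((Tw T w)⁻¹ ω) ^ 2)
    (fun w => summable_perm (Tw T w)⁻¹ (f := fun ω => f ω ^ 2) hf)
  have h2 : ∀ ω, Avg T θs f ω ^ 2 + δ ^ θs.length / 4 *
      (f ((Tw T (v ++ o :: u))⁻¹ ω) - f ((Tw T (v ++ z :: u))⁻¹ ω)) ^ 2
      ≤ Ex θs (fun w => f ((Tw T w)⁻¹ ω) ^ 2) :=
    fun ω => Ex_var hδ h (fun w => f ((Tw T w)⁻¹ ω)) _ _ (by simp; omega) (by simp; omega)
  have h3 := (Avg_contr T hδ h hf).1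
  have h4 : Summable (fun ω => (f ((Tw T (v ++ o :: u))⁻¹ ω) - f ((Tw T (v ++ z :: u))⁻¹ ω)) ^ 2) :=
    summable_sub_sq (summable_perm (Tw T _)⁻¹ (f := fun ω => f ω ^ 2) hf)
      (summable_perm (Tw T _)⁻¹ (f := fun ω => f ω ^ 2) hf)
  have h5 := (h3.add (h4.mul_left (δ ^ θs.length / 4))).tsum_le_tsum h2 h1.1
  rw [h3.tsum_add (h4.mul_left (δ ^ θs.length / 4)), tsum_mul_left, h1.2] at h5
  have : ∀ w, ∑' ω, f ((Tw T w)⁻¹ ω) ^ 2 = ∑' ω, f ω ^ 2 :=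
    fun w => (Tw T w)⁻¹.tsum_eq (fun ω => f ω ^ 2)
  simp only [this] at h5
  rw [Ex_const h] at h5
  rw [← (Tw T (v ++ o :: u)).tsum_eq (fun ω =>
    (f ((Tw T (v ++ o :: u))⁻¹ ω) - f ((Tw T (v ++ z :: u))⁻¹ ω)) ^ 2)] at h5
  have e : ∀ ω, f ((Tw T (v ++ o :: u))⁻¹ (Tw T (v ++ o :: u) ω))
      - f ((Tw T (v ++ z :: u))⁻¹ (Tw T (v ++ o :: u) ω))
      = f ω - f (((Tw T u)⁻¹ * (T o)⁻¹ * T z * Tw T u)⁻¹ ω) := by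
    intro ω
    congr 2
    · simp
    · simp only [Tw_append, Tw, _root_.mul_inv_rev, inv_inv, Equiv.Perm.mul_apply]
      simp
  simp only [e] at h5
  exact h5

/-- Hypotheses of the gap theorem. -/
structure GapData (o : Fin l) (J : Type) [Fintype J] where
  u : J → List (Fin l)
  z : J → Fin l
  Rf : J → Ω → ℝ
  K : ℝ
  ε : ℝ
  hε : 0 < ε
  hK : ∀ j ω, |Rf j ω| ≤ K
  hR : ∀ ω, ε ≤ ∑ j, (Rf j (((Tw T (u j))⁻¹ * (T o)⁻¹ * T (z j) * Tw T (u j)) ω) - Rf j ω)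

lemma gap_CS {f : Ω → ℝ} (hf : Summable (fun ω => f ω ^ 2)) (σ : Equiv.Perm Ω) (r : Ω → ℝ) {K : ℝ}
    (hK : ∀ ω, |r ω| ≤ K) {τ : ℝ} (hτ : 0 < τ) :
    Summable (fun ω => (r (σ ω) - r ω) * f ω ^ 2) ∧
    ∑' ω, (r (σ ω) - r ω) * f ω ^ 2 ≤
      K / (2 * τ) * ∑' ω, (f ω - f (σ⁻¹ ω)) ^ 2 + 2 * K * τ * ∑' ω, f ω ^ 2 := by
  have s0 : ∀ r' : Ω → ℝ, (∀ ω, |r' ω| ≤ K) → Summable (fun ω => r' ω * f ω ^ 2) := by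
    intro r' hr'
    apply Summable.of_norm_bounded (hf.mul_left K)
    intro ω
    rw [Real.norm_eq_abs, abs_mul, abs_of_nonneg (sq_nonneg (f ω))]
    exact mul_le_mul_of_nonneg_right (hr' ω) (sq_nonneg _)
  have s1 := s0 (fun ω => r (σ ω)) (fun ω => hK _)
  have s2 := s0 r hK
  have s3 : Summable (fun ω => r ω * f (σ⁻¹ ω) ^ 2) := by
    have := summable_perm σ⁻¹ s1
    simpa using this
  have e1 : ∑' ω, r (σ ω) * f ω ^ 2 = ∑' ω, r ω * f (σ⁻¹ ω) ^ 2 := by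
    rw [← σ⁻¹.tsum_eq]
    simp
  have hfs := summable_perm σ⁻¹ (f := fun ω => f ω ^ 2) hf
  have e2 : ∑' ω, f (σ⁻¹ ω) ^ 2 = ∑' ω, f ω ^ 2 := σ⁻¹.tsum_eq (fun ω => f ω ^ 2)
  have hd := summable_sub_sq hf hfs
  constructor
  · simpa only [sub_mul] using s1.sub s2
  · simp only [sub_mul]
    rw [s1.tsum_sub s2, e1, ← s3.tsum_sub s2]
    have key : ∀ ω, r ω * f (σ⁻¹ ω) ^ 2 - r ω * f ω ^ 2 ≤ K / (2 * τ) * (f ω - f (σ⁻¹ ω)) ^ 2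
        + (K * τ * f (σ⁻¹ ω) ^ 2 + K * τ * f ω ^ 2) := by
      intro ω
      set x := f ω
      set y := f (σ⁻¹ ω)
      have hK0 : 0 ≤ K := (abs_nonneg _).trans (hK ω)
      have h1 : r ω * y ^ 2 - r ω * x ^ 2 = r ω * ((y - x) * (y + x)) := by ring
      have h2 : r ω * ((y - x) * (y + x)) ≤ K * |(y - x) * (y + x)| := by
        refine (le_abs_self _).trans ?_
        rw [abs_mul]
        exact mul_le_mul_of_nonneg_right (hK ω) (abs_nonneg _)
      have h3 : |(y - x) * (y + x)| ≤ (y - x) ^ 2 / (2 * τ) + τ / 2 * (y + x) ^ 2 := by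
        have : (y - x) ^ 2 / (2 * τ) + τ / 2 * (y + x) ^ 2 - |(y - x) * (y + x)|
          = (|y - x| - τ * |y + x|) ^ 2 / (2 * τ) := by
          rw [abs_mul, ← sq_abs (y - x), ← sq_abs (y + x)]
          field_simp
          ring
        have h4 : 0 ≤ (|y - x| - τ * |y + x|) ^ 2 / (2 * τ) := by positivity
        linarith
      have h4 : (y + x) ^ 2 ≤ 2 * y ^ 2 + 2 * x ^ 2 := by nlinarith [sq_nonneg (y - x)]
      have h5 : |(y - x) * (y + x)| ≤ (y - x) ^ 2 / (2 * τ) + τ / 2 * (2 * y ^ 2 + 2 * x ^ 2) :=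
        h3.trans (by gcongr)
      have h6 := mul_le_mul_of_nonneg_left h5 hK0
      have h7 : K * ((y - x) ^ 2 / (2 * τ) + τ / 2 * (2 * y ^ 2 + 2 * x ^ 2)) =
        K / (2 * τ) * (x - y) ^ 2 + (K * τ * y ^ 2 + K * τ * x ^ 2) := by
        field_simp
        ring
      linarith
    have s4 := (hd.mul_left (K / (2 * τ))).add ((hfs.mul_left (K * τ)).add (hf.mul_left (K * τ)))
    refine ((s3.sub s2).tsum_le_tsum key s4).trans (le_of_eq ?_)
    rw [(hd.mul_left (K / (2 * τ))).tsum_add ((hfs.mul_left (K * τ)).add (hf.mul_left (K * τ))),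
      (hfs.mul_left (K * τ)).tsum_add (hf.mul_left (K * τ)), tsum_mul_left, tsum_mul_left,
      tsum_mul_left, e2]
    ring

lemma expo {a : ℝ} (h0 : 0 < a) (h1 : a < 1) {m : ℕ} (hm : 0 < m) :
    ∃ C ρ : ℝ, 0 < C ∧ 0 < ρ ∧ ρ < 1 ∧ ∀ (n : ℕ) (x : ℝ), x ^ 2 ≤ a ^ (n / m) → x ≤ C * ρ ^ n := by
  set ρ : ℝ := a ^ (1 / (2 * m : ℝ)) with hρ
  have hm' : (0 : ℝ) < m := by exact_mod_cast hm
  have hρ0 : 0 < ρ := Real.rpow_pos_of_pos h0 _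
  have hρ1 : ρ < 1 := Real.rpow_lt_one h0.le h1 (by positivity)
  have hρm : ρ ^ (2 * m) = a := by
    rw [hρ, ← Real.rpow_natCast, ← Real.rpow_mul h0.le]
    push_cast
    rw [one_div_mul_cancel (by positivity), Real.rpow_one]
  refine ⟨(ρ ^ m)⁻¹, ρ, by positivity, hρ0, hρ1, ?_⟩
  intro n x hx
  have h2 : x ≤ ρ ^ (m * (n / m)) := by
    apply le_of_sq_le_sq _ (by positivity)
    refine hx.trans (le_of_eq ?_)
    rw [← hρm, ← pow_mul, ← pow_mul]
    congr 1; ring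
  refine h2.trans ?_
  rw [inv_mul_eq_div, le_div_iff₀ (by positivity), ← pow_add]
  apply pow_le_pow_of_le_one hρ0.le hρ1.le
  have := Nat.lt_div_mul_add hm (a := n)
  nlinarith

theorem gap {o : Fin l} {J : Type} [Fintype J] (d : GapData T o J) {δ : ℝ} (hδ : 0 < δ) :
    ∃ C ρ : ℝ, 0 < C ∧ 0 < ρ ∧ ρ < 1 ∧ ∀ (θs : List (Fin l → ℝ)), Good δ θs → ∀ (P : List (Fin l) → ℝ)
      (ω ω' : Ω), (∀ w, w.length = θs.length → P w ≤ 1) →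
      (∀ w, w.length = θs.length → Tw T w ω ≠ ω' → P w ≤ 0) → Ex θs P ≤ C * ρ ^ θs.length := by
  classical
  obtain ⟨m, hm, hum⟩ : ∃ m, 0 < m ∧ ∀ j, (d.u j).length + 1 ≤ m := by
    refine ⟨(∑ j, (d.u j).length) + 1, by omega, fun j => ?_⟩
    have := Finset.single_le_sum (f := fun j => (d.u j).length) (fun _ _ => Nat.zero_le _)
      (Finset.mem_univ j)
    omega
  set n : ℝ := (Fintype.card J : ℝ) with hn
  have hn0 : 0 ≤ n := Nat.cast_nonneg _
  set K : ℝ := |d.K| + 1 with hKdef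
  have hK0 : 0 < K := by positivity
  have hK : ∀ j ω, |d.Rf j ω| ≤ K := fun j ω => (d.hK j ω).trans (by
    have := le_abs_self d.K; linarith)
  set τ : ℝ := d.ε / (4 * K * (n + 1)) with hτdef
  have hε := d.hε
  have hτ : 0 < τ := by positivity
  set c : ℝ := d.ε * τ / K with hc
  have hc0 : 0 < c := by positivity
  set a : ℝ := max (1 - δ ^ m / 4 * c / (n + 1)) (1 / 2) with ha
  have ha0 : 0 < a := lt_of_lt_of_le (by norm_num) (le_max_right _ _)
  have ha1 : a < 1 := by
    apply max_lt
    · have : 0 < δ ^ m / 4 * c / (n + 1) := by positivity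
      linarith
    · norm_num
  have block : ∀ θs : List (Fin l → ℝ), Good δ θs → θs.length = m → ∀ f : Ω → ℝ,
      Summable (fun ω => f ω ^ 2) → ∑' ω, Avg T θs f ω ^ 2 ≤ a * ∑' ω, f ω ^ 2 := by
    intro θs hθ hlen f hf
    set N := ∑' ω, f ω ^ 2 with hN
    have hN0 : 0 ≤ N := tsum_nonneg fun _ => sq_nonneg _
    set Nj : J → ℝ := fun j => ∑' ω,
      (f ω - f (((Tw T (d.u j))⁻¹ * (T o)⁻¹ * T (d.z j) * Tw T (d.u j))⁻¹ ω)) ^ 2 with hNj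
    have cs := fun j => gap_CS hf ((Tw T (d.u j))⁻¹ * (T o)⁻¹ * T (d.z j) * Tw T (d.u j))
      (d.Rf j) (hK j) hτ
    have h1 : d.ε * N ≤ ∑ j, (K / (2 * τ) * Nj j + 2 * K * τ * N) := by
      calc d.ε * N = ∑' ω, d.ε * f ω ^ 2 := by rw [tsum_mul_left]
        _ ≤ ∑' ω, ∑ j, (d.Rf j (((Tw T (d.u j))⁻¹ * (T o)⁻¹ * T (d.z j) * Tw T (d.u j)) ω)
            - d.Rf j ω) * f ω ^ 2 := by
          refine (hf.mul_left _).tsum_le_tsum (fun ω => ?_) (summable_sum fun j _ => (cs j).1)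
          rw [← Finset.sum_mul]
          exact mul_le_mul_of_nonneg_right (d.hR ω) (sq_nonneg _)
        _ = ∑ j, ∑' ω, (d.Rf j (((Tw T (d.u j))⁻¹ * (T o)⁻¹ * T (d.z j) * Tw T (d.u j)) ω)
            - d.Rf j ω) * f ω ^ 2 := Summable.tsum_finsetSum fun j _ => (cs j).1
        _ ≤ _ := Finset.sum_le_sum fun j _ => (cs j).2
    rw [Finset.sum_add_distrib, ← Finset.mul_sum, Finset.sum_const, Finset.card_univ, nsmul_eq_mul,
      ← hn] at h1
    have h2 : n * (2 * K * τ * N) ≤ d.ε / 2 * N := by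
      have : n * (2 * K * τ) ≤ d.ε / 2 := by
        rw [hτdef]
        have : n * (2 * K * (d.ε / (4 * K * (n + 1)))) = d.ε / 2 * (n / (n + 1)) := by
          field_simp; ring
        rw [this]
        have h3 : n / (n + 1) ≤ 1 := by
          rw [div_le_one (by positivity)]; linarith
        nlinarith
      nlinarith
    have h3 : c * N ≤ ∑ j, Nj j := by
      have h4 : d.ε / 2 * N ≤ K / (2 * τ) * ∑ j, Nj j := by linarith
      have h5 := mul_le_mul_of_nonneg_left h4 (show 0 ≤ 2 * τ / K by positivity)
      have e1 : 2 * τ / K * (d.ε / 2 * N) = c * N := by rw [hc]; field_simp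
      have e2 : 2 * τ / K * (K / (2 * τ) * ∑ j, Nj j) = ∑ j, Nj j := by field_simp
      linarith
    have hb : ∀ j, ∑' ω, Avg T θs f ω ^ 2 + δ ^ m / 4 * Nj j ≤ N := by
      intro j
      have hj := hum j
      have := Avg_block T hδ.le hθ hf (List.replicate (m - 1 - (d.u j).length) o) (d.u j) o (d.z j)
        (by simp; omega)
      rw [hlen] at this
      exact this
    have h6 := Finset.sum_le_sum (fun j (_ : j ∈ (Finset.univ : Finset J)) => hb j)
    rw [Finset.sum_add_distrib, ← Finset.mul_sum, Finset.sum_const, Finset.sum_const,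
      Finset.card_univ, nsmul_eq_mul, nsmul_eq_mul, ← hn] at h6
    have h7 := (Avg_contr T hδ.le hθ hf).2
    rw [← hN] at h7
    have h8 : (n + 1) * ∑' ω, Avg T θs f ω ^ 2 ≤ (n + 1) * N - δ ^ m / 4 * (c * N) := by
      have := mul_le_mul_of_nonneg_left h3 (show 0 ≤ δ ^ m / 4 by positivity)
      linarith
    have h9 : ∑' ω, Avg T θs f ω ^ 2 ≤ (1 - δ ^ m / 4 * c / (n + 1)) * N := by
      rw [← mul_le_mul_iff_right₀ (show 0 < n + 1 by positivity)]
      refine h8.trans (le_of_eq ?_)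
      field_simp
    exact h9.trans (mul_le_mul_of_nonneg_right (le_max_left _ _) hN0)
  have iter : ∀ (r : ℕ) (θs : List (Fin l → ℝ)), Good δ θs → r * m ≤ θs.length → ∀ f : Ω → ℝ,
      Summable (fun ω => f ω ^ 2) → ∑' ω, Avg T θs f ω ^ 2 ≤ a ^ r * ∑' ω, f ω ^ 2 := by
    intro r
    induction r with
    | zero =>
      intro θs hθ _ f hf
      rw [pow_zero, one_mul]
      exact (Avg_contr T hδ.le hθ hf).2
    | succ r ih =>
      intro θs hθ hlen f hf
      have hlen' : r * m + m ≤ θs.length := by rwa [Nat.succ_mul] at hlen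
      have hθ' : Good δ (θs.take m ++ θs.drop m) := by rwa [List.take_append_drop]
      have h1 := (Avg_contr T hδ.le hθ'.right hf).1
      have h2 := block _ hθ'.left (by simp; omega) _ h1
      have h3 := ih _ hθ'.right (by simp; omega) f hf
      rw [← Avg_append, List.take_append_drop] at h2
      calc _ ≤ _ := h2
        _ ≤ a * (a ^ r * ∑' ω, f ω ^ 2) := mul_le_mul_of_nonneg_left h3 ha0.le
        _ = _ := by ring
  obtain ⟨C, ρ, hC, hρ0, hρ1, hx⟩ := expo ha0 ha1 hm
  refine ⟨C, ρ, hC, hρ0, hρ1, ?_⟩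
  intro θs hθ P ω ω' hP1 hP0
  have hfs : Summable (fun ω'' => (if ω'' = ω then (1 : ℝ) else 0) ^ 2) :=
    summable_of_ne_finset_zero (s := {ω}) (fun b hb => by
      simp only [Finset.mem_singleton] at hb; simp [hb])
  have hfN : ∑' ω'', (if ω'' = ω then (1 : ℝ) else 0) ^ 2 = 1 := by
    rw [tsum_eq_single ω (fun b hb => by simp [hb])]; simp
  set f : Ω → ℝ := fun ω'' => if ω'' = ω then 1 else 0 with hf
  have h1 : Ex θs P ≤ Avg T θs f ω' := by
    apply Ex_mono hδ.le hθ
    intro w hw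
    by_cases hc : Tw T w ω = ω'
    · have : (Tw T w)⁻¹ ω' = ω := by rw [← hc]; simp
      simp only [hf, this, if_true]
      exact hP1 w hw
    · refine (hP0 w hw hc).trans ?_
      simp only [hf]
      split_ifs <;> norm_num
  refine h1.trans (hx _ _ ?_)
  have h2 := iter (θs.length / m) θs hθ (Nat.div_mul_le_self _ _) f hfs
  rw [hfN, mul_one] at h2
  refine le_trans ?_ h2
  exact (Avg_contr T hδ.le hθ hfs).1.le_tsum ω' (fun _ _ => sq_nonneg _)

end Gap
end

noncomputable section
attribute [local instance] LieRing.ofAssociativeRing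

/-- Rayleigh quotient. -/
def Ray {J : Type} [Fintype J] (A y : J → ℝ) : ℝ := (∑ i, A i * y i ^ 2) / ∑ i, y i ^ 2

lemma Ray_smul {J : Type} [Fintype J] (A y : J → ℝ) {c : ℝ} (hc : c ≠ 0) :
    Ray A (c • y) = Ray A y := by
  have h1 : ∑ i, A i * (c • y) i ^ 2 = c ^ 2 * ∑ i, A i * y i ^ 2 := by
    rw [Finset.mul_sum]; exact Finset.sum_congr rfl fun i _ => by simp; ring
  have h2 : ∑ i, (c • y) i ^ 2 = c ^ 2 * ∑ i, y i ^ 2 := by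
    rw [Finset.mul_sum]; exact Finset.sum_congr rfl fun i _ => by simp; ring
  rw [Ray, h1, h2, mul_div_mul_left _ _ (pow_ne_zero 2 hc), Ray]

lemma Ray_bound {J : Type} [Fintype J] (A y : J → ℝ) : |Ray A y| ≤ ∑ i, |A i| := by
  rw [Ray, abs_div, abs_of_nonneg (Finset.sum_nonneg fun i _ => sq_nonneg (y i))]
  apply div_le_of_le_mul₀ (Finset.sum_nonneg fun i _ => sq_nonneg (y i))
    (Finset.sum_nonneg fun i _ => abs_nonneg _)
  rw [Finset.mul_sum]
  refine (Finset.abs_sum_le_sum_abs _ _).trans (Finset.sum_le_sum fun i _ => ?_)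
  rw [abs_mul, abs_of_nonneg (sq_nonneg (y i))]
  exact mul_le_mul_of_nonneg_right (Finset.single_le_sum (f := fun i => |A i|)
    (fun _ _ => abs_nonneg _) (Finset.mem_univ i)) (sq_nonneg _)

lemma sum_sq_pos {J : Type} [Fintype J] {y : J → ℝ} (hy : y ≠ 0) : 0 < ∑ i, y i ^ 2 := by
  obtain ⟨i, hi⟩ := Function.ne_iff.mp hy
  exact Finset.sum_pos' (fun _ _ => sq_nonneg _) ⟨i, Finset.mem_univ _, by
    have hi' : y i ≠ 0 := hi
    positivity⟩

lemma Ray_key {J : Type} [Fintype J] (A y : J → ℝ) :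
    (∑ i, A i * (A i * y i) ^ 2) * (∑ i, y i ^ 2) - (∑ i, A i * y i ^ 2) * (∑ i, (A i * y i) ^ 2)
      = (∑ i, ∑ j, (A i + A j) * (A i - A j) ^ 2 * (y i ^ 2 * y j ^ 2)) / 2 := by
  have h1 : ∑ i, ∑ j, (A i + A j) * (A i - A j) ^ 2 * (y i ^ 2 * y j ^ 2)
      = ∑ i, ∑ j, (A i ^ 3 * y i ^ 2 * y j ^ 2 - A i * y i ^ 2 * (A j ^ 2 * y j ^ 2))
        + ∑ i, ∑ j, (A j ^ 3 * y j ^ 2 * y i ^ 2 - A j * y j ^ 2 * (A i ^ 2 * y i ^ 2)) := by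
    rw [← Finset.sum_add_distrib]
    refine Finset.sum_congr rfl fun i _ => ?_
    rw [← Finset.sum_add_distrib]
    refine Finset.sum_congr rfl fun j _ => ?_
    ring
  have h2 : ∑ i, ∑ j, (A j ^ 3 * y j ^ 2 * y i ^ 2 - A j * y j ^ 2 * (A i ^ 2 * y i ^ 2))
    = ∑ i, ∑ j, (A i ^ 3 * y i ^ 2 * y j ^ 2 - A i * y i ^ 2 * (A j ^ 2 * y j ^ 2)) :=
    Finset.sum_comm
  rw [h1, h2, Finset.sum_mul_sum, Finset.sum_mul_sum, ← Finset.sum_sub_distrib, ← two_mul,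
    mul_div_cancel_left₀ _ two_ne_zero]
  refine Finset.sum_congr rfl fun i _ => ?_
  rw [← Finset.sum_sub_distrib]
  refine Finset.sum_congr rfl fun j _ => ?_
  ring

lemma Ray_diff {J : Type} [Fintype J] {A y : J → ℝ} (hA : ∀ i, 0 < A i) (hy : y ≠ 0) :
    Ray A (fun i => A i * y i) - Ray A y =
      (∑ i, ∑ j, (A i + A j) * (A i - A j) ^ 2 * (y i ^ 2 * y j ^ 2)) / 2 /
        ((∑ i, (A i * y i) ^ 2) * ∑ i, y i ^ 2) ∧
    0 < (∑ i, (A i * y i) ^ 2) * ∑ i, y i ^ 2 := by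
  have h1 := sum_sq_pos hy
  have h2 : 0 < ∑ i, (A i * y i) ^ 2 := by
    apply sum_sq_pos (y := fun i => A i * y i)
    intro h0
    apply hy
    funext i
    exact (mul_eq_zero.mp (congrFun h0 i)).resolve_left (hA i).ne'
  refine ⟨?_, mul_pos h2 h1⟩
  rw [Ray, Ray, ← Ray_key, div_sub_div _ _ h2.ne' h1.ne']
  congr 1
  ring

lemma Ray_mono {J : Type} [Fintype J] {A y : J → ℝ} (hA : ∀ i, 0 < A i) :
    Ray A y ≤ Ray A (fun i => A i * y i) := by
  by_cases hy : y = 0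
  · subst hy
    simp [Ray]
  obtain ⟨h1, h2⟩ := Ray_diff hA hy
  rw [← sub_nonneg, h1]
  refine div_nonneg (div_nonneg (Finset.sum_nonneg fun i _ => Finset.sum_nonneg fun j _ => ?_)
    two_pos.le) h2.le
  have := hA i
  have := hA j
  positivity

lemma Ray_eq {J : Type} [Fintype J] {A y : J → ℝ} (hA : ∀ i, 0 < A i) (hy : y ≠ 0)
    (h : Ray A (fun i => A i * y i) ≤ Ray A y) (i j : J) (hi : y i ≠ 0) (hj : y j ≠ 0) :
    A i = A j := by
  obtain ⟨h1, h2⟩ := Ray_diff hA hy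
  by_contra hne
  have hnn : ∀ i j, 0 ≤ (A i + A j) * (A i - A j) ^ 2 * (y i ^ 2 * y j ^ 2) := by
    intro i j
    have := hA i
    have := hA j
    positivity
  have : 0 < ∑ i, ∑ j, (A i + A j) * (A i - A j) ^ 2 * (y i ^ 2 * y j ^ 2) := by
    refine Finset.sum_pos' (fun i _ => Finset.sum_nonneg fun j _ => hnn i j)
      ⟨i, Finset.mem_univ _, Finset.sum_pos' (fun j _ => hnn i j) ⟨j, Finset.mem_univ _, ?_⟩⟩
    have := hA i
    have := hA j
    have := sub_ne_zero.mpr hne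
    positivity
  have h3 : 0 < Ray A (fun i => A i * y i) - Ray A y := by rw [h1]; positivity
  linarith

lemma Ray_cont {J X : Type} [Fintype J] [TopologicalSpace X] (A : J → ℝ) {f : X → J → ℝ} {s : Set X}
    (hf : Continuous f) (h0 : ∀ x ∈ s, f x ≠ 0) : ContinuousOn (fun x => Ray A (f x)) s := by
  have hi : ∀ i, Continuous fun x => f x i := fun i => (continuous_apply i).comp hf
  unfold Ray
  refine ContinuousOn.div ?_ ?_ ?_
  · exact (continuous_finsetSum _ fun i _ => continuous_const.mul ((hi i).pow 2)).continuousOn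
  · exact (continuous_finsetSum _ fun i _ => (hi i).pow 2).continuousOn
  · intro x hx
    exact (sum_sq_pos (h0 x hx)).ne'

namespace Sys
variable {k l : ℕ} (S : Sys k l) (R : Type) [Fintype R] [DecidableEq R]

/-- Invariant tensors. -/
def Ts : Submodule ℝ ((R → Fin k) → ℝ) where
  carrier := {t | ∀ X ∈ S.nn, drho R X *ᵥ t = 0}
  add_mem' := fun {a b} ha hb X hX => by rw [Matrix.mulVec_add, ha X hX, hb X hX, add_zero]
  zero_mem' := fun X _ => Matrix.mulVec_zero _
  smul_mem' := fun c t ht X hX => by rw [Matrix.mulVec_smul, ht X hX, smul_zero]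

variable {S R}

lemma Ts_wd {t : (R → Fin k) → ℝ} (ht : t ∈ S.Ts R) (u : List (Fin l)) :
    rho R (S.wd u) *ᵥ t ∈ S.Ts R := by
  intro X hX
  rw [Matrix.mulVec_mulVec, ← rho_drho R (S.wd u) ((S.wd u)⁻¹ * X * S.wd u) X,
    ← Matrix.mulVec_mulVec, ht _ (S.conj_nn_wd u hX), Matrix.mulVec_zero]
  simp only [← Matrix.mul_assoc, S.wd_mul_inv, Matrix.one_mul]

lemma Ts_wd_inv {t : (R → Fin k) → ℝ} (ht : t ∈ S.Ts R) (u : List (Fin l)) :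
    rho R (S.wd u)⁻¹ *ᵥ t ∈ S.Ts R := by
  intro X hX
  rw [Matrix.mulVec_mulVec, ← rho_drho R (S.wd u)⁻¹ (S.wd u * X * (S.wd u)⁻¹) X,
    ← Matrix.mulVec_mulVec, ht _ (S.conj_nn_wd' u hX), Matrix.mulVec_zero]
  simp only [← Matrix.mul_assoc, S.wd_inv_mul, Matrix.one_mul]

/-- A tensor which is an eigenvector modulo invariant tensors is invariant. -/
lemma Ts_of_eig {t : (R → Fin k) → ℝ}
    (h : ∀ X ∈ S.gens, ∃ χ : ℝ, drho R X *ᵥ t - χ • t ∈ S.Ts R) : t ∈ S.Ts R := by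
  have hkill : ∀ {s}, s ∈ S.Ts R → ∀ X ∈ S.nn, drho R X *ᵥ s = 0 := fun hs X hX => hs X hX
  have br : ∀ X ∈ S.nn, ∀ Y ∈ S.nn, ∀ χ ψ : ℝ, drho R X *ᵥ t - χ • t ∈ S.Ts R →
      drho R Y *ᵥ t - ψ • t ∈ S.Ts R → drho R (X * Y - Y * X) *ᵥ t ∈ S.Ts R := by
    intro X hX Y hY χ ψ h1 h2
    have e1 := hkill h2 X hX
    have e2 := hkill h1 Y hY
    rw [Matrix.mulVec_sub, Matrix.mulVec_smul, sub_eq_zero] at e1 e2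
    rw [← drho_lie, Matrix.sub_mulVec, ← Matrix.mulVec_mulVec, ← Matrix.mulVec_mulVec, e1, e2]
    have := (S.Ts R).sub_mem ((S.Ts R).smul_mem ψ h1) ((S.Ts R).smul_mem χ h2)
    convert this using 1
    module
  have all : ∀ X ∈ S.nn, ∃ χ : ℝ, drho R X *ᵥ t - χ • t ∈ S.Ts R := by
    intro X hX
    induction hX using LieSubalgebra.lieSpan_induction with
    | mem x hx => exact h x hx
    | zero => exact ⟨0, by simp [drho_zero]⟩
    | add x y hx hy h1 h2 =>
      obtain ⟨χ, h1⟩ := h1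
      obtain ⟨ψ, h2⟩ := h2
      refine ⟨χ + ψ, ?_⟩
      rw [drho_add, Matrix.add_mulVec]
      convert (S.Ts R).add_mem h1 h2 using 1
      module
    | smul c x hx h1 =>
      obtain ⟨χ, h1⟩ := h1
      refine ⟨c * χ, ?_⟩
      rw [drho_smul, Matrix.smul_mulVec]
      convert (S.Ts R).smul_mem c h1 using 1
      module
    | lie x y hx hy h1 h2 =>
      obtain ⟨χ, h1⟩ := h1
      obtain ⟨ψ, h2⟩ := h2
      refine ⟨0, ?_⟩
      rw [zero_smul, sub_zero]
      exact br x hx y hy χ ψ h1 h2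
  have perf : ∀ U : Submodule ℝ ((R → Fin k) → ℝ),
      (∀ X ∈ S.nn, ∀ Y ∈ S.nn, drho R (X * Y - Y * X) *ᵥ t ∈ U) →
      ∀ X ∈ S.nn, drho R X *ᵥ t ∈ U := by
    intro U hU X hX
    have hX' : X ∈ Submodule.span ℝ {Z | ∃ X ∈ S.nn, ∃ Y ∈ S.nn, Z = X * Y - Y * X} := by
      rw [S.perfect]; exact hX
    induction hX' using Submodule.span_induction with
    | mem x hx =>
      obtain ⟨X', hX', Y, hY, rfl⟩ := hx
      exact hU X' hX' Y hY
    | zero => simp [drho_zero]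
    | add x y hx hy h1 h2 =>
      rw [drho_add, Matrix.add_mulVec]
      have e : ∀ x, x ∈ Submodule.span ℝ {Z | ∃ X ∈ S.nn, ∃ Y ∈ S.nn, Z = X * Y - Y * X} →
        x ∈ S.nn := fun x hx => by rw [S.perfect] at hx; exact hx
      exact U.add_mem (h1 (e x hx)) (h2 (e y hy))
    | smul c x hx h1 =>
      rw [drho_smul, Matrix.smul_mulVec]
      have e : ∀ x, x ∈ Submodule.span ℝ {Z | ∃ X ∈ S.nn, ∃ Y ∈ S.nn, Z = X * Y - Y * X} →
        x ∈ S.nn := fun x hx => by rw [S.perfect] at hx; exact hx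
      exact U.smul_mem c (h1 (e x hx))
  have s1 : ∀ X ∈ S.nn, drho R X *ᵥ t ∈ S.Ts R := perf _ (fun X hX Y hY => by
    obtain ⟨χ, h1⟩ := all X hX
    obtain ⟨ψ, h2⟩ := all Y hY
    exact br X hX Y hY χ ψ h1 h2)
  have s2 : ∀ X ∈ S.nn, drho R X *ᵥ t ∈ (⊥ : Submodule ℝ ((R → Fin k) → ℝ)) :=
    perf _ (fun X hX Y hY => by
      rw [← drho_lie, Matrix.sub_mulVec, ← Matrix.mulVec_mulVec, ← Matrix.mulVec_mulVec,
        hkill (s1 Y hY) X hX, hkill (s1 X hX) Y hY, sub_zero]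
      exact Submodule.zero_mem _)
  intro X hX
  exact (Submodule.mem_bot ℝ).mp (s2 X hX)

variable (S R)

/-- A projection with kernel the invariant tensors and commuting with the diagonal operators. -/
lemma exists_P : ∃ P : ((R → Fin k) → ℝ) →ₗ[ℝ] ((R → Fin k) → ℝ),
    (∀ t, t - P t ∈ S.Ts R) ∧ (∀ t ∈ S.Ts R, P t = 0) ∧
    (∀ z t, P (fun i => (∏ r, S.D z (i r)) * t i) = fun i => (∏ r, S.D z (i r)) * P t i) := by
  classical
  obtain ⟨π, hπ⟩ := (S.Ts R).subtype.exists_leftInverse_of_injective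
    (LinearMap.ker_eq_bot.mpr (S.Ts R).subtype_injective)
  have hπ' : ∀ s (hs : s ∈ S.Ts R), (π s : (R → Fin k) → ℝ) = s := by
    intro s hs
    have := LinearMap.congr_fun hπ ⟨s, hs⟩
    simp only [LinearMap.comp_apply, Submodule.subtype_apply, LinearMap.id_apply] at this
    rw [this]
  let I0 : (R → Fin k) → ℝ := fun i => if ∀ z, ∑ r, S.hh z (i r) = 0 then 1 else 0
  let M0 : ((R → Fin k) → ℝ) →ₗ[ℝ] ((R → Fin k) → ℝ) := (Matrix.diagonal I0).mulVecLin
  have hM0 : ∀ t i, M0 t i = I0 i * t i := fun t i => by simp [M0, Matrix.mulVec_diagonal]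
  have hsupp : ∀ s ∈ S.Ts R, ∀ i, s i ≠ 0 → ∀ z, ∑ r, S.hh z (i r) = 0 := by
    intro s hs i hi z
    have := congrFun (hs _ (S.diag_hh_mem z)) i
    rw [drho_diagonal] at this
    simp only [Matrix.mulVec_diagonal, Pi.zero_apply] at this
    exact (mul_eq_zero.mp this).resolve_right hi
  have hM0s : ∀ s ∈ S.Ts R, M0 s = s := by
    intro s hs
    funext i
    rw [hM0]
    by_cases hi : s i = 0
    · simp [hi]
    · have := hsupp s hs i hi
      simp only [I0]
      rw [if_pos this, one_mul]
  refine ⟨LinearMap.id - (S.Ts R).subtype ∘ₗ π ∘ₗ M0, ?_, ?_, ?_⟩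
  · intro t
    simp
  · intro t ht
    simp [hM0s t ht, hπ' t ht]
  · intro z t
    -- constant value on I0
    obtain ⟨a0, ha0⟩ : ∃ a0 : ℝ, ∀ i : R → Fin k, (∀ z, ∑ r, S.hh z (i r) = 0) → ∏ r, S.D z (i r) = a0 := by
      by_cases hex : ∃ i : R → Fin k, ∀ z, ∑ r, S.hh z (i r) = 0
      · obtain ⟨j, hj⟩ := hex
        exact ⟨∏ r, S.D z (j r), fun i hi => (S.level z i j).mpr (by rw [hi z, hj z])⟩
      · exact ⟨0, fun i hi => absurd ⟨i, hi⟩ hex⟩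
    have e1 : M0 (fun i => (∏ r, S.D z (i r)) * t i) = a0 • M0 t := by
      funext i
      rw [Pi.smul_apply, hM0, hM0, smul_eq_mul]
      by_cases hi : ∀ z, ∑ r, S.hh z (i r) = 0
      · rw [ha0 i hi]; ring
      · simp only [I0]; rw [if_neg hi]; ring
    have e2 : ∀ s ∈ S.Ts R, ∀ i, a0 * s i = (∏ r, S.D z (i r)) * s i := by
      intro s hs i
      by_cases hi : s i = 0
      · simp [hi]
      · rw [ha0 i (hsupp s hs i hi)]
    funext i
    simp only [LinearMap.sub_apply, LinearMap.id_apply, LinearMap.comp_apply, Pi.sub_apply, e1,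
      map_smul, Submodule.subtype_apply, Submodule.coe_smul, Pi.smul_apply, smul_eq_mul]
    rw [e2 _ (π (M0 t)).2 i]
    ring

theorem rayleigh : ∃ (F : Finset (List (Fin l) × Fin l))
    (Rf : List (Fin l) × Fin l → ((R → Fin k) → ℝ) → ℝ) (K ε : ℝ), 0 < ε ∧
    (∀ j t, |Rf j t| ≤ K) ∧ (∀ j t (c : ℝ), c ≠ 0 → Rf j (c • t) = Rf j t) ∧
    ∀ t, t ∉ S.Ts R → ε ≤ ∑ j ∈ F, (Rf j (rho R (S.dl j.1 j.2) *ᵥ t) - Rf j t) := by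
  classical
  obtain ⟨P, hP1, hP2, hP3⟩ := S.exists_P R
  let A : Fin l → (R → Fin k) → ℝ := fun z i => ∏ r, S.D z (i r)
  have hA : ∀ z i, 0 < A z i := fun z i => Finset.prod_pos fun r _ => S.Dpos z _
  let y : List (Fin l) → ((R → Fin k) → ℝ) →ₗ[ℝ] ((R → Fin k) → ℝ) :=
    fun u => P ∘ₗ (rho R (S.wd u)).mulVecLin
  have hy : ∀ u t, y u t = P (rho R (S.wd u) *ᵥ t) := fun u t => rfl
  have hyA : ∀ u z t, y u (rho R (S.dl u z) *ᵥ t) = fun i => A z i * y u t i := by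
    intro u z t
    rw [hy, hy, ← hP3, Matrix.mulVec_mulVec, dl, rho_gen, ← Matrix.mul_assoc, ← Matrix.mul_assoc,
      rho_mul_inv (S.det_wd u), Matrix.one_mul, ← Matrix.mulVec_mulVec]
    congr 1
    funext i
    rw [Matrix.mulVec_diagonal]
  have hP0 : ∀ t, P t = 0 → t ∈ S.Ts R := fun t ht => by
    have := hP1 t
    rwa [ht, sub_zero] at this
  have hy0 : ∀ u t, t ∉ S.Ts R → y u t ≠ 0 := by
    intro u t ht h0
    apply ht
    have := Ts_wd_inv (hP0 _ h0) u
    rwa [Matrix.mulVecLin_apply, Matrix.mulVec_mulVec, rho_inv_mul (S.det_wd u), Matrix.one_mulVec] at this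
  have hyP : ∀ u t, y u (P t) = y u t := by
    intro u t
    have := hP2 _ (Ts_wd (hP1 t) u)
    rw [Matrix.mulVec_sub, map_sub, sub_eq_zero] at this
    exact this.symm
  have hstrict : ∀ t, t ∉ S.Ts R → ∃ u z,
      Ray (A z) (y u t) < Ray (A z) (fun i => A z i * y u t i) := by
    intro t ht
    by_contra hcon
    push Not at hcon
    apply ht
    apply Ts_of_eig
    rintro X ⟨u, z, rfl⟩
    have hlev := Ray_eq (hA z) (hy0 u t ht) (hcon u z)
    obtain ⟨j, hj⟩ := Function.ne_iff.mp (hy0 u t ht)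
    refine ⟨∑ r, S.hh z (j r), ?_⟩
    set χ := ∑ r, S.hh z (j r) with hχ
    have e1 : ∀ i, (∑ r, S.hh z (i r)) * y u t i = χ * y u t i := by
      intro i
      by_cases hi : y u t i = 0
      · simp [hi]
      · rw [(S.level z i j).mp (hlev i j hi hj)]
    have hs := hP1 (rho R (S.wd u) *ᵥ t)
    rw [← hy] at hs
    set s := rho R (S.wd u) *ᵥ t - y u t with hsdef
    have e2 : rho R (S.wd u) *ᵥ t = y u t + s := by rw [hsdef]; abel
    have e3 : Matrix.diagonal (fun i : R → Fin k => ∑ r, S.hh z (i r)) *ᵥ (rho R (S.wd u) *ᵥ t)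
        = χ • (rho R (S.wd u) *ᵥ t) - χ • s := by
      have h1 := hs _ (S.diag_hh_mem z)
      rw [drho_diagonal] at h1
      rw [e2, Matrix.mulVec_add, h1, smul_add, add_sub_cancel_right, add_zero]
      funext i
      rw [Matrix.mulVec_diagonal, e1, Pi.smul_apply, smul_eq_mul]
    rw [drho_gen, ← Matrix.mulVec_mulVec, ← Matrix.mulVec_mulVec, e3, Matrix.mulVec_sub,
      Matrix.mulVec_smul, Matrix.mulVec_smul, Matrix.mulVec_mulVec, rho_inv_mul (S.det_wd u),
      Matrix.one_mulVec]
    have := (S.Ts R).smul_mem (-χ) (Ts_wd_inv hs u)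
    convert this using 1
    module
  let Rf : List (Fin l) × Fin l → ((R → Fin k) → ℝ) → ℝ := fun j t => Ray (A j.2) (y j.1 t)
  let G : List (Fin l) × Fin l → ((R → Fin k) → ℝ) → ℝ :=
    fun j t => Rf j (rho R (S.dl j.1 j.2) *ᵥ t) - Rf j t
  have hG : ∀ j t, G j t = Ray (A j.2) (fun i => A j.2 i * y j.1 t i) - Ray (A j.2) (y j.1 t) := by
    intro j t
    simp only [G, Rf, hyA]
  have hGnn : ∀ j t, 0 ≤ G j t := fun j t => by
    rw [hG, sub_nonneg]; exact Ray_mono (hA _)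
  let Sph : Set ((R → Fin k) → ℝ) := {w | P w = w} ∩ Metric.sphere 0 1
  have hPc : Continuous P := LinearMap.continuous_of_finiteDimensional P
  have hSc : IsCompact Sph := (isCompact_sphere _ _).inter_left
    (isClosed_eq hPc continuous_id)
  have hSn : ∀ w ∈ Sph, w ∉ S.Ts R := by
    intro w hw ht
    have h1 : P w = w := hw.1
    rw [hP2 w ht] at h1
    have := hw.2
    rw [← h1] at this
    simp at this
  have hGc : ∀ j, ContinuousOn (G j) Sph := by
    intro j
    have hc : Continuous (y j.1) := LinearMap.continuous_of_finiteDimensional _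
    have h1 : ContinuousOn (fun t => Ray (A j.2) (fun i => A j.2 i * y j.1 t i)) Sph := by
      apply Ray_cont
      · exact continuous_pi fun i => continuous_const.mul ((continuous_apply i).comp hc)
      · intro w hw h0
        apply hy0 j.1 w (hSn w hw)
        funext i
        exact (mul_eq_zero.mp (congrFun h0 i)).resolve_left (hA _ i).ne'
    have h2 : ContinuousOn (fun t => Ray (A j.2) (y j.1 t)) Sph :=
      Ray_cont _ hc (fun w hw => hy0 j.1 w (hSn w hw))
    refine (h1.sub h2).congr fun t _ => ?_
    rw [hG]
    rfl
  obtain ⟨F, hF⟩ : ∃ F : Finset (List (Fin l) × Fin l), ∀ w ∈ Sph, 0 < ∑ j ∈ F, G j w := by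
    refine hSc.induction_on (p := fun s => ∃ F : Finset (List (Fin l) × Fin l),
      ∀ w ∈ s, 0 < ∑ j ∈ F, G j w) ?_ ?_ ?_ ?_
    · exact ⟨∅, by simp⟩
    · rintro s t hst ⟨F, hF⟩
      exact ⟨F, fun w hw => hF w (hst hw)⟩
    · rintro s t ⟨F, hF⟩ ⟨F', hF'⟩
      refine ⟨F ∪ F', fun w hw => ?_⟩
      rcases hw with hw | hw
      · exact (hF w hw).trans_le (Finset.sum_le_sum_of_subset_of_nonneg Finset.subset_union_left
          fun _ _ _ => hGnn _ _)
      · exact (hF' w hw).trans_le (Finset.sum_le_sum_of_subset_of_nonneg Finset.subset_union_right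
          fun _ _ _ => hGnn _ _)
    · intro w hw
      obtain ⟨u, z, huz⟩ := hstrict w (hSn w hw)
      have hpos : 0 < G (u, z) w := by rw [hG]; exact sub_pos.mpr huz
      exact ⟨_, (hGc (u, z) w hw).eventually (lt_mem_nhds hpos), {(u, z)}, fun v hv => by
        rw [Finset.sum_singleton]; exact hv⟩
  obtain ⟨ε, hε, hεF⟩ : ∃ ε > 0, ∀ w ∈ Sph, ε ≤ ∑ j ∈ F, G j w := by
    rcases Sph.eq_empty_or_nonempty with he | hne
    · exact ⟨1, one_pos, fun w hw => by simp [he] at hw⟩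
    · obtain ⟨w0, hw0, hmin⟩ := hSc.exists_isMinOn hne
        (continuousOn_finsetSum F fun j _ => hGc j)
      exact ⟨_, hF w0 hw0, fun w hw => hmin hw⟩
  have hsm : ∀ j t (c : ℝ), c ≠ 0 → Rf j (c • t) = Rf j t := by
    intro j t c hc
    simp only [Rf, map_smul]
    exact Ray_smul _ _ hc
  refine ⟨F, Rf, ∑ z, ∑ i, |A z i|, ε, hε, ?_, hsm, ?_⟩
  · intro j t
    refine (Ray_bound _ _).trans ?_
    exact Finset.single_le_sum (f := fun z => ∑ i, |A z i|)
      (fun _ _ => Finset.sum_nonneg fun _ _ => abs_nonneg _) (Finset.mem_univ j.2)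
  · intro t ht
    have hPt : P t ≠ 0 := fun h0 => ht (hP0 t h0)
    have hn : ‖P t‖ ≠ 0 := norm_ne_zero_iff.mpr hPt
    have hPP : P (P t) = P t := by
      have := hP2 _ (hP1 t)
      rw [map_sub, sub_eq_zero] at this
      exact this.symm
    have hw : ‖P t‖⁻¹ • P t ∈ Sph := by
      refine ⟨?_, ?_⟩
      · change P _ = _
        rw [map_smul, hPP]
      · simp [norm_smul, hn]
    refine (hεF _ hw).trans (le_of_eq ?_)
    refine Finset.sum_congr rfl fun j _ => ?_
    simp only [G]
    rw [Matrix.mulVec_smul, hsm _ _ _ (inv_ne_zero hn), hsm _ _ _ (inv_ne_zero hn)]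
    simp only [Rf, hyA, hyP]

end Sys
end

noncomputable section

attribute [local instance] LieRing.ofAssociativeRing

/-! ### Part E2 : Plücker coordinates of subspaces -/

section plu
variable {N : Type} [Fintype N] [DecidableEq N] {d : ℕ}

/-- Minors of a family of vectors. -/
def om0 (b : Fin d → N → ℝ) (m : Fin d → N) : ℝ := (Matrix.of fun r a => b a (m r)).det

lemma om0_expand (b : Fin d → N → ℝ) (G : Fin d → N → ℝ) :
    (Matrix.of fun (r a : Fin d) => ∑ n, G r n * b a n).det
      = ∑ m : Fin d → N, (∏ r, G r (m r)) * om0 b m := by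
  have e : (Matrix.of fun (r a : Fin d) => ∑ n, G r n * b a n)
      = fun r => ∑ n, G r n • (fun a => b a n) := by
    funext r a
    simp [Finset.sum_apply]
  have h := (Matrix.detRowAlternating (n := Fin d) (R := ℝ)).toMultilinearMap.map_sum
    (fun r (n : N) => G r n • (fun a => b a n))
  rw [e]
  refine h.trans ?_
  refine Finset.sum_congr rfl fun m _ => ?_
  have h2 := (Matrix.detRowAlternating (n := Fin d) (R := ℝ)).toMultilinearMap.map_smul_univ
    (fun r => G r (m r)) (fun r a => b a (m r))
  exact h2

lemma om0_mulVec (b : Fin d → N → ℝ) (G : Matrix N N ℝ) (m : Fin d → N) :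
    om0 (fun a => G *ᵥ b a) m = ∑ m' : Fin d → N, (∏ r, G (m r) (m' r)) * om0 b m' := by
  rw [← om0_expand b (fun r => G (m r))]
  rfl

lemma om0_ne {b : Fin d → N → ℝ} (hb : LinearIndependent ℝ b) : ∃ m, om0 b m ≠ 0 := by
  by_contra hne
  push Not at hne
  have hinj : Function.Injective (Fintype.linearCombination ℝ b) := by
    exact linearIndependent_iff_injective_fintypeLinearCombination.mp hb
  obtain ⟨g, hg⟩ := LinearMap.exists_leftInverse_of_injective (Fintype.linearCombination ℝ b)
    (LinearMap.ker_eq_bot.mpr hinj)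
  have h := om0_expand b (fun r n => g (Pi.single n 1) r)
  simp only [hne, mul_zero, Finset.sum_const_zero] at h
  have e : (Matrix.of fun (r a : Fin d) => ∑ n, g (Pi.single n 1) r * b a n) = 1 := by
    ext r a
    have h1 : g (b a) r = (1 : Matrix (Fin d) (Fin d) ℝ) r a := by
      have := congrArg (fun f => f r) (LinearMap.congr_fun hg (Pi.single a 1))
      simp only [LinearMap.comp_apply, Fintype.linearCombination_apply_single, one_smul,
        LinearMap.id_apply] at this
      rw [this, Matrix.one_apply, Pi.single_apply]
    rw [Matrix.of_apply, ← h1]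
    conv_rhs => rw [pi_eq_sum_univ' (b a)]
    rw [map_sum, Finset.sum_apply]
    refine Finset.sum_congr rfl fun n _ => ?_
    rw [map_smul, Pi.smul_apply, smul_eq_mul, mul_comm]
  rw [e, Matrix.det_one] at h
  exact one_ne_zero h

lemma om0_prop {b b' : Fin d → N → ℝ} (hb' : LinearIndependent ℝ b')
    (h : ∀ a, b' a ∈ Submodule.span ℝ (Set.range b)) :
    ∃ c : ℝ, c ≠ 0 ∧ om0 b' = c • om0 b := by
  choose A hA using fun a => (Submodule.mem_span_range_iff_exists_fun ℝ).mp (h a)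
  have e : ∀ m, om0 b' m = (Matrix.of A).det * om0 b m := by
    intro m
    rw [om0, om0, ← Matrix.det_transpose (Matrix.of A), mul_comm, ← Matrix.det_mul]
    congr 1
    ext r a
    simp only [Matrix.of_apply, Matrix.mul_apply, Matrix.transpose_apply]
    rw [← hA a, Finset.sum_apply]
    exact Finset.sum_congr rfl fun i _ => by simp [mul_comm]
  refine ⟨_, ?_, funext e⟩
  intro h0
  obtain ⟨m, hm⟩ := om0_ne hb'
  rw [e, h0, zero_mul] at hm
  exact hm rfl

lemma om0_cramer (b : Fin d → N → ℝ) (m : Fin d → N) (a : Fin d) :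
    om0 b m • b a = ∑ r, b a (m r) • fun n => om0 b (Function.update m r n) := by
  funext n
  have h := congrFun (Matrix.mulVec_cramer (Matrix.of fun r a => b a (m r))ᵀ (fun a => b a n)) a
  rw [Matrix.det_transpose] at h
  rw [Pi.smul_apply, Finset.sum_apply]
  refine h.symm.trans ?_
  simp only [Matrix.mulVec, dotProduct, Matrix.transpose_apply, Matrix.of_apply, Pi.smul_apply,
    smul_eq_mul]
  refine Finset.sum_congr rfl fun r _ => ?_
  congr 1
  rw [Matrix.cramer_transpose_apply, om0]
  congr 1
  ext r' a'
  by_cases hr : r' = r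
  · subst hr; simp
  · simp [Matrix.updateRow_ne hr, Function.update_of_ne hr]

lemma om0_span {b b' : Fin d → N → ℝ} (hb : LinearIndependent ℝ b) (hb' : LinearIndependent ℝ b')
    {c : ℝ} (hc : c ≠ 0) (h : om0 b' = c • om0 b) :
    Submodule.span ℝ (Set.range b') = Submodule.span ℝ (Set.range b) := by
  obtain ⟨m, hm⟩ := om0_ne hb
  have key : ∀ {b : Fin d → N → ℝ}, LinearIndependent ℝ b → om0 b m ≠ 0 →
      Submodule.span ℝ (Set.range b)
        = Submodule.span ℝ (Set.range fun r n => om0 b (Function.update m r n)) := by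
    intro b hb hm
    apply Submodule.eq_of_le_of_finrank_le
    · rw [Submodule.span_le]
      rintro _ ⟨a, rfl⟩
      have : b a = (om0 b m)⁻¹ • (om0 b m • b a) := by rw [smul_smul, inv_mul_cancel₀ hm, one_smul]
      rw [this, om0_cramer]
      refine Submodule.smul_mem _ _ (Submodule.sum_mem _ fun r _ => Submodule.smul_mem _ _ ?_)
      exact Submodule.subset_span ⟨r, rfl⟩
    · rw [finrank_span_eq_card hb]
      exact (finrank_range_le_card _)
  have hm' : om0 b' m ≠ 0 := by rw [h]; exact mul_ne_zero hc hm
  rw [key hb hm, key hb' hm']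
  apply le_antisymm
  · rw [Submodule.span_le]
    rintro _ ⟨r, rfl⟩
    have : (fun n => om0 b' (Function.update m r n)) = c • fun n => om0 b (Function.update m r n) := by
      funext n; rw [h]; rfl
    simp only [this]
    exact Submodule.smul_mem _ _ (Submodule.subset_span ⟨r, rfl⟩)
  · rw [Submodule.span_le]
    rintro _ ⟨r, rfl⟩
    have : (fun n => om0 b (Function.update m r n)) = c⁻¹ • fun n => om0 b' (Function.update m r n) := by
      funext n; rw [h]; simp [hc]
    simp only [this]
    exact Submodule.smul_mem _ _ (Submodule.subset_span ⟨r, rfl⟩)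

end plu

/-- Plücker tensor. -/
def om {k d : ℕ} (b : Fin d → (Fin 2 → Fin k) → ℝ) : ((Fin d × Fin 2) → Fin k) → ℝ :=
  fun i => om0 b (fun r c => i (r, c))

lemma rho_om {k d : ℕ} (g : Matrix (Fin k) (Fin k) ℝ) (b : Fin d → (Fin 2 → Fin k) → ℝ) :
    rho (Fin d × Fin 2) g *ᵥ om b = om (fun a => rho (Fin 2) g *ᵥ b a) := by
  funext i
  rw [om, om0_mulVec]
  simp only [Matrix.mulVec, dotProduct]
  refine Fintype.sum_equiv (Equiv.curry (Fin d) (Fin 2) (Fin k)) _ _ fun i' => ?_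
  congr 1
  simp [rho, tens, Fintype.prod_prod_type, Function.curry]

lemma om_eq {k d : ℕ} {b b' : Fin d → (Fin 2 → Fin k) → ℝ} {c : ℝ} (h : om b' = c • om b) :
    om0 b' = c • om0 b := by
  funext m
  have := congrFun h (fun rc => m rc.1 rc.2)
  exact this

lemma om_ne {k d : ℕ} {b : Fin d → (Fin 2 → Fin k) → ℝ} (hb : LinearIndependent ℝ b) : om b ≠ 0 := by
  intro h
  obtain ⟨m, hm⟩ := om0_ne hb
  exact hm (congrFun h (fun rc => m rc.1 rc.2))

namespace Sys
variable {k l : ℕ} {S : Sys k l}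

lemma eig_of_Ts {R : Type} [Fintype R] [DecidableEq R] {t : (R → Fin k) → ℝ} (ht : t ∈ S.Ts R)
    (h0 : t ≠ 0) (u : List (Fin l)) (z : Fin l) :
    ∃ c : ℝ, c ≠ 0 ∧ rho R (S.dl u z) *ᵥ t = c • t := by
  set y := rho R (S.wd u) *ᵥ t with hy
  have hy0 : y ≠ 0 := fun h => h0 (rho_inj (S.det_wd u) h)
  have h1 := ht _ (LieSubalgebra.subset_lieSpan ⟨u, z, rfl⟩)
  rw [drho_gen, ← Matrix.mulVec_mulVec, ← Matrix.mulVec_mulVec] at h1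
  have h2 : Matrix.diagonal (fun i : R → Fin k => ∑ r, S.hh z (i r)) *ᵥ y = 0 := by
    have : rho R (S.wd u) *ᵥ (rho R (S.wd u)⁻¹ *ᵥ
      (Matrix.diagonal (fun i : R → Fin k => ∑ r, S.hh z (i r)) *ᵥ y)) = 0 := by
      rw [hy, h1, Matrix.mulVec_zero]
    rwa [Matrix.mulVec_mulVec, rho_mul_inv (S.det_wd u), Matrix.one_mulVec] at this
  obtain ⟨i0, hi0⟩ := Function.ne_iff.mp hy0
  have h3 : ∀ i, y i ≠ 0 → ∑ r, S.hh z (i r) = 0 := by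
    intro i hi
    have := congrFun h2 i
    rw [Matrix.mulVec_diagonal] at this
    exact (mul_eq_zero.mp this).resolve_right hi
  refine ⟨∏ r, S.D z (i0 r), (Finset.prod_pos fun r _ => S.Dpos z _).ne', ?_⟩
  rw [dl, rho_gen, ← Matrix.mulVec_mulVec, ← Matrix.mulVec_mulVec, ← hy]
  have h4 : Matrix.diagonal (fun i : R → Fin k => ∏ r, S.D z (i r)) *ᵥ y
      = (∏ r, S.D z (i0 r)) • y := by
    funext i
    rw [Matrix.mulVec_diagonal, Pi.smul_apply, smul_eq_mul]
    by_cases hi : y i = 0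
    · rw [hi]; simp
    · congr 1
      rw [S.level, h3 i hi, h3 i0 hi0]
  rw [h4, Matrix.mulVec_smul, hy, Matrix.mulVec_mulVec, rho_inv_mul (S.det_wd u), Matrix.one_mulVec]

lemma li_rho {R : Type} [Fintype R] [DecidableEq R] {d : ℕ} {b : Fin d → (R → Fin k) → ℝ}
    (hb : LinearIndependent ℝ b) {g : Matrix (Fin k) (Fin k) ℝ} (hg : IsUnit g.det) :
    LinearIndependent ℝ (fun a => rho R g *ᵥ b a) := by
  refine hb.map' (rho R g).mulVecLin (LinearMap.ker_eq_bot'.mpr fun m hm => ?_)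
  exact rho_inj hg hm

lemma linv_of_om {d : ℕ} {b : Fin d → (Fin 2 → Fin k) → ℝ} (hb : LinearIndependent ℝ b)
    (ht : om b ∈ S.Ts (Fin d × Fin 2)) : S.LInv (Submodule.span ℝ (Set.range b)) := by
  rw [linv_iff]
  intro u z v hv
  obtain ⟨c, hc, h⟩ := eig_of_Ts ht (om_ne hb) u z
  rw [rho_om] at h
  rw [← om0_span hb (li_rho hb (S.det_dl u z)) hc (om_eq h)]
  have : Set.range (fun a => rho (Fin 2) (S.dl u z) *ᵥ b a)
      = Set.image (rho (Fin 2) (S.dl u z)).mulVecLin (Set.range b) := by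
    rw [← Set.range_comp]; rfl
  rw [this, Submodule.span_image]
  exact ⟨v, hv, rfl⟩

end Sys
end

noncomputable section

/-! ### Part E3 : no atoms for the action on subspaces -/

namespace Sys
variable {k l : ℕ} (S : Sys k l)

/-- Non-invariant subspaces of given dimension. -/
abbrev Om (d : ℕ) : Type :=
  {E : Submodule ℝ ((Fin 2 → Fin k) → ℝ) // Module.finrank ℝ E = d ∧ ¬ S.LInv E}

/-- The permutation attached to a letter. -/
def TT (d : ℕ) (s : Fin l) : Equiv.Perm (S.Om d) where
  toFun E := ⟨S.act (Fin 2) [s] E.1, by rw [finrank_act]; exact E.2.1, fun h => E.2.2 (LInv.of_act [s] h)⟩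
  invFun E := ⟨S.iact (Fin 2) [s] E.1, by rw [finrank_iact]; exact E.2.1, fun h => E.2.2 (by
    have := h.act [s]
    rwa [act_iact] at this)⟩
  left_inv E := Subtype.ext (iact_act [s] E.1)
  right_inv E := Subtype.ext (act_iact [s] E.1)

lemma Tw_TT (d : ℕ) (w : List (Fin l)) (E : S.Om d) :
    (Tw (S.TT d) w E).1 = S.act (Fin 2) w E.1 := by
  induction w with
  | nil => simp [Tw, act_nil]
  | cons s w ih =>
    have : S.act (Fin 2) (s :: w) E.1 = S.act (Fin 2) [s] (S.act (Fin 2) w E.1) := by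
      rw [← act_append]; rfl
    rw [this, ← ih]
    rfl

lemma act_dl (u : List (Fin l)) (z : Fin l) (E : Submodule ℝ ((Fin 2 → Fin k) → ℝ)) :
    S.act (Fin 2) (z :: u) E
      = S.act (Fin 2) (S.o :: u) (E.map (rho (Fin 2) (S.dl u z)).mulVecLin) := by
  rw [act, act, ← Submodule.map_comp, ← Matrix.mulVecLin_mul, ← rho_mul]
  congr 3
  rw [wd, wd, dl, S.ha z]
  simp only [Matrix.mul_assoc]
  rw [← Matrix.mul_assoc (S.wd u), S.wd_mul_inv, Matrix.one_mul]

lemma exists_bas {d : ℕ} {E : Submodule ℝ ((Fin 2 → Fin k) → ℝ)} (h : Module.finrank ℝ E = d) :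
    ∃ b : Fin d → (Fin 2 → Fin k) → ℝ, LinearIndependent ℝ b ∧ Submodule.span ℝ (Set.range b) = E := by
  let B := Module.finBasisOfFinrankEq ℝ E h
  refine ⟨fun a => (B a : (Fin 2 → Fin k) → ℝ), ?_, ?_⟩
  · exact B.linearIndependent.map' E.subtype (Submodule.ker_subtype E)
  · have : Set.range (fun a => (B a : (Fin 2 → Fin k) → ℝ)) = Set.image E.subtype (Set.range B) := by
      rw [← Set.range_comp]; rfl
    rw [this, Submodule.span_image, B.span_eq, Submodule.map_top, Submodule.range_subtype]

theorem no_atoms (d : ℕ) {δ : ℝ} (hδ : 0 < δ) :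
    ∃ C ρ : ℝ, 0 < C ∧ 0 < ρ ∧ ρ < 1 ∧ ∀ (θs : List (Fin l → ℝ)), Good δ θs →
      ∀ (P : List (Fin l) → ℝ) (E E' : Submodule ℝ ((Fin 2 → Fin k) → ℝ)),
      Module.finrank ℝ E = d → ¬ S.LInv E →
      (∀ w, w.length = θs.length → P w ≤ 1) →
      (∀ w, w.length = θs.length → S.act (Fin 2) w E' ≠ E → P w ≤ 0) →
      Ex θs P ≤ C * ρ ^ θs.length := by
  classical
  obtain ⟨F, Rf, K, ε, hε, hK, hsc, hR⟩ := S.rayleigh (Fin d × Fin 2)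
  choose bas hbas1 hbas2 using fun E : S.Om d => exists_bas E.2.1
  let dat : GapData (S.TT d) S.o F :=
    { u := fun j => j.1.1
      z := fun j => j.1.2
      Rf := fun j E => Rf j.1 (om (bas E))
      K := K
      ε := ε
      hε := hε
      hK := fun j E => hK _ _
      hR := by
        intro E
        have hE : om (bas E) ∉ S.Ts (Fin d × Fin 2) := by
          intro h
          have := linv_of_om (hbas1 E) h
          rw [hbas2] at this
          exact E.2.2 this
        refine (hR _ hE).trans (le_of_eq ?_)
        rw [← Finset.sum_coe_sort F]
        refine Finset.sum_congr rfl fun j _ => ?_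
        congr 1
        set E' := ((Tw (S.TT d) j.1.1)⁻¹ * (S.TT d S.o)⁻¹ * S.TT d j.1.2 * Tw (S.TT d) j.1.1) E with hE'
        have h1 : Tw (S.TT d) (S.o :: j.1.1) E' = Tw (S.TT d) (j.1.2 :: j.1.1) E := by
          rw [hE']
          simp only [Tw, ← Equiv.Perm.mul_apply]
          congr 1
          group
        have h2 := congrArg Subtype.val h1
        rw [Tw_TT, Tw_TT, S.act_dl j.1.1 j.1.2] at h2
        have h3 : E'.1 = E.1.map (rho (Fin 2) (S.dl j.1.1 j.1.2)).mulVecLin := by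
          rw [← iact_act (S := S) (S.o :: j.1.1) E'.1, h2, iact_act]
        rw [rho_om]
        obtain ⟨c, hc, h4⟩ := om0_prop (b := fun a => rho (Fin 2) (S.dl j.1.1 j.1.2) *ᵥ bas E a)
          (hbas1 E') (by
            intro a
            have h5 : bas E' a ∈ E'.1 := by
              have h7 : bas E' a ∈ Submodule.span ℝ (Set.range (bas E')) :=
                Submodule.subset_span ⟨a, rfl⟩
              rwa [hbas2 E'] at h7
            rw [h3, ← hbas2 E, ← Submodule.span_image, ← Set.range_comp] at h5
            exact h5)
        have h6 : om (bas E') = c • om (fun a => rho (Fin 2) (S.dl j.1.1 j.1.2) *ᵥ bas E a) := by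
          funext i
          exact congrFun h4 _
        rw [h6, hsc _ _ _ hc] }
  obtain ⟨C, ρ, hC, hρ0, hρ1, h⟩ := gap (S.TT d) dat hδ
  refine ⟨C, ρ, hC, hρ0, hρ1, ?_⟩
  intro θs hθ P E E' hEd hEL hP1 hP0
  by_cases hE' : Module.finrank ℝ E' = d ∧ ¬ S.LInv E'
  · refine h θs hθ P ⟨E', hE'⟩ ⟨E, hEd, hEL⟩ hP1 ?_
    intro w hw hne
    refine hP0 w hw fun heq => hne (Subtype.ext ?_)
    rw [Tw_TT]
    exact heq
  · have h0 : Ex θs P ≤ Ex θs (fun _ => 0) := by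
      refine Ex_mono hδ.le hθ fun w hw => hP0 w hw fun heq => hE' ?_
      refine ⟨by rw [← hEd, ← heq, finrank_act], fun hL => hEL ?_⟩
      rw [← heq]
      exact hL.act w
    rw [Ex_const hθ] at h0
    exact h0.trans (by positivity)

end Sys
end

noncomputable section

/-! ### Part F : descent -/

namespace Sys
variable {k l : ℕ} (S : Sys k l)

open Classical in
/-- Indicator. -/
def ind (Q : Prop) : ℝ := if Q then 1 else 0

lemma ind_le (Q : Prop) : ind Q ≤ 1 := by unfold ind; split_ifs <;> norm_num
lemma ind_nonneg (Q : Prop) : 0 ≤ ind Q := by unfold ind; split_ifs <;> norm_num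
lemma ind_of_not {Q : Prop} (h : ¬ Q) : ind Q = 0 := if_neg h
lemma ind_of {Q : Prop} (h : Q) : ind Q = 1 := if_pos h
lemma ind_and (Q Q' : Prop) : ind Q * ind Q' = ind (Q ∧ Q') := by
  unfold ind; split_ifs <;> simp_all

lemma Ex_double {δ : ℝ} (hδ : 0 ≤ δ) {θ1 θ2 : List (Fin l → ℝ)} (h2 : Good δ θ2)
    (G : List (Fin l) → List (Fin l) → ℝ) :
    (Ex θ1 fun g => Ex θ2 fun h => G g h) ^ 2
      ≤ Ex θ1 fun g' => Ex θ1 fun g => Ex θ2 fun h => G g' h * G g h := by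
  rw [Ex_comm θ1 θ2]
  refine (Ex_sq_le hδ h2 _).trans (le_of_eq ?_)
  have : ∀ h, (Ex θ1 fun g => G g h) ^ 2 = Ex θ1 fun g' => Ex θ1 fun g => G g' h * G g h := by
    intro h
    rw [sq, ← Ex_smul]
    refine Ex_congr fun g _ => ?_
    rw [Ex_smul, mul_comm]
  simp only [this]
  rw [Ex_comm θ2 θ1]
  refine Ex_congr fun g' _ => ?_
  rw [Ex_comm θ2 θ1]

theorem descent {δ : ℝ} (hδ : 0 < δ) (d : ℕ) :
    ∃ C ρ : ℝ, 0 < C ∧ 0 < ρ ∧ ρ < 1 ∧ ∀ (θs : List (Fin l → ℝ)), Good δ θs →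
      ∀ (E : Submodule ℝ ((Fin 2 → Fin k) → ℝ)), S.Thin E → Module.finrank ℝ E ≤ d →
      ∀ x y : Fin k → ℝ, wedge x y ≠ 0 →
      Ex θs (fun w => ind (rho (Fin 2) (S.wd w) *ᵥ wedge x y ∈ E)) ≤ C * ρ ^ θs.length := by
  induction d with
  | zero =>
    refine ⟨1, 1/2, one_pos, by norm_num, by norm_num, ?_⟩
    intro θs hθ E hE hd x y hxy
    have : E = ⊥ := Submodule.finrank_eq_zero.mp (Nat.le_zero.mp hd)
    subst this
    have h0 : Ex θs (fun w => ind (rho (Fin 2) (S.wd w) *ᵥ wedge x y ∈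
        (⊥ : Submodule ℝ ((Fin 2 → Fin k) → ℝ)))) = Ex θs (fun _ => 0) := by
      refine Ex_congr fun w _ => ind_of_not fun h => hxy ?_
      exact rho_inj (S.det_wd w) ((Submodule.mem_bot ℝ).mp h)
    rw [h0, Ex_const hθ]
    positivity
  | succ d ih =>
    obtain ⟨C0, ρ0, hC0, hρ00, hρ01, h0⟩ := ih
    obtain ⟨C1, ρ1, hC1, hρ10, hρ11, h1⟩ := S.no_atoms (d + 1) hδ
    set a := max ρ0 ρ1 with ha
    have ha0 : 0 < a := lt_max_of_lt_left hρ00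
    have ha1 : a < 1 := max_lt hρ01 hρ11
    obtain ⟨C2, ρ2, hC2, hρ20, hρ21, h2⟩ := expo ha0 ha1 (m := 2) (by norm_num)
    set M := Real.sqrt (C0 + C1) with hM
    have hM0 : 0 < M := Real.sqrt_pos.mpr (by positivity)
    have hMsq : M ^ 2 = C0 + C1 := Real.sq_sqrt (by positivity)
    refine ⟨C0 + M * C2, max ρ0 ρ2, by positivity, lt_max_of_lt_left hρ00, max_lt hρ01 hρ21, ?_⟩
    intro θs hθ E hE hd x y hxy
    have hb1 : ρ0 ^ θs.length ≤ (max ρ0 ρ2) ^ θs.length :=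
      pow_le_pow_left₀ hρ00.le (le_max_left _ _) _
    have hb2 : ρ2 ^ θs.length ≤ (max ρ0 ρ2) ^ θs.length :=
      pow_le_pow_left₀ hρ20.le (le_max_right _ _) _
    have hpos : 0 ≤ (max ρ0 ρ2) ^ θs.length := le_trans (by positivity) hb1
    by_cases hd' : Module.finrank ℝ E ≤ d
    · refine (h0 θs hθ E hE hd' x y hxy).trans ?_
      nlinarith [mul_le_mul_of_nonneg_left hb1 hC0.le, mul_nonneg (mul_pos hM0 hC2).le hpos]
    have hdE : Module.finrank ℝ E = d + 1 := by omega
    by_cases hL : S.LInv E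
    · have h0 : Ex θs (fun w => ind (rho (Fin 2) (S.wd w) *ᵥ wedge x y ∈ E)) = Ex θs (fun _ => 0) := by
        refine Ex_congr fun w _ => ind_of_not fun h => hxy ?_
        have h' := h
        rw [rho_wedge] at h'
        have h3 := hE E hL le_rfl _ _ h'
        rw [← rho_wedge] at h3
        exact rho_inj (S.det_wd w) h3
      rw [h0, Ex_const hθ]
      positivity
    set n := θs.length with hn
    set θ1 := θs.take (n / 2) with hθ1
    set θ2 := θs.drop (n / 2) with hθ2
    have hsplit : θs = θ1 ++ θ2 := (List.take_append_drop _ _).symm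
    have hg1 : Good δ θ1 := Good.left (θs' := θ2) (hsplit ▸ hθ)
    have hg2 : Good δ θ2 := Good.right (θs := θ1) (hsplit ▸ hθ)
    have hl1 : θ1.length = n / 2 := by simp [hθ1, ← hn]; omega
    have hl2 : θ2.length = n - n / 2 := by simp [hθ2, ← hn]
    set P := Ex θs (fun w => ind (rho (Fin 2) (S.wd w) *ᵥ wedge x y ∈ E)) with hP
    have hP2 : P = Ex θ1 fun g => Ex θ2 fun h =>
        ind (rho (Fin 2) (S.wd h) *ᵥ wedge x y ∈ S.iact (Fin 2) g E) := by
      rw [hP, hsplit, Ex_append]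
      refine Ex_congr fun g _ => Ex_congr fun h _ => ?_
      rw [iact, Submodule.mem_comap, Matrix.mulVecLin_apply, Matrix.mulVec_mulVec, wd_append, rho_mul]
    have hbound : P ^ 2 ≤ C1 * ρ1 ^ (n / 2) + C0 * ρ0 ^ (n - n / 2) := by
      rw [hP2]
      refine (Ex_double hδ.le hg2 _).trans ?_
      have hc : Ex θ1 (fun _ => C1 * ρ1 ^ (n / 2) + C0 * ρ0 ^ (n - n / 2))
        = C1 * ρ1 ^ (n / 2) + C0 * ρ0 ^ (n - n / 2) := Ex_const hg1 _
      rw [← hc]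
      refine Ex_mono hδ.le hg1 fun g' hg' => ?_
      have h3 := h1 θ1 hg1 (fun g => ind (S.act (Fin 2) g (S.iact (Fin 2) g' E) = E)) E
        (S.iact (Fin 2) g' E) hdE hL (fun _ _ => ind_le _) (fun w _ hne => (ind_of_not hne).le)
      rw [hl1] at h3
      have h4 : Ex θ1 (fun g => ind (S.act (Fin 2) g (S.iact (Fin 2) g' E) = E)
          + C0 * ρ0 ^ (n - n / 2)) ≤ C1 * ρ1 ^ (n / 2) + C0 * ρ0 ^ (n - n / 2) := by
        rw [Ex_add, Ex_const hg1]
        linarith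
      refine le_trans (Ex_mono hδ.le hg1 fun g hg => ?_) h4
      have h5 : Ex θ2 (fun h => ind (rho (Fin 2) (S.wd h) *ᵥ wedge x y ∈ S.iact (Fin 2) g' E)
          * ind (rho (Fin 2) (S.wd h) *ᵥ wedge x y ∈ S.iact (Fin 2) g E))
          = Ex θ2 (fun h => ind (rho (Fin 2) (S.wd h) *ᵥ wedge x y ∈
            S.iact (Fin 2) g' E ⊓ S.iact (Fin 2) g E)) := by
        refine Ex_congr fun h _ => ?_
        rw [ind_and, Submodule.mem_inf]
      rw [h5]
      have hpp : 0 ≤ C0 * ρ0 ^ (n - n / 2) := by positivity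
      by_cases heq : S.act (Fin 2) g (S.iact (Fin 2) g' E) = E
      · rw [ind_of heq]
        have h6 : Ex θ2 (fun h => ind (rho (Fin 2) (S.wd h) *ᵥ wedge x y ∈
            S.iact (Fin 2) g' E ⊓ S.iact (Fin 2) g E)) ≤ Ex θ2 (fun _ => 1) :=
          Ex_mono hδ.le hg2 fun _ _ => ind_le _
        rw [Ex_const hg2] at h6
        linarith
      · have hne : S.iact (Fin 2) g' E ≠ S.iact (Fin 2) g E := by
          intro h
          apply heq
          rw [h, act_iact]
        have h6 := h0 θ2 hg2 (S.iact (Fin 2) g' E ⊓ S.iact (Fin 2) g E)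
          ((hE.iact g').mono inf_le_left) (by
            by_contra hlt
            push Not at hlt
            have e1 := Submodule.eq_of_le_of_finrank_le
              (inf_le_left : S.iact (Fin 2) g' E ⊓ S.iact (Fin 2) g E ≤ S.iact (Fin 2) g' E)
              (by rw [finrank_iact]; omega)
            have e2 := Submodule.eq_of_le_of_finrank_le
              (inf_le_right : S.iact (Fin 2) g' E ⊓ S.iact (Fin 2) g E ≤ S.iact (Fin 2) g E)
              (by rw [finrank_iact]; omega)
            exact hne (e1.symm.trans e2)) x y hxy
        rw [hl2] at h6
        have := ind_nonneg (S.act (Fin 2) g (S.iact (Fin 2) g' E) = E)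
        linarith
    have hb3 : ρ1 ^ (n / 2) ≤ a ^ (n / 2) := pow_le_pow_left₀ hρ10.le (le_max_right _ _) _
    have hb4 : ρ0 ^ (n - n / 2) ≤ a ^ (n / 2) :=
      (pow_le_pow_left₀ hρ00.le (le_max_left _ _) _).trans
        (pow_le_pow_of_le_one ha0.le ha1.le (by omega))
    have hfin := h2 n (P / M) (by
      rw [div_pow, div_le_iff₀ (by positivity), hMsq]
      nlinarith [mul_le_mul_of_nonneg_left hb3 hC1.le, mul_le_mul_of_nonneg_left hb4 hC0.le])
    rw [div_le_iff₀ hM0] at hfin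
    nlinarith [mul_le_mul_of_nonneg_left hb2 (mul_pos hM0 hC2).le, mul_nonneg hC0.le hpos]

end Sys
end

noncomputable section

/-! ### Part G : recurrence of good times -/

namespace Sys
variable {k l : ℕ} (S : Sys k l)

lemma exists_word (X : ((Fin 2 → Fin k) → ℝ) →ₗ[ℝ] ℝ) (hX : S.Thin (LinearMap.ker X))
    (x y : Fin k → ℝ) (h0 : wedge x y ≠ 0) : ∃ u, X (rho (Fin 2) (S.wd u) *ᵥ wedge x y) ≠ 0 := by
  by_contra hne
  push Not at hne
  set Q : Submodule ℝ ((Fin 2 → Fin k) → ℝ) :=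
    Submodule.span ℝ (Set.range fun u => rho (Fin 2) (S.wd u) *ᵥ wedge x y) with hQ
  have hact : ∀ u, S.act (Fin 2) u Q = Q := by
    intro u
    apply Submodule.eq_of_le_of_finrank_le
    · rw [act, Submodule.map_le_iff_le_comap, hQ, Submodule.span_le]
      rintro _ ⟨v, rfl⟩
      refine Submodule.subset_span ⟨u ++ v, ?_⟩
      simp only [wd_append, rho_mul, Matrix.mulVecLin_apply, Matrix.mulVec_mulVec]
    · rw [finrank_act]
  have hL : S.LInv Q := by
    rw [linv_iff]
    intro u z v hv
    have h1 := S.act_dl u z Q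
    rw [hact] at h1
    have h2 : Q = Q.map (rho (Fin 2) (S.dl u z)).mulVecLin := by
      rw [← iact_act (S := S) (S.o :: u) (Q.map (rho (Fin 2) (S.dl u z)).mulVecLin), ← h1]
      conv_rhs => rw [← hact (S.o :: u)]
      rw [iact_act]
    rw [h2]
    exact ⟨v, hv, rfl⟩
  apply h0
  refine hX Q hL ?_ x y ?_
  · rw [hQ, Submodule.span_le]
    rintro _ ⟨v, rfl⟩
    exact hne v
  · refine Submodule.subset_span ⟨[], ?_⟩
    simp [wd, rho_one]

lemma wedge_apply (x y : Fin k → ℝ) (i : Fin 2 → Fin k) :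
    wedge x y i = x (i 0) * y (i 1) - y (i 0) * x (i 1) := by
  simp [wedge]

lemma wedge_cont : Continuous fun xy : (Fin k → ℝ) × (Fin k → ℝ) => wedge xy.1 xy.2 := by
  refine continuous_pi fun i => ?_
  simp only [wedge_apply]
  fun_prop

/-- Orthonormal pairs. -/
def ONP (k : ℕ) : Set ((Fin k → ℝ) × (Fin k → ℝ)) :=
  {xy | ∑ i, xy.1 i ^ 2 = 1 ∧ ∑ i, xy.2 i ^ 2 = 1 ∧ ∑ i, xy.1 i * xy.2 i = 0}

lemma ONP_compact : IsCompact (ONP k) := by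
  refine Metric.isCompact_of_isClosed_isBounded ?_ ?_
  · refine IsClosed.inter (isClosed_eq (by fun_prop) continuous_const)
      (IsClosed.inter (isClosed_eq (by fun_prop) continuous_const)
        (isClosed_eq (by fun_prop) continuous_const))
  · refine (Metric.isBounded_closedBall (x := 0) (r := 1)).subset ?_
    rintro ⟨x, y⟩ ⟨h1, h2, -⟩
    have key : ∀ x : Fin k → ℝ, ∑ i, x i ^ 2 = 1 → ‖x‖ ≤ 1 := by
      intro x hx
      rw [pi_norm_le_iff_of_nonneg zero_le_one]
      intro i
      have := Finset.single_le_sum (f := fun i => x i ^ 2) (fun i _ => sq_nonneg _) (Finset.mem_univ i)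
      rw [hx] at this
      rw [Real.norm_eq_abs]
      exact abs_le_one_iff_mul_self_le_one.mpr (by nlinarith)
    rw [mem_closedBall_zero_iff, Prod.norm_def]
    exact max_le (key x h1) (key y h2)

lemma ONP_wedge {x y : Fin k → ℝ} (h : (x, y) ∈ ONP k) : wedge x y ≠ 0 := by
  intro h0
  obtain ⟨h1, h2, h3⟩ := h
  simp only at h1 h2 h3
  have hy : ∀ j, y j = 0 := by
    intro j
    have e : ∀ i, x i * (x i * y j - y i * x j) = 0 := by
      intro i
      have := congrFun h0 ![i, j]
      rw [wedge_apply] at this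
      simp only [Matrix.cons_val_zero, Matrix.cons_val_one, Pi.zero_apply] at this
      rw [this, mul_zero]
    have e2 : ∑ i, x i * (x i * y j - y i * x j) = 0 := Finset.sum_eq_zero fun i _ => e i
    have e3 : ∑ i, x i * (x i * y j - y i * x j) = (∑ i, x i ^ 2) * y j - (∑ i, x i * y i) * x j := by
      rw [Finset.sum_mul, Finset.sum_mul, ← Finset.sum_sub_distrib]
      exact Finset.sum_congr rfl fun i _ => by ring
    rw [e3, h1, h3] at e2
    linarith
  simp [hy] at h2

lemma exists_ONP {x y : Fin k → ℝ} (h : wedge x y ≠ 0) :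
    ∃ x' y' : Fin k → ℝ, ∃ r : ℝ, (x', y') ∈ ONP k ∧ r ≠ 0 ∧ wedge x y = r • wedge x' y' := by
  have hx : x ≠ 0 := by
    rintro rfl
    apply h; funext i; simp [wedge_apply]
  set a := Real.sqrt (∑ i, x i ^ 2) with ha
  have hxx := sum_sq_pos hx
  have ha0 : 0 < a := Real.sqrt_pos.mpr hxx
  have haa : a ^ 2 = ∑ i, x i ^ 2 := Real.sq_sqrt hxx.le
  set t := (∑ i, x i * y i) / a ^ 2 with ht
  set v : Fin k → ℝ := fun i => y i - t * x i with hv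
  have hw : wedge x y = wedge x v := by
    funext i; simp only [wedge_apply, hv]; ring
  have hv0 : v ≠ 0 := by
    intro h0
    apply h; rw [hw, h0]; funext i; simp [wedge_apply]
  set b := Real.sqrt (∑ i, v i ^ 2) with hb
  have hvv := sum_sq_pos hv0
  have hb0 : 0 < b := Real.sqrt_pos.mpr hvv
  have hbb : b ^ 2 = ∑ i, v i ^ 2 := Real.sq_sqrt hvv.le
  refine ⟨fun i => x i / a, fun i => v i / b, a * b, ⟨?_, ?_, ?_⟩, (mul_pos ha0 hb0).ne', ?_⟩
  · simp only [div_pow]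
    rw [← Finset.sum_div, ← haa, div_self (pow_pos ha0 2).ne']
  · simp only [div_pow]
    rw [← Finset.sum_div, ← hbb, div_self (pow_pos hb0 2).ne']
  · have e : ∑ i, x i / a * (v i / b) = (∑ i, x i * v i) / (a * b) := by
      rw [Finset.sum_div]
      exact Finset.sum_congr rfl fun i _ => by field_simp
    have e2 : ∑ i, x i * v i = 0 := by
      have : ∑ i, x i * v i = (∑ i, x i * y i) - t * ∑ i, x i ^ 2 := by
        rw [Finset.mul_sum, ← Finset.sum_sub_distrib]
        exact Finset.sum_congr rfl fun i _ => by simp only [hv]; ring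
      rw [this, ← haa, ht]
      field_simp
      ring
    simp only
    rw [e, e2, zero_div]
  · rw [hw]
    funext i
    rw [Pi.smul_apply, wedge_apply, wedge_apply, smul_eq_mul]
    field_simp

lemma exists_word_unif (X : ((Fin 2 → Fin k) → ℝ) →ₗ[ℝ] ℝ) (hX : S.Thin (LinearMap.ker X)) :
    ∃ (m : ℕ) (c : ℝ), 0 < c ∧ ∀ x y : Fin k → ℝ, wedge x y ≠ 0 → ∃ u : List (Fin l), u.length ≤ m ∧
      c * ‖rho (Fin 2) (S.wd u) *ᵥ wedge x y‖ ≤ |X (rho (Fin 2) (S.wd u) *ᵥ wedge x y)| := by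
  have hXc : Continuous X := LinearMap.continuous_of_finiteDimensional X
  have key : ∃ (m : ℕ) (c : ℝ), 0 < c ∧ ∀ xy ∈ ONP k, ∃ u : List (Fin l), u.length ≤ m ∧
      c * ‖rho (Fin 2) (S.wd u) *ᵥ wedge xy.1 xy.2‖
        ≤ |X (rho (Fin 2) (S.wd u) *ᵥ wedge xy.1 xy.2)| := by
    refine (ONP_compact (k := k)).induction_on (p := fun s => ∃ (m : ℕ) (c : ℝ), 0 < c ∧ ∀ xy ∈ s,
      ∃ u : List (Fin l), u.length ≤ m ∧
      c * ‖rho (Fin 2) (S.wd u) *ᵥ wedge xy.1 xy.2‖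
        ≤ |X (rho (Fin 2) (S.wd u) *ᵥ wedge xy.1 xy.2)|) ?_ ?_ ?_ ?_
    · exact ⟨0, 1, one_pos, by simp⟩
    · rintro s t hst ⟨m, c, hc, h⟩
      exact ⟨m, c, hc, fun xy hxy => h xy (hst hxy)⟩
    · rintro s t ⟨m, c, hc, h⟩ ⟨m', c', hc', h'⟩
      refine ⟨max m m', min c c', lt_min hc hc', ?_⟩
      rintro xy (hxy | hxy)
      · obtain ⟨u, hu, hh⟩ := h xy hxy
        exact ⟨u, hu.trans (le_max_left _ _),
          (mul_le_mul_of_nonneg_right (min_le_left _ _) (norm_nonneg _)).trans hh⟩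
      · obtain ⟨u, hu, hh⟩ := h' xy hxy
        exact ⟨u, hu.trans (le_max_right _ _),
          (mul_le_mul_of_nonneg_right (min_le_right _ _) (norm_nonneg _)).trans hh⟩
    · rintro ⟨x, y⟩ hxy
      obtain ⟨u, hu⟩ := S.exists_word X hX x y (ONP_wedge hxy)
      have hfc : Continuous fun xy : (Fin k → ℝ) × (Fin k → ℝ) =>
          rho (Fin 2) (S.wd u) *ᵥ wedge xy.1 xy.2 :=
        (LinearMap.continuous_of_finiteDimensional (rho (Fin 2) (S.wd u)).mulVecLin).comp wedge_cont
      set B := |X (rho (Fin 2) (S.wd u) *ᵥ wedge x y)| with hB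
      have hB0 : 0 < B := abs_pos.mpr hu
      set A := ‖rho (Fin 2) (S.wd u) *ᵥ wedge x y‖ with hA
      have hA0 : 0 ≤ A := norm_nonneg _
      set c := B / (A + 1) with hc
      have hc0 : 0 < c := by positivity
      have hlt : c * A < B := by
        rw [hc, div_mul_eq_mul_div, div_lt_iff₀ (by positivity)]
        nlinarith
      have hopen : IsOpen {xy : (Fin k → ℝ) × (Fin k → ℝ) |
          c * ‖rho (Fin 2) (S.wd u) *ᵥ wedge xy.1 xy.2‖
            < |X (rho (Fin 2) (S.wd u) *ᵥ wedge xy.1 xy.2)|} :=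
        isOpen_lt (continuous_const.mul hfc.norm) (hXc.comp hfc).abs
      refine ⟨_, mem_nhdsWithin_of_mem_nhds (hopen.mem_nhds (show (x, y) ∈ _ from hlt)),
        u.length, c, hc0, fun xy hxy => ⟨u, le_rfl, ?_⟩⟩
      exact le_of_lt hxy
  obtain ⟨m, c, hc, h⟩ := key
  refine ⟨m, c, hc, fun x y hxy => ?_⟩
  obtain ⟨x', y', r, hON, hr, hw⟩ := exists_ONP hxy
  obtain ⟨u, hu, hh⟩ := h _ hON
  refine ⟨u, hu, ?_⟩
  rw [hw, Matrix.mulVec_smul, norm_smul, map_smul, smul_eq_mul, abs_mul, Real.norm_eq_abs]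
  have := mul_le_mul_of_nonneg_left hh (abs_nonneg r)
  simp only at this
  linarith

/-- The good times. -/
def hit (X : ((Fin 2 → Fin k) → ℝ) →ₗ[ℝ] ℝ) (c : ℝ) (Y : (Fin 2 → Fin k) → ℝ)
    (w : List (Fin l)) : Prop :=
  c * ‖rho (Fin 2) (S.wd w) *ᵥ Y‖ ≤ |X (rho (Fin 2) (S.wd w) *ᵥ Y)|

/-- No good time after `N`. -/
def nohit (X : ((Fin 2 → Fin k) → ℝ) →ₗ[ℝ] ℝ) (c : ℝ) (Y : (Fin 2 → Fin k) → ℝ) (N : ℕ)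
    (w : List (Fin l)) : Prop :=
  ∀ u v, w = u ++ v → N ≤ v.length → ¬ S.hit X c Y v

theorem recur (X : ((Fin 2 → Fin k) → ℝ) →ₗ[ℝ] ℝ) (hX : S.Thin (LinearMap.ker X))
    {δ : ℝ} (hδ : 0 < δ) (hl : 0 < l) :
    ∃ (m : ℕ) (c η : ℝ), 0 < c ∧ 0 ≤ η ∧ η < 1 ∧ ∀ x y : Fin k → ℝ, wedge x y ≠ 0 →
      ∀ (N J : ℕ) (θs : List (Fin l → ℝ)), Good δ θs → θs.length = N + J * m →
      Ex θs (fun w => ind (S.nohit X c (wedge x y) N w)) ≤ η ^ J := by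
  obtain ⟨m, c, hc, h⟩ := S.exists_word_unif X hX
  set δ' := min δ (1 / 2) with hδ'
  have hδ0 : 0 < δ' := lt_min hδ (by norm_num)
  have hδ1 : δ' ^ m ≤ 1 := pow_le_one₀ hδ0.le ((min_le_right _ _).trans (by norm_num))
  have hp : 0 < δ' ^ m := by positivity
  refine ⟨m, c, 1 - δ' ^ m, hc, by linarith, by linarith, ?_⟩
  intro x y hxy N J
  induction J with
  | zero =>
    intro θs hθ _
    have := Ex_mono hδ.le hθ (F := fun w => ind (S.nohit X c (wedge x y) N w)) (G := fun _ => 1)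
      (fun w _ => ind_le _)
    rw [Ex_const hθ] at this
    simpa using this
  | succ J ih =>
    intro θs hθ hlen
    set θ1 := θs.take m with hθ1
    set θ2 := θs.drop m with hθ2
    have hsplit : θs = θ1 ++ θ2 := (List.take_append_drop _ _).symm
    have hg1 : Good δ θ1 := Good.left (θs' := θ2) (hsplit ▸ hθ)
    have hg2 : Good δ θ2 := Good.right (θs := θ1) (hsplit ▸ hθ)
    have hlen' : θs.length = N + J * m + m := by rw [hlen]; ring
    have hl1 : θ1.length = m := by simp [hθ1, hlen']
    have hl2 : θ2.length = N + J * m := by simp [hθ2, hlen']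
    have hg1' : Good δ' θ1 := fun θ hθ => ⟨fun s => (min_le_left _ _).trans ((hg1 θ hθ).1 s), (hg1 θ hθ).2⟩
    rw [hsplit, Ex_append, Ex_comm]
    have hstep : Ex θ2 (fun v => Ex θ1 (fun u => ind (S.nohit X c (wedge x y) N (u ++ v))))
        ≤ Ex θ2 (fun v => (1 - δ' ^ m) * ind (S.nohit X c (wedge x y) N v)) := by
      refine Ex_mono hδ.le hg2 fun v hv => ?_
      by_cases hno : S.nohit X c (wedge x y) N v
      · rw [ind_of hno, mul_one]
        have hv0 : wedge (S.wd v *ᵥ x) (S.wd v *ᵥ y) ≠ 0 := by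
          rw [← rho_wedge]
          exact fun h => hxy (rho_inj (S.det_wd v) h)
        obtain ⟨u, hu, hh⟩ := h _ _ hv0
        have hhit : S.hit X c (wedge x y) (u ++ v) := by
          rw [hit, wd_append, rho_mul, ← Matrix.mulVec_mulVec, rho_wedge (S.wd v)]
          exact hh
        set u0 := List.replicate (m - u.length) (⟨0, hl⟩ : Fin l) ++ u with hu0
        have hu0l : u0.length = θ1.length := by simp [hu0, hl1]; omega
        have hbad : ¬ S.nohit X c (wedge x y) N (u0 ++ v) := by
          intro hn
          refine hn (List.replicate (m - u.length) (⟨0, hl⟩ : Fin l)) (u ++ v) ?_ ?_ hhit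
          · rw [hu0, List.append_assoc]
          · rw [List.length_append, hv, hl2]
            omega
        have h3 := Ex_ge hδ0.le hg1' (F := fun u => 1 - ind (S.nohit X c (wedge x y) N (u ++ v)))
          (fun w => by have := ind_le (S.nohit X c (wedge x y) N (w ++ v)); linarith) u0 hu0l
        rw [ind_of_not hbad, hl1] at h3
        have h4 : Ex θ1 (fun u => 1 - ind (S.nohit X c (wedge x y) N (u ++ v)))
            = 1 - Ex θ1 (fun u => ind (S.nohit X c (wedge x y) N (u ++ v))) := by
          have : (fun u => 1 - ind (S.nohit X c (wedge x y) N (u ++ v)))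
            = fun u => 1 + (-1) * ind (S.nohit X c (wedge x y) N (u ++ v)) := by
            funext u; ring
          rw [this, Ex_add, Ex_const hg1, Ex_smul]
          ring
        rw [h4] at h3
        linarith
      · rw [ind_of_not hno, mul_zero]
        have h5 : Ex θ1 (fun u => ind (S.nohit X c (wedge x y) N (u ++ v))) = Ex θ1 (fun _ => 0) := by
          refine Ex_congr fun u _ => ind_of_not fun hn => hno ?_
          intro u' v' he hN
          exact hn (u ++ u') v' (by rw [he, List.append_assoc]) hN
        rw [h5, Ex_const hg1]
    refine hstep.trans ?_
    rw [Ex_smul, pow_succ, mul_comm]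
    exact mul_le_mul_of_nonneg_right (ih θ2 hg2 hl2) (by linarith)

end Sys
end

noncomputable section

/-! ### Part H : probabilistic estimates for the hidden Markov measure -/

/-- The word `[z (-n), …, z (-1)]`. -/
def zw {l : ℕ} (z : ℤ → Fin l) : ℕ → List (Fin l)
  | 0 => []
  | n + 1 => z (-((n : ℤ) + 1)) :: zw z n

lemma zw_length {l : ℕ} (z : ℤ → Fin l) (n : ℕ) : (zw z n).length = n := by
  induction n with
  | zero => rfl
  | succ n ih => simp [zw, ih]

lemma zw_suffix {l : ℕ} (z : ℤ → Fin l) (n : ℕ) (u v : List (Fin l)) (h : zw z n = u ++ v) :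
    v = zw z v.length := by
  induction n generalizing u with
  | zero =>
    have : u ++ v = [] := h.symm
    obtain ⟨-, rfl⟩ := List.append_eq_nil_iff.mp this
    rfl
  | succ n ih =>
    cases u with
    | nil =>
      simp only [List.nil_append] at h
      rw [← h, zw_length]
    | cons s u =>
      simp only [zw, List.cons_append, List.cons.injEq] at h
      exact ih u h.2

lemma zw_ofFn {l : ℕ} (z : ℤ → Fin l) (n : ℕ) :
    zw z n = List.ofFn (fun j : Fin n => z (-(n : ℤ) + (j : ℕ))) := by
  induction n with
  | zero => simp [zw]
  | succ n ih =>
    have h1 : z (-((n : ℤ) + 1)) = z (-((n + 1 : ℕ) : ℤ) + ((0 : Fin (n + 1)) : ℕ)) := by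
      congr 1
    have h2 : (fun j : Fin n => z (-(n : ℤ) + (j : ℕ)))
        = fun j : Fin n => z (-((n + 1 : ℕ) : ℤ) + ((j.succ : Fin (n + 1)) : ℕ)) := by
      funext j
      congr 1
      push_cast [Fin.val_succ]
      ring
    rw [List.ofFn_succ, zw, ih, h1, h2]

lemma Ex_ofFn {l n : ℕ} (θ : Fin n → Fin l → ℝ) (F : List (Fin l) → ℝ) :
    Ex (List.ofFn θ) F = ∑ w : Fin n → Fin l, (∏ j, θ j (w j)) * F (List.ofFn w) := by
  induction n generalizing F with
  | zero => simp [Ex]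
  | succ n ih =>
    rw [List.ofFn_succ, Ex]
    simp only [ih]
    rw [← (Fin.consEquiv (fun _ : Fin (n + 1) => Fin l)).sum_comp, Fintype.sum_prod_type]
    refine Finset.sum_congr rfl fun s _ => ?_
    rw [Finset.mul_sum]
    refine Finset.sum_congr rfl fun w _ => ?_
    rw [Fin.prod_univ_succ, List.ofFn_succ]
    simp [Fin.consEquiv, mul_assoc]

lemma chain_sum {k : ℕ} (p : Matrix (Fin k) (Fin k) ℝ) (hp : ∀ i, ∑ j, p i j = 1) (n : ℕ)
    (f : Fin k → ℝ) :
    ∑ x : Fin (n + 1) → Fin k, f (x 0) * ∏ j : Fin n, p (x j.castSucc) (x j.succ) = ∑ i, f i := by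
  induction n generalizing f with
  | zero =>
    simp only [Finset.univ_eq_empty, Finset.prod_empty, mul_one]
    exact (Equiv.funUnique (Fin 1) (Fin k)).sum_comp f
  | succ n ih =>
    rw [← (Fin.consEquiv (fun _ : Fin (n + 2) => Fin k)).sum_comp, Fintype.sum_prod_type,
      Finset.sum_comm]
    have h := ih (fun i => ∑ i', f i' * p i' i)
    rw [Finset.sum_comm] at h
    simp only [← Finset.mul_sum, hp, mul_one] at h
    rw [← h]
    refine Finset.sum_congr rfl fun x _ => ?_
    rw [Finset.sum_mul]
    refine Finset.sum_congr rfl fun i _ => ?_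
    rw [Fin.prod_univ_succ]
    simp [Fin.consEquiv, mul_assoc]

open Classical in
lemma hmm_bound {k l : ℕ} {p : Matrix (Fin k) (Fin k) ℝ} {q : Matrix (Fin k) (Fin l) ℝ}
    (hp : ∀ i, ∑ j, p i j = 1) (hq : ∀ i, ∑ m, q i m = 1) (hp0 : ∀ i j, 0 < p i j)
    {piv : Fin k → ℝ} (hpi0 : ∀ i, 0 ≤ piv i) (hpi1 : ∑ i, piv i = 1)
    {δ : ℝ} (hδ0 : 0 < δ) (hδ : ∀ i m, δ ≤ q i m)
    {μ : Measure (ℤ → Fin l)} [IsProbabilityMeasure μ] (hlaw : IsHMMLaw p q piv μ)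
    (n : ℕ) (P : List (Fin l) → Prop) (ε : ℝ)
    (h : ∀ θs : List (Fin l → ℝ), Good δ θs → θs.length = n → Ex θs (fun w => Sys.ind (P w)) ≤ ε) :
    μ {z | P (zw z n)} ≤ ENNReal.ofReal ε := by
  cases n with
  | zero =>
    have h1 := h [] (fun _ h => by simp at h) rfl
    simp only [Ex] at h1
    by_cases hP : P []
    · rw [Sys.ind_of hP] at h1
      exact prob_le_one.trans (by rw [← ENNReal.ofReal_one]; exact ENNReal.ofReal_le_ofReal h1)
    · simp [zw, hP]
  | succ n =>
    set wt : (Fin (n + 1) → Fin l) → ℝ := fun w => ∑ x : Fin (n + 1) → Fin k,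
      piv (x 0) * (∏ j : Fin n, p (x j.castSucc) (x j.succ)) * ∏ j, q (x j) (w j) with hwt
    have hq0 : ∀ i m, 0 ≤ q i m := fun i m => hδ0.le.trans (hδ i m)
    have hwt0 : ∀ w, 0 ≤ wt w := fun w => Finset.sum_nonneg fun x _ =>
      mul_nonneg (mul_nonneg (hpi0 _) (Finset.prod_nonneg fun j _ => (hp0 _ _).le))
        (Finset.prod_nonneg fun j _ => hq0 _ _)
    have hcyl : ∀ w : Fin (n + 1) → Fin l, μ {z | zw z (n + 1) = List.ofFn w} = ENNReal.ofReal (wt w) := by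
      intro w
      have hl := hlaw (-((n + 1 : ℕ) : ℤ)) n (fun t => if ht : t < n + 1 then w ⟨t, ht⟩ else w 0)
      have e1 : {z : ℤ → Fin l | ∀ t : ℕ, t ≤ n → z (-((n + 1 : ℕ) : ℤ) + t)
          = if ht : t < n + 1 then w ⟨t, ht⟩ else w 0} = {z | zw z (n + 1) = List.ofFn w} := by
        ext z
        simp only [Set.mem_ofPred_eq]
        rw [zw_ofFn, List.ofFn_inj]
        constructor
        · intro hz
          funext j
          rw [hz j (by omega), dif_pos j.2]
        · intro hz t ht
          rw [dif_pos (by omega)]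
          exact congrFun hz ⟨t, by omega⟩
      rw [e1] at hl
      rw [hl, hwt]
      congr 1
      refine Finset.sum_congr rfl fun x _ => ?_
      rw [Finset.prod_mul_distrib, Fin.prod_univ_succ]
      have e2 : ∀ j : Fin n, (if ht : (j : ℕ) + 1 < n + 1 then w ⟨(j : ℕ) + 1, ht⟩ else w 0) = w j.succ := by
        intro j
        rw [dif_pos (by omega)]
        rfl
      have e3 : (if ht : 0 < n + 1 then w ⟨0, ht⟩ else w 0) = w 0 := by
        rw [dif_pos (by omega)]; rfl
      simp only [e2, e3]
      ring
    have hsub : {z | P (zw z (n + 1))} ⊆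
        ⋃ w ∈ Finset.univ.filter (fun w : Fin (n + 1) → Fin l => P (List.ofFn w)),
          {z | zw z (n + 1) = List.ofFn w} := by
      intro z hz
      simp only [Set.mem_iUnion, Finset.mem_filter, Finset.mem_univ, true_and]
      have := zw_ofFn z (n + 1)
      exact ⟨_, by rw [← this]; exact hz, this⟩
    refine (measure_mono hsub).trans ((measure_biUnion_finset_le _ _).trans ?_)
    simp only [hcyl]
    rw [← ENNReal.ofReal_sum_of_nonneg (fun w _ => hwt0 w)]
    apply ENNReal.ofReal_le_ofReal
    rw [Finset.sum_filter]
    calc ∑ w : Fin (n + 1) → Fin l, (if P (List.ofFn w) then wt w else 0)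
        = ∑ w : Fin (n + 1) → Fin l, ∑ x : Fin (n + 1) → Fin k,
            (piv (x 0) * (∏ j : Fin n, p (x j.castSucc) (x j.succ))) *
              ((∏ j, q (x j) (w j)) * Sys.ind (P (List.ofFn w))) := by
          refine Finset.sum_congr rfl fun w _ => ?_
          by_cases hP : P (List.ofFn w)
          · simp only [hP, if_true, Sys.ind_of, mul_one, hwt]
          · rw [if_neg hP]
            simp only [Sys.ind_of_not hP, mul_zero, Finset.sum_const_zero]
      _ = ∑ x : Fin (n + 1) → Fin k, (piv (x 0) * (∏ j : Fin n, p (x j.castSucc) (x j.succ))) *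
            Ex (List.ofFn fun j => q (x j)) (fun w => Sys.ind (P w)) := by
          rw [Finset.sum_comm]
          refine Finset.sum_congr rfl fun x _ => ?_
          rw [Ex_ofFn, Finset.mul_sum]
      _ ≤ ∑ x : Fin (n + 1) → Fin k, (piv (x 0) * (∏ j : Fin n, p (x j.castSucc) (x j.succ))) * ε := by
          refine Finset.sum_le_sum fun x _ => mul_le_mul_of_nonneg_left ?_
            (mul_nonneg (hpi0 _) (Finset.prod_nonneg fun j _ => (hp0 _ _).le))
          refine h _ ?_ (by simp)
          intro θ hθ
          obtain ⟨j, rfl⟩ := (List.mem_ofFn' _ _).mp hθ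
          exact ⟨fun s => hδ _ _, hq _⟩
      _ = ε := by rw [← Finset.sum_mul, chain_sum p hp, hpi1, one_mul]

theorem hmm_ae {k l : ℕ} (S : Sys k l) (hl : 0 < l)
    {p : Matrix (Fin k) (Fin k) ℝ} {q : Matrix (Fin k) (Fin l) ℝ}
    (hp : ∀ i, ∑ j, p i j = 1) (hq : ∀ i, ∑ m, q i m = 1) (hp0 : ∀ i j, 0 < p i j)
    {piv : Fin k → ℝ} (hpi0 : ∀ i, 0 ≤ piv i) (hpi1 : ∑ i, piv i = 1)
    {δ : ℝ} (hδ0 : 0 < δ) (hδ : ∀ i m, δ ≤ q i m)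
    {μ : Measure (ℤ → Fin l)} [IsProbabilityMeasure μ] (hlaw : IsHMMLaw p q piv μ)
    (X : ((Fin 2 → Fin k) → ℝ) →ₗ[ℝ] ℝ) (hX : S.Thin (LinearMap.ker X)) :
    ∃ c : ℝ, 0 < c ∧ ∀ x y : Fin k → ℝ, wedge x y ≠ 0 →
      ∀ᵐ z ∂μ, (∀ᶠ n in atTop, X (rho (Fin 2) (S.wd (zw z n)) *ᵥ wedge x y) ≠ 0) ∧
        (∃ᶠ n in atTop, c * ‖rho (Fin 2) (S.wd (zw z n)) *ᵥ wedge x y‖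
          ≤ |X (rho (Fin 2) (S.wd (zw z n)) *ᵥ wedge x y)|) := by
  obtain ⟨C, ρ, hC, hρ0, hρ1, hdes⟩ := S.descent hδ0 (Module.finrank ℝ (LinearMap.ker X))
  obtain ⟨m, c, η, hc, hη0, hη1, hrec⟩ := S.recur X hX hδ0 hl
  refine ⟨c, hc, fun x y hxy => ?_⟩
  have h1 : ∀ᵐ z ∂μ, ∀ᶠ n in atTop,
      z ∉ {z | rho (Fin 2) (S.wd (zw z n)) *ᵥ wedge x y ∈ LinearMap.ker X} := by
    apply ae_eventually_notMem
    refine ne_top_of_le_ne_top ?_ (ENNReal.tsum_le_tsum (g := fun n => ENNReal.ofReal (C * ρ ^ n)) fun n => ?_)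
    · have hs : Summable fun n : ℕ => C * ρ ^ n := (summable_geometric_of_lt_one hρ0.le hρ1).mul_left C
      rw [← ENNReal.ofReal_tsum_of_nonneg (fun n => by positivity) hs]
      exact ENNReal.ofReal_ne_top
    · refine hmm_bound hp hq hp0 hpi0 hpi1 hδ0 hδ hlaw n
        (fun w => rho (Fin 2) (S.wd w) *ᵥ wedge x y ∈ LinearMap.ker X) _ ?_
      intro θs hθ hn
      rw [← hn]
      exact hdes θs hθ _ hX le_rfl x y hxy
  have h2 : ∀ N : ℕ, ∀ᵐ z ∂μ, ∃ n, N ≤ n ∧ S.hit X c (wedge x y) (zw z n) := by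
    intro N
    rw [ae_iff]
    have hb : ∀ J : ℕ, μ {z | ¬ ∃ n, N ≤ n ∧ S.hit X c (wedge x y) (zw z n)} ≤ ENNReal.ofReal (η ^ J) := by
      intro J
      refine (measure_mono ?_).trans (hmm_bound hp hq hp0 hpi0 hpi1 hδ0 hδ hlaw (N + J * m)
        (fun w => S.nohit X c (wedge x y) N w) (η ^ J) ?_)
      · intro z hz u v huv hN hh
        apply hz
        refine ⟨v.length, hN, ?_⟩
        rw [← zw_suffix z _ u v huv]
        exact hh
      · intro θs hθ hn
        exact hrec x y hxy N J θs hθ hn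
    have ht : Tendsto (fun J : ℕ => ENNReal.ofReal (η ^ J)) atTop (nhds 0) := by
      have := ENNReal.tendsto_ofReal (tendsto_pow_atTop_nhds_zero_of_lt_one hη0 hη1)
      simpa using this
    exact le_antisymm (ge_of_tendsto' ht hb) bot_le
  filter_upwards [h1, ae_all_iff.mpr h2] with z hz1 hz2
  refine ⟨?_, ?_⟩
  · filter_upwards [hz1] with n hn
    exact hn
  · rw [frequently_atTop]
    intro N
    exact hz2 N

end

noncomputable section

/-! ### Part I : products of positive matrices -/

/-- A sequence of products `P (n+1) = B n * P n` with uniformly positive factors. -/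
structure PosProd (k : ℕ) where
  B : ℕ → Matrix (Fin k) (Fin k) ℝ
  P : ℕ → Matrix (Fin k) (Fin k) ℝ
  al : ℝ
  be : ℝ
  hal : 0 < al
  hl : ∀ n i j, al ≤ B n i j
  hu : ∀ n i j, B n i j ≤ be
  P0 : P 0 = 1
  Ps : ∀ n, P (n + 1) = B n * P n
  kpos : 0 < k

namespace PosProd

variable {k : ℕ} (T : PosProd k)

lemma step (n : ℕ) (w : Fin k → ℝ) (i : Fin k) :
    (T.P (n + 1) *ᵥ w) i = ∑ j, T.B n i j * (T.P n *ᵥ w) j := by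
  rw [T.Ps, ← Matrix.mulVec_mulVec]
  rfl

lemma hbe : 0 < T.be :=
  T.hal.trans_le ((T.hl 0 ⟨0, T.kpos⟩ ⟨0, T.kpos⟩).trans (T.hu 0 ⟨0, T.kpos⟩ ⟨0, T.kpos⟩))

lemma nonneg_from {w : Fin k → ℝ} {n : ℕ} (h : ∀ i, 0 ≤ (T.P n *ᵥ w) i) :
    ∀ m, n ≤ m → ∀ i, 0 ≤ (T.P m *ᵥ w) i := by
  intro m hm
  induction m, hm using Nat.le_induction with
  | base => exact h
  | succ m _ ih =>
    intro i
    rw [T.step]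
    exact Finset.sum_nonneg fun j _ => mul_nonneg (T.hal.le.trans (T.hl _ _ _)) (ih j)

lemma pos {v : Fin k → ℝ} (hv : ∀ i, 0 < v i) (n : ℕ) : ∀ i, 0 < (T.P n *ᵥ v) i := by
  induction n with
  | zero => simpa [T.P0] using hv
  | succ n ih =>
    intro i
    rw [T.step]
    exact Finset.sum_pos (fun j _ => mul_pos (T.hal.trans_le (T.hl _ _ _)) (ih j))
      ⟨⟨0, T.kpos⟩, Finset.mem_univ _⟩

lemma compar {v : Fin k → ℝ} (hv : ∀ i, 0 < v i) :
    ∃ R, 0 < R ∧ ∀ n i j, (T.P n *ᵥ v) i ≤ R * (T.P n *ᵥ v) j := by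
  have hi0 : (⟨0, T.kpos⟩ : Fin k) ∈ Finset.univ := Finset.mem_univ _
  set R0 := ∑ i, ∑ j, v i / v j with hR0
  have hterm : ∀ i j, v i / v j ≤ R0 := by
    intro i j
    refine (Finset.single_le_sum (f := fun j => v i / v j)
      (fun j _ => (div_pos (hv i) (hv j)).le) (Finset.mem_univ j)).trans ?_
    exact Finset.single_le_sum (f := fun i => ∑ j, v i / v j)
      (fun i _ => Finset.sum_nonneg fun j _ => (div_pos (hv i) (hv j)).le) (Finset.mem_univ i)
  have hR0n : 0 < R0 := (div_pos (hv ⟨0, T.kpos⟩) (hv ⟨0, T.kpos⟩)).trans_le (hterm _ _)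
  refine ⟨R0 + T.be / T.al, add_pos hR0n (div_pos T.hbe T.hal), ?_⟩
  intro n i j
  cases n with
  | zero =>
    simp only [T.P0, Matrix.one_mulVec]
    have := hterm i j
    rw [div_le_iff₀ (hv j)] at this
    have h2 : 0 ≤ T.be / T.al * v j := mul_nonneg (div_pos T.hbe T.hal).le (hv j).le
    linarith
  | succ n =>
    have hp := T.pos hv n
    have h1 : (T.P (n + 1) *ᵥ v) i ≤ T.be * ∑ t, (T.P n *ᵥ v) t := by
      rw [T.step, Finset.mul_sum]
      exact Finset.sum_le_sum fun t _ => mul_le_mul_of_nonneg_right (T.hu _ _ _) (hp t).le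
    have h2 : T.al * ∑ t, (T.P n *ᵥ v) t ≤ (T.P (n + 1) *ᵥ v) j := by
      rw [T.step, Finset.mul_sum]
      exact Finset.sum_le_sum fun t _ => mul_le_mul_of_nonneg_right (T.hl _ _ _) (hp t).le
    have h3 : T.be * ∑ t, (T.P n *ᵥ v) t ≤ T.be / T.al * (T.P (n + 1) *ᵥ v) j := by
      calc T.be * ∑ t, (T.P n *ᵥ v) t = T.be / T.al * (T.al * ∑ t, (T.P n *ᵥ v) t) := by
            field_simp [T.hal.ne']
        _ ≤ _ := mul_le_mul_of_nonneg_left h2 (div_pos T.hbe T.hal).le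
    have h4 : 0 ≤ R0 * (T.P (n + 1) *ᵥ v) j := mul_nonneg hR0n.le (T.pos hv _ j).le
    linarith

lemma contr {v : Fin k → ℝ} (hv : ∀ i, 0 < v i) :
    ∃ c, 0 < c ∧ c < 1 ∧ ∀ (w : Fin k → ℝ) (n : ℕ) (m M : ℝ), m ≤ M →
      (∀ i, m * (T.P n *ᵥ v) i ≤ (T.P n *ᵥ w) i) → (∀ i, (T.P n *ᵥ w) i ≤ M * (T.P n *ᵥ v) i) →
      ∃ m' M', m ≤ m' ∧ m' ≤ M' ∧ M' ≤ M ∧ M' - m' = (1 - c) * (M - m) ∧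
        (∀ i, m' * (T.P (n + 1) *ᵥ v) i ≤ (T.P (n + 1) *ᵥ w) i) ∧
        (∀ i, (T.P (n + 1) *ᵥ w) i ≤ M' * (T.P (n + 1) *ᵥ v) i) := by
  obtain ⟨R, hR, hc⟩ := T.compar hv
  have hk : (0 : ℝ) < k := by exact_mod_cast T.kpos
  -- a constant with y' i ≤ K * y 0
  set K : ℝ := T.be * k * R with hK
  have hKp : 0 < K := mul_pos (mul_pos T.hbe hk) hR
  have hy : ∀ n i j, (T.P (n + 1) *ᵥ v) i ≤ K * (T.P n *ᵥ v) j := by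
    intro n i j
    rw [T.step]
    calc ∑ t, T.B n i t * (T.P n *ᵥ v) t ≤ ∑ _t : Fin k, T.be * (R * (T.P n *ᵥ v) j) := by
          refine Finset.sum_le_sum fun t _ => ?_
          exact mul_le_mul (T.hu _ _ _) (hc n t j) (T.pos hv n t).le T.hbe.le
      _ = _ := by simp [hK]; ring
  set c : ℝ := min (1 / 2) (T.al / (2 * K)) with hcdef
  have hc0 : 0 < c := lt_min (by norm_num) (div_pos T.hal (by positivity))
  have hc1 : c ≤ 1 / 2 := min_le_left _ _
  have hc2 : c * K ≤ T.al / 2 := by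
    have : c ≤ T.al / (2 * K) := min_le_right _ _
    calc c * K ≤ T.al / (2 * K) * K := mul_le_mul_of_nonneg_right this hKp.le
      _ = T.al / 2 := by field_simp
  refine ⟨c, hc0, by linarith, ?_⟩
  intro w n m M hmM hm hM
  set o : Fin k := ⟨0, T.kpos⟩
  have hgen : ∀ u : Fin k → ℝ, (∀ i, 0 ≤ u i) → ∀ i, T.al * u o ≤ ∑ j, T.B n i j * u j := by
    intro u hu i
    refine (mul_le_mul_of_nonneg_right (T.hl n i o) (hu o)).trans ?_
    exact Finset.single_le_sum (f := fun j => T.B n i j * u j)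
      (fun j _ => mul_nonneg (T.hal.le.trans (T.hl _ _ _)) (hu j)) (Finset.mem_univ o)
  have hlow := hgen (fun i => (T.P n *ᵥ w) i - m * (T.P n *ᵥ v) i) (fun i => sub_nonneg.mpr (hm i))
  have hup := hgen (fun i => M * (T.P n *ᵥ v) i - (T.P n *ᵥ w) i) (fun i => sub_nonneg.mpr (hM i))
  have e1 : ∀ i, ∑ j, T.B n i j * ((T.P n *ᵥ w) j - m * (T.P n *ᵥ v) j)
      = (T.P (n + 1) *ᵥ w) i - m * (T.P (n + 1) *ᵥ v) i := by
    intro i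
    rw [T.step, T.step, Finset.mul_sum, ← Finset.sum_sub_distrib]
    exact Finset.sum_congr rfl fun j _ => by ring
  have e2 : ∀ i, ∑ j, T.B n i j * (M * (T.P n *ᵥ v) j - (T.P n *ᵥ w) j)
      = M * (T.P (n + 1) *ᵥ v) i - (T.P (n + 1) *ᵥ w) i := by
    intro i
    rw [T.step, T.step, Finset.mul_sum, ← Finset.sum_sub_distrib]
    exact Finset.sum_congr rfl fun j _ => by ring
  simp only [e1, e2] at hlow hup
  have hyo := T.pos hv n o
  have hcy : ∀ i, c * (T.P (n + 1) *ᵥ v) i ≤ T.al / 2 * (T.P n *ᵥ v) o := by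
    intro i
    calc c * (T.P (n + 1) *ᵥ v) i ≤ c * (K * (T.P n *ᵥ v) o) := mul_le_mul_of_nonneg_left (hy n i o) hc0.le
      _ = c * K * (T.P n *ᵥ v) o := by ring
      _ ≤ _ := mul_le_mul_of_nonneg_right hc2 hyo.le
  have hcy2 : ∀ i, c * (M - m) * (T.P (n + 1) *ᵥ v) i ≤ T.al * ((M - m) / 2 * (T.P n *ᵥ v) o) := by
    intro i
    have := mul_le_mul_of_nonneg_left (hcy i) (sub_nonneg.mpr hmM)
    nlinarith
  have hd : 0 ≤ M - m := sub_nonneg.mpr hmM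
  have hcd : 0 ≤ c * (M - m) := mul_nonneg hc0.le hd
  have hcd2 : c * (M - m) ≤ 1 / 2 * (M - m) := mul_le_mul_of_nonneg_right hc1 hd
  rcases le_total ((T.P n *ᵥ w) o) ((m + M) / 2 * (T.P n *ᵥ v) o) with h | h
  · refine ⟨m, M - c * (M - m), le_rfl, by linarith, by linarith, by ring, ?_, ?_⟩
    · intro i
      have h1 := hlow i
      have h2 : 0 ≤ T.al * ((T.P n *ᵥ w) o - m * (T.P n *ᵥ v) o) :=
        mul_nonneg T.hal.le (sub_nonneg.mpr (hm o))
      linarith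
    · intro i
      have h1 := hup i
      have h2 : T.al * ((M - m) / 2 * (T.P n *ᵥ v) o) ≤ T.al * (M * (T.P n *ᵥ v) o - (T.P n *ᵥ w) o) := by
        apply mul_le_mul_of_nonneg_left _ T.hal.le
        linarith
      have h3 := hcy2 i
      linarith
  · refine ⟨m + c * (M - m), M, by linarith, by linarith, le_rfl, by ring, ?_, ?_⟩
    · intro i
      have h1 := hlow i
      have h2 : T.al * ((M - m) / 2 * (T.P n *ᵥ v) o) ≤ T.al * ((T.P n *ᵥ w) o - m * (T.P n *ᵥ v) o) := by
        apply mul_le_mul_of_nonneg_left _ T.hal.le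
        linarith
      have h3 := hcy2 i
      linarith
    · intro i
      have h1 := hup i
      have h2 : 0 ≤ T.al * (M * (T.P n *ᵥ v) o - (T.P n *ᵥ w) o) :=
        mul_nonneg T.hal.le (sub_nonneg.mpr (hM o))
      linarith

lemma bound_init {v : Fin k → ℝ} (hv : ∀ i, 0 < v i) (w : Fin k → ℝ) :
    ∃ C, 0 < C ∧ ∀ i, |w i| ≤ C * v i := by
  refine ⟨1 + ∑ i, |w i| / v i, ?_, ?_⟩
  · exact add_pos_of_pos_of_nonneg one_pos
      (Finset.sum_nonneg fun i _ => div_nonneg (abs_nonneg _) (hv i).le)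
  · intro i
    have h := Finset.single_le_sum (f := fun i => |w i| / v i)
      (fun i _ => div_nonneg (abs_nonneg _) (hv i).le) (Finset.mem_univ i)
    have h2 : |w i| / v i ≤ 1 + ∑ i, |w i| / v i := h.trans (by linarith)
    rwa [div_le_iff₀ (hv i)] at h2

lemma dominated {v : Fin k → ℝ} (hv : ∀ i, 0 < v i) (w : Fin k → ℝ) :
    ∃ C, 0 < C ∧ ∀ n i, |(T.P n *ᵥ w) i| ≤ C * (T.P n *ᵥ v) i := by
  obtain ⟨C, hC, h⟩ := bound_init hv w
  refine ⟨C, hC, fun n i => ?_⟩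
  have h1 := T.nonneg_from (w := C • v - w) (n := 0) (by
    intro i
    have := (abs_le.mp (h i)).2
    simp only [T.P0, Matrix.one_mulVec, Pi.sub_apply, Pi.smul_apply, smul_eq_mul]
    linarith) n (Nat.zero_le _) i
  have h2 := T.nonneg_from (w := C • v + w) (n := 0) (by
    intro i
    have := (abs_le.mp (h i)).1
    simp only [T.P0, Matrix.one_mulVec, Pi.add_apply, Pi.smul_apply, smul_eq_mul]
    linarith) n (Nat.zero_le _) i
  simp only [Matrix.mulVec_sub, Matrix.mulVec_add, Matrix.mulVec_smul, Pi.sub_apply, Pi.add_apply,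
    Pi.smul_apply, smul_eq_mul] at h1 h2
  rw [abs_le]
  constructor <;> linarith

theorem doeblin {v : Fin k → ℝ} (hv : ∀ i, 0 < v i) (w : Fin k → ℝ) :
    ∃ a C r : ℝ, 0 < C ∧ 0 < r ∧ r < 1 ∧
      ∀ n i, |(T.P n *ᵥ (w - a • v)) i| ≤ C * r ^ n * (T.P n *ᵥ v) i := by
  obtain ⟨c, hc0, hc1, hcon⟩ := T.contr hv
  obtain ⟨C, hC, hdom⟩ := T.dominated hv w
  let I : ℕ → Type := fun n => {s : ℝ × ℝ // s.1 ≤ s.2 ∧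
      (∀ i, s.1 * (T.P n *ᵥ v) i ≤ (T.P n *ᵥ w) i) ∧ (∀ i, (T.P n *ᵥ w) i ≤ s.2 * (T.P n *ᵥ v) i)}
  have hs : ∀ n (s : I n), ∃ s' : I (n + 1), s.1.1 ≤ s'.1.1 ∧ s'.1.2 ≤ s.1.2 ∧
      s'.1.2 - s'.1.1 = (1 - c) * (s.1.2 - s.1.1) := by
    rintro n ⟨⟨m, M⟩, h1, h2, h3⟩
    obtain ⟨m', M', g1, g2, g3, g4, g5, g6⟩ := hcon w n m M h1 h2 h3
    exact ⟨⟨(m', M'), g2, g5, g6⟩, g1, g3, g4⟩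
  choose nx hnx using hs
  let s0 : I 0 := ⟨(-C, C), by simp only; linarith,
    fun i => by have := (abs_le.mp (hdom 0 i)).1; simp only; linarith,
    fun i => (abs_le.mp (hdom 0 i)).2⟩
  let s : ∀ n, I n := fun n => Nat.rec s0 (fun n t => nx n t) n
  have hsucc : ∀ n, s (n + 1) = nx n (s n) := fun n => rfl
  have hmono : Monotone fun n => (s n).1.1 := monotone_nat_of_le_succ fun n => (hnx n (s n)).1
  have hanti : Antitone fun n => (s n).1.2 := antitone_nat_of_succ_le fun n => (hnx n (s n)).2.1
  have hlen : ∀ n, (s n).1.2 - (s n).1.1 = 2 * C * (1 - c) ^ n := by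
    intro n
    induction n with
    | zero => show C - (-C) = _; ring
    | succ n ih => rw [hsucc, (hnx n (s n)).2.2, ih]; ring
  have hmem := hmono.ciSup_mem_iInter_Icc_of_antitone hanti (fun n => (s n).2.1)
  set a := ⨆ n, (s n).1.1 with ha
  rw [Set.mem_iInter] at hmem
  refine ⟨a, 2 * C, 1 - c, by positivity, by linarith, by linarith, fun n i => ?_⟩
  obtain ⟨h1, h2⟩ := hmem n
  have hy := T.pos hv n i
  have g1 := (s n).2.2.1 i
  have g2 := (s n).2.2.2 i
  have hl := hlen n
  rw [← hl]
  simp only [Matrix.mulVec_sub, Matrix.mulVec_smul, Pi.sub_apply, Pi.smul_apply, smul_eq_mul]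
  have k1 := mul_le_mul_of_nonneg_right h1 hy.le
  have k2 := mul_le_mul_of_nonneg_right h2 hy.le
  rw [abs_le]
  constructor <;> nlinarith

end PosProd

lemma abs_le_enorm2 {k : ℕ} (v : Fin k → ℝ) (i : Fin k) : |v i| ≤ enorm2 v := by
  unfold enorm2
  apply Real.abs_le_sqrt
  exact Finset.single_le_sum (f := fun i => v i ^ 2) (fun i _ => sq_nonneg _) (Finset.mem_univ i)

lemma enorm2_nonneg {k : ℕ} (v : Fin k → ℝ) : 0 ≤ enorm2 v := Real.sqrt_nonneg _

lemma enorm2_le {k : ℕ} (hk : 0 < k) (v : Fin k → ℝ) {C : ℝ} (h : ∀ i, |v i| ≤ C) :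
    enorm2 v ≤ k * C := by
  have hk1 : (1 : ℝ) ≤ k := by exact_mod_cast hk
  have hC : 0 ≤ C := (abs_nonneg _).trans (h ⟨0, hk⟩)
  unfold enorm2
  rw [Real.sqrt_le_left (by positivity)]
  calc ∑ i, v i ^ 2 ≤ ∑ _i : Fin k, C ^ 2 := Finset.sum_le_sum fun i _ => by
        rw [← sq_abs]; exact pow_le_pow_left₀ (abs_nonneg _) (h i) 2
    _ = k * C ^ 2 := by simp
    _ ≤ (k * C) ^ 2 := by
        rw [mul_pow]
        apply mul_le_mul_of_nonneg_right _ (sq_nonneg _)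
        nlinarith

lemma enorm2_mono {k : ℕ} (x y : Fin k → ℝ) (h : ∀ i, |x i| ≤ y i) : enorm2 x ≤ enorm2 y := by
  unfold enorm2
  apply Real.sqrt_le_sqrt
  refine Finset.sum_le_sum fun i _ => ?_
  rw [← sq_abs]
  exact pow_le_pow_left₀ (abs_nonneg _) (h i) 2

lemma enorm2_smul {k : ℕ} {c : ℝ} (hc : 0 ≤ c) (x : Fin k → ℝ) : enorm2 (c • x) = c * enorm2 x := by
  unfold enorm2
  simp only [Pi.smul_apply, smul_eq_mul, mul_pow, ← Finset.mul_sum]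
  rw [Real.sqrt_mul (sq_nonneg c), Real.sqrt_sq hc]

end

noncomputable section

/-! ### Part J : growth rates -/

lemma growth_compare {x y : ℕ → ℝ} {a b C r : ℝ} (hx : ∀ n, 0 < x n) (hy : ∀ n, 0 < y n)
    (hC : 0 < C) (hr : 0 < r) (h : ∀ᶠ n in atTop, x n ≤ C * r ^ n * y n)
    (hxa : Tendsto (fun n : ℕ => Real.log (x n) / n) atTop (nhds a))
    (hyb : Tendsto (fun n : ℕ => Real.log (y n) / n) atTop (nhds b)) : a ≤ b + Real.log r := by
  have h1 : Tendsto (fun n : ℕ => Real.log C / n + Real.log r + Real.log (y n) / n) atTop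
      (nhds (0 + Real.log r + b)) :=
    ((tendsto_const_div_atTop_nhds_zero_nat _).add tendsto_const_nhds).add hyb
  have h2 : a ≤ 0 + Real.log r + b := by
    refine le_of_tendsto_of_tendsto hxa h1 ?_
    filter_upwards [h, eventually_gt_atTop 0] with n hn hn0
    have hn' : (0 : ℝ) < n := by exact_mod_cast hn0
    have h3 := Real.log_le_log (hx n) hn
    rw [Real.log_mul (by positivity) (hy n).ne', Real.log_mul hC.ne' (by positivity),
      Real.log_pow] at h3
    rw [div_le_iff₀ hn']
    have : (Real.log C / n + Real.log r + Real.log (y n) / n) * n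
        = Real.log C + n * Real.log r + Real.log (y n) := by
      field_simp
    rw [this]
    exact h3
  linarith

lemma limsup_eq_of {u a b : ℕ → ℝ} {L : ℝ} (h1 : ∀ᶠ n in atTop, u n ≤ a n)
    (h2 : ∃ᶠ n in atTop, b n ≤ u n) (ha : Tendsto a atTop (nhds L)) (hb : Tendsto b atTop (nhds L)) :
    limsup u atTop = L := by
  have hfr : ∀ ε > 0, ∃ᶠ n in atTop, L - ε ≤ u n := by
    intro ε hε
    have he : ∀ᶠ n in atTop, L - ε ≤ b n := hb.eventually_const_le (by linarith)
    exact (h2.and_eventually he).mono fun n hn => hn.2.trans hn.1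
  have hev : ∀ ε > 0, ∀ᶠ n in atTop, u n ≤ L + ε := by
    intro ε hε
    have he : ∀ᶠ n in atTop, a n ≤ L + ε := ha.eventually_le_const (by linarith)
    filter_upwards [he, h1] with n g1 g2
    exact g2.trans g1
  have hbd : IsBoundedUnder (· ≤ ·) atTop u := ⟨L + 1, by simpa using hev 1 one_pos⟩
  have hcb : IsCoboundedUnder (· ≤ ·) atTop u := IsCoboundedUnder.of_frequently_ge (hfr 1 one_pos)
  apply le_antisymm
  · refine le_of_forall_pos_le_add fun ε hε => ?_
    exact limsup_le_of_le hcb (hev ε hε)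
  · refine le_of_forall_pos_le_add fun ε hε => ?_
    have := le_limsup_of_frequently_le (hfr ε hε) hbd
    linarith

namespace PosProd

variable {k : ℕ} (T : PosProd k)

lemma enorm2_pos {k : ℕ} {w : Fin k → ℝ} (h : w ≠ 0) : 0 < enorm2 w := by
  obtain ⟨i, hi⟩ := Function.ne_iff.mp h
  exact (abs_pos.mpr hi).trans_le (abs_le_enorm2 w i)

lemma crude {v : Fin k → ℝ} (hv : ∀ i, 0 < v i) :
    IsBoundedUnder (· ≤ ·) atTop (fun n : ℕ => Real.log (enorm2 (T.P n *ᵥ v)) / n) := by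
  have hk : (0 : ℝ) < k := by exact_mod_cast T.kpos
  have hbe := T.hbe
  have h1 : ∀ n i, (T.P n *ᵥ v) i ≤ (∑ t, v t) * (k * T.be) ^ n := by
    intro n
    induction n with
    | zero =>
      intro i
      simp only [T.P0, Matrix.one_mulVec, pow_zero, mul_one]
      exact Finset.single_le_sum (f := v) (fun i _ => (hv i).le) (Finset.mem_univ i)
    | succ n ih =>
      intro i
      rw [T.step]
      calc ∑ j, T.B n i j * (T.P n *ᵥ v) j
          ≤ ∑ _j : Fin k, T.be * ((∑ t, v t) * (k * T.be) ^ n) :=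
            Finset.sum_le_sum fun j _ => mul_le_mul (T.hu _ _ _) (ih j) (T.pos hv n j).le hbe.le
        _ = _ := by simp; ring
  have hvs : 0 < ∑ t, v t := Finset.sum_pos (fun i _ => hv i) ⟨⟨0, T.kpos⟩, Finset.mem_univ _⟩
  refine ⟨|Real.log (k * ∑ t, v t)| + Real.log (k * T.be), ?_⟩
  rw [eventually_map]
  filter_upwards [eventually_gt_atTop 0] with n hn0
  have hn1 : (1 : ℝ) ≤ n := by exact_mod_cast hn0
  have hpos : 0 < enorm2 (T.P n *ᵥ v) := by
    have := T.pos hv n ⟨0, T.kpos⟩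
    exact (this.trans_le (le_abs_self _)).trans_le (abs_le_enorm2 _ _)
  have h2 : enorm2 (T.P n *ᵥ v) ≤ k * ((∑ t, v t) * (k * T.be) ^ n) :=
    enorm2_le T.kpos _ fun i => by rw [abs_of_pos (T.pos hv n i)]; exact h1 n i
  have h3 := Real.log_le_log hpos h2
  rw [← mul_assoc, Real.log_mul (by positivity) (by positivity), Real.log_pow] at h3
  rw [div_le_iff₀ (by linarith)]
  have h4 := le_abs_self (Real.log (k * ∑ t, v t))
  have h5 : |Real.log (k * ∑ t, v t)| ≤ |Real.log (k * ∑ t, v t)| * n :=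
    le_mul_of_one_le_right (abs_nonneg _) hn1
  linarith

theorem vnotin (hinj : ∀ n w, T.P n *ᵥ w = 0 → w = 0) {v : Fin k → ℝ} (hv : ∀ i, 0 < v i)
    {lam1 lam2 : ℝ} (hlam : lam2 < lam1) (V : Submodule ℝ (Fin k → ℝ)) (hV : V ≠ ⊤)
    (hbig : ∀ w : Fin k → ℝ, w ∉ V →
        Tendsto (fun n : ℕ => Real.log (enorm2 (T.P n *ᵥ w)) / n) atTop (nhds lam1))
    (hsmall : ∀ ξ : Fin k → ℝ, ξ ∈ V → ξ ≠ 0 →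
        limsup (fun n : ℕ => Real.log (enorm2 (T.P n *ᵥ ξ)) / n) atTop ≤ lam2) : v ∉ V := by
  intro hvV
  have hv0 : v ≠ 0 := fun h => by have := hv ⟨0, T.kpos⟩; simp [h] at this
  obtain ⟨w, hw⟩ : ∃ w, w ∉ V := by
    by_contra! h
    exact hV (eq_top_iff.mpr fun w _ => h w)
  have hw0 : w ≠ 0 := fun h => hw (h ▸ V.zero_mem)
  obtain ⟨C, hC, hdom⟩ := T.dominated hv w
  have hlim := hbig w hw
  have h1 : Tendsto (fun n : ℕ => Real.log (enorm2 (T.P n *ᵥ w)) / n - Real.log C / n) atTop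
      (nhds (lam1 - 0)) := hlim.sub (tendsto_const_div_atTop_nhds_zero_nat _)
  have h2 : ∀ᶠ n : ℕ in atTop, (lam1 + lam2) / 2 ≤ Real.log (enorm2 (T.P n *ᵥ v)) / n := by
    filter_upwards [h1.eventually_const_le (show (lam1 + lam2) / 2 < lam1 - 0 by linarith)] with n hn
    refine hn.trans ?_
    rw [← sub_div]
    apply div_le_div_of_nonneg_right _ (Nat.cast_nonneg n)
    have hp1 : 0 < enorm2 (T.P n *ᵥ w) := enorm2_pos fun h => hw0 (hinj n w h)
    have hp2 : 0 < enorm2 (T.P n *ᵥ v) := enorm2_pos fun h => hv0 (hinj n v h)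
    have h3 : enorm2 (T.P n *ᵥ w) ≤ C * enorm2 (T.P n *ᵥ v) := by
      rw [← enorm2_smul hC.le]
      exact enorm2_mono _ _ fun i => hdom n i
    have h4 := Real.log_le_log hp1 h3
    rw [Real.log_mul hC.ne' hp2.ne'] at h4
    linarith
  have h5 := le_limsup_of_frequently_le h2.frequently (T.crude hv)
  have h6 := hsmall v hvV hv0
  linarith

/-- Codimension one of the slow space. -/
theorem decomp (hinj : ∀ n w, T.P n *ᵥ w = 0 → w = 0) {v : Fin k → ℝ} (hv : ∀ i, 0 < v i)
    {lam1 : ℝ} (V : Submodule ℝ (Fin k → ℝ))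
    (hbig : ∀ w : Fin k → ℝ, w ∉ V →
        Tendsto (fun n : ℕ => Real.log (enorm2 (T.P n *ᵥ w)) / n) atTop (nhds lam1))
    (hvV : v ∉ V) (w : Fin k → ℝ) : ∃ a : ℝ, w - a • v ∈ V := by
  obtain ⟨a, C, r, hC, hr0, hr1, h⟩ := T.doeblin hv w
  refine ⟨a, ?_⟩
  by_contra hn
  have hv0 : v ≠ 0 := fun h => by have := hv ⟨0, T.kpos⟩; simp [h] at this
  have hw0 : w - a • v ≠ 0 := fun h => hn (h ▸ V.zero_mem)
  have := growth_compare (x := fun n => enorm2 (T.P n *ᵥ (w - a • v))) (y := fun n => enorm2 (T.P n *ᵥ v))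
    (fun n => enorm2_pos fun h => hw0 (hinj n _ h)) (fun n => enorm2_pos fun h => hv0 (hinj n _ h))
    hC hr0 (Eventually.of_forall fun n => by
      rw [← enorm2_smul (by positivity)]
      exact enorm2_mono _ _ fun i => h n i) (hbig _ hn) (hbig _ hvV)
  have := Real.log_neg hr0 hr1
  linarith

lemma exists_nonpos (hinj : ∀ n w, T.P n *ᵥ w = 0 → w = 0) {v : Fin k → ℝ} (hv : ∀ i, 0 < v i)
    {lam1 lam2 : ℝ} (hlam : lam2 < lam1)
    (h1 : Tendsto (fun n : ℕ => Real.log (enorm2 (T.P n *ᵥ v)) / n) atTop (nhds lam1))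
    {ξ : Fin k → ℝ} (hξ : ξ ≠ 0)
    (h2 : Tendsto (fun n : ℕ => Real.log (enorm2 (T.P n *ᵥ ξ)) / n) atTop (nhds lam2)) (n : ℕ) :
    ∃ j, (T.P n *ᵥ ξ) j ≤ 0 := by
  by_contra! hpos
  obtain ⟨C, hC, hb⟩ := bound_init hpos (T.P n *ᵥ v)
  have hv0 : v ≠ 0 := fun h => by have := hv ⟨0, T.kpos⟩; simp [h] at this
  have hnn := T.nonneg_from (w := C • ξ - v) (n := n) (by
    intro i
    have := (abs_le.mp (hb i)).2
    simp only [Matrix.mulVec_sub, Matrix.mulVec_smul, Pi.sub_apply, Pi.smul_apply, smul_eq_mul]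
    linarith)
  have := growth_compare (x := fun n => enorm2 (T.P n *ᵥ v)) (y := fun n => enorm2 (T.P n *ᵥ ξ))
    (fun n => enorm2_pos fun h => hv0 (hinj n _ h)) (fun n => enorm2_pos fun h => hξ (hinj n _ h))
    hC one_pos (by
      filter_upwards [eventually_ge_atTop n] with m hm
      rw [one_pow, mul_one, ← enorm2_smul hC.le]
      refine enorm2_mono _ _ fun i => ?_
      rw [abs_of_pos (T.pos hv m i)]
      have := hnn m hm i
      simp only [Matrix.mulVec_sub, Matrix.mulVec_smul, Pi.sub_apply, Pi.smul_apply, smul_eq_mul] at this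
      simp only [Pi.smul_apply, smul_eq_mul]
      linarith) h1 h2
  rw [Real.log_one] at this
  linarith

lemma enorm2_neg {k : ℕ} (x : Fin k → ℝ) : enorm2 (-x) = enorm2 x := by
  simp [enorm2]

theorem angle (hinj : ∀ n w, T.P n *ᵥ w = 0 → w = 0) {v : Fin k → ℝ} (hv : ∀ i, 0 < v i)
    {lam1 lam2 : ℝ} (hlam : lam2 < lam1)
    (h1 : Tendsto (fun n : ℕ => Real.log (enorm2 (T.P n *ᵥ v)) / n) atTop (nhds lam1))
    {ξ : Fin k → ℝ} (hξ : ξ ≠ 0)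
    (h2 : Tendsto (fun n : ℕ => Real.log (enorm2 (T.P n *ᵥ ξ)) / n) atTop (nhds lam2)) :
    ∃ c, 0 < c ∧ ∀ n, c * (enorm2 (T.P n *ᵥ ξ) * enorm2 (T.P n *ᵥ v))
      ≤ ‖wedge (T.P n *ᵥ ξ) (T.P n *ᵥ v)‖ := by
  obtain ⟨R, hR, hcmp⟩ := T.compar hv
  have hk : (0 : ℝ) < k := by exact_mod_cast T.kpos
  refine ⟨1 / (k * (k * R)), by positivity, fun n => ?_⟩
  obtain ⟨j, hj⟩ := T.exists_nonpos hinj hv hlam h1 hξ h2 n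
  obtain ⟨j', hj'⟩ := T.exists_nonpos hinj hv hlam h1 (neg_ne_zero.mpr hξ)
    (by simpa only [Matrix.mulVec_neg, enorm2_neg] using h2) n
  simp only [Matrix.mulVec_neg, Pi.neg_apply] at hj'
  have hpos := T.pos hv n
  have hc := hcmp n
  set x := T.P n *ᵥ ξ
  set y := T.P n *ᵥ v
  obtain ⟨t, -, ht⟩ := Finset.exists_max_image Finset.univ (fun i => |x i|)
    ⟨⟨0, T.kpos⟩, Finset.mem_univ _⟩
  have hx : enorm2 x ≤ k * |x t| := enorm2_le T.kpos _ fun i => ht i (Finset.mem_univ i)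
  have hy : ∀ i, enorm2 y ≤ k * (R * y i) := fun i => enorm2_le T.kpos _ fun i' => by
    rw [abs_of_pos (hpos i')]; exact hc i' i
  have key : ∃ s, |x t| * y s ≤ ‖wedge x y‖ := by
    have hw : ∀ s, |x t * y s - y t * x s| ≤ ‖wedge x y‖ := by
      intro s
      have := norm_le_pi_norm (wedge x y) ![t, s]
      simpa [wedge] using this
    rcases le_total 0 (x t) with h | h
    · refine ⟨j, le_trans ?_ (hw j)⟩
      rw [abs_of_nonneg h]
      refine le_trans ?_ (le_abs_self _)
      nlinarith [hpos t]
    · refine ⟨j', le_trans ?_ (hw j')⟩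
      rw [abs_of_nonpos h]
      refine le_trans ?_ (neg_le_abs _)
      nlinarith [hpos t]
  obtain ⟨s, hs⟩ := key
  refine le_trans ?_ hs
  rw [div_mul_eq_mul_div, one_mul, div_le_iff₀ (by positivity)]
  calc enorm2 x * enorm2 y ≤ (k * |x t|) * (k * (R * y s)) :=
        mul_le_mul hx (hy s) (enorm2_nonneg _) (by positivity)
    _ = _ := by ring

lemma wedge_norm_le {k : ℕ} (x y : Fin k → ℝ) : ‖wedge x y‖ ≤ 2 * (enorm2 x * enorm2 y) := by
  have hx := enorm2_nonneg x
  have hy := enorm2_nonneg y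
  refine (pi_norm_le_iff_of_nonneg (by positivity)).mpr fun i => ?_
  rw [wedge, Real.norm_eq_abs]
  refine (abs_sub _ _).trans ?_
  rw [abs_mul, abs_mul]
  have h1 := mul_le_mul (abs_le_enorm2 x (i 0)) (abs_le_enorm2 y (i 1)) (abs_nonneg _) hx
  have h2 := mul_le_mul (abs_le_enorm2 x (i 1)) (abs_le_enorm2 y (i 0)) (abs_nonneg _) hx
  linarith

theorem det_main (hinj : ∀ n w, T.P n *ᵥ w = 0 → w = 0) {v : Fin k → ℝ} (hv : ∀ i, 0 < v i)
    {lam1 lam2 : ℝ} (hlam : lam2 < lam1)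
    (h1 : Tendsto (fun n : ℕ => Real.log (enorm2 (T.P n *ᵥ v)) / n) atTop (nhds lam1))
    {ξ : Fin k → ℝ} (hξ : ξ ≠ 0)
    (h2 : Tendsto (fun n : ℕ => Real.log (enorm2 (T.P n *ᵥ ξ)) / n) atTop (nhds lam2))
    (X : ((Fin 2 → Fin k) → ℝ) →ₗ[ℝ] ℝ) (ub uc : Fin k → ℝ) (hub : ∀ i, 0 < ub i) (huc : ∀ i, 0 < uc i)
    (hne : ∀ᶠ n in atTop, X (wedge (T.P n *ᵥ ξ) (T.P n *ᵥ v)) ≠ 0)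
    {c : ℝ} (hc : 0 < c)
    (hfr : ∃ᶠ n in atTop, c * ‖wedge (T.P n *ᵥ ξ) (T.P n *ᵥ v)‖ ≤ |X (wedge (T.P n *ᵥ ξ) (T.P n *ᵥ v))|) :
    limsup (fun n : ℕ => Real.log |X (wedge (T.P n *ᵥ ξ) (T.P n *ᵥ v)) /
      ((∑ i, ub i * (T.P n *ᵥ v) i) * (∑ i, uc i * (T.P n *ᵥ v) i))| / n) atTop = lam2 - lam1 := by
  obtain ⟨c1, hc1, hang⟩ := T.angle hinj hv hlam h1 hξ h2
  obtain ⟨R, hR, hcmp⟩ := T.compar hv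
  have hk : (0 : ℝ) < k := by exact_mod_cast T.kpos
  have hv0 : v ≠ 0 := fun h => by have := hv ⟨0, T.kpos⟩; simp [h] at this
  have hxp : ∀ n, 0 < enorm2 (T.P n *ᵥ ξ) := fun n => enorm2_pos fun h => hξ (hinj n _ h)
  have hyp : ∀ n, 0 < enorm2 (T.P n *ᵥ v) := fun n => enorm2_pos fun h => hv0 (hinj n _ h)
  -- bounds on the denominators
  have hden : ∀ u : Fin k → ℝ, (∀ i, 0 < u i) → ∃ s t : ℝ, 0 < s ∧ 0 < t ∧
      ∀ n, s * enorm2 (T.P n *ᵥ v) ≤ ∑ i, u i * (T.P n *ᵥ v) i ∧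
        ∑ i, u i * (T.P n *ᵥ v) i ≤ t * enorm2 (T.P n *ᵥ v) := by
    intro u hu
    set o : Fin k := ⟨0, T.kpos⟩
    refine ⟨u o / (k * R), ∑ i, u i, div_pos (hu o) (by positivity),
      Finset.sum_pos (fun i _ => hu i) ⟨o, Finset.mem_univ _⟩, fun n => ⟨?_, ?_⟩⟩
    · have hy : enorm2 (T.P n *ᵥ v) ≤ k * (R * (T.P n *ᵥ v) o) := enorm2_le T.kpos _ fun i' => by
        rw [abs_of_pos (T.pos hv n i')]; exact hcmp n i' o
      calc u o / (k * R) * enorm2 (T.P n *ᵥ v) ≤ u o / (k * R) * (k * (R * (T.P n *ᵥ v) o)) :=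
            mul_le_mul_of_nonneg_left hy (div_pos (hu o) (by positivity)).le
        _ = u o * (T.P n *ᵥ v) o := by field_simp
        _ ≤ _ := Finset.single_le_sum (f := fun i => u i * (T.P n *ᵥ v) i)
            (fun i _ => (mul_pos (hu i) (T.pos hv n i)).le) (Finset.mem_univ o)
    · rw [Finset.sum_mul]
      refine Finset.sum_le_sum fun i _ => mul_le_mul_of_nonneg_left ?_ (hu i).le
      exact (le_abs_self _).trans (abs_le_enorm2 _ i)
  obtain ⟨sb, tb, hsb, htb, hb⟩ := hden ub hub
  obtain ⟨sc, tc, hsc, htc, hcc⟩ := hden uc huc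
  obtain ⟨K, hK, hKX⟩ : ∃ K : ℝ, 0 < K ∧ ∀ w, |X w| ≤ K * ‖w‖ := by
    refine ⟨‖LinearMap.toContinuousLinearMap X‖ + 1, by positivity, fun w => ?_⟩
    have := (LinearMap.toContinuousLinearMap X).le_opNorm w
    rw [LinearMap.coe_toContinuousLinearMap', Real.norm_eq_abs] at this
    have h0 := norm_nonneg w
    linarith
  have hlogdiff : ∀ A : ℝ, Tendsto (fun n : ℕ => Real.log A / n + Real.log (enorm2 (T.P n *ᵥ ξ)) / n
      - Real.log (enorm2 (T.P n *ᵥ v)) / n) atTop (nhds (lam2 - lam1)) := by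
    intro A
    have := ((tendsto_const_div_atTop_nhds_zero_nat (Real.log A)).add h2).sub h1
    simpa using this
  have hlogeq : ∀ A : ℝ, 0 < A → ∀ n : ℕ, Real.log A / n + Real.log (enorm2 (T.P n *ᵥ ξ)) / n
      - Real.log (enorm2 (T.P n *ᵥ v)) / n
      = Real.log (A * enorm2 (T.P n *ᵥ ξ) / enorm2 (T.P n *ᵥ v)) / n := by
    intro A hA n
    rw [Real.log_div (mul_pos hA (hxp n)).ne' (hyp n).ne', Real.log_mul hA.ne' (hxp n).ne']
    ring
  refine limsup_eq_of ?_ ?_ (hlogdiff (2 * K / (sb * sc))) (hlogdiff (c * c1 / (tb * tc)))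
  · filter_upwards [hne] with n hn
    rw [hlogeq _ (by positivity)]
    apply div_le_div_of_nonneg_right _ (Nat.cast_nonneg n)
    have hx := hxp n
    have hy := hyp n
    have d1 := (mul_pos hsb hy).trans_le (hb n).1
    have d2 := (mul_pos hsc hy).trans_le (hcc n).1
    apply Real.log_le_log
    · exact abs_pos.mpr (div_ne_zero hn (mul_pos d1 d2).ne')
    · rw [abs_div, abs_of_pos (mul_pos d1 d2)]
      calc _ ≤ (K * (2 * (enorm2 (T.P n *ᵥ ξ) * enorm2 (T.P n *ᵥ v)))) /
            ((sb * enorm2 (T.P n *ᵥ v)) * (sc * enorm2 (T.P n *ᵥ v))) := by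
            apply div_le_div₀ (by positivity) _ (by positivity)
            · exact mul_le_mul (hb n).1 (hcc n).1 (by positivity) d1.le
            · exact (hKX _).trans (mul_le_mul_of_nonneg_left (wedge_norm_le _ _) hK.le)
        _ = _ := by field_simp
  · refine hfr.mono fun n hn => ?_
    rw [hlogeq _ (by positivity)]
    apply div_le_div_of_nonneg_right _ (Nat.cast_nonneg n)
    have hx := hxp n
    have hy := hyp n
    have d1 := (mul_pos hsb hy).trans_le (hb n).1
    have d2 := (mul_pos hsc hy).trans_le (hcc n).1
    apply Real.log_le_log (by positivity)
    rw [abs_div, abs_of_pos (mul_pos d1 d2)]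
    calc _ = (c * (c1 * (enorm2 (T.P n *ᵥ ξ) * enorm2 (T.P n *ᵥ v)))) /
            ((tb * enorm2 (T.P n *ᵥ v)) * (tc * enorm2 (T.P n *ᵥ v))) := by field_simp
      _ ≤ _ := by
            apply div_le_div₀ (abs_nonneg _) _ (mul_pos d1 d2)
            · exact mul_le_mul (hb n).2 (hcc n).2 d2.le (by positivity)
            · exact (mul_le_mul_of_nonneg_left (hang n) hc.le).trans hn

end PosProd

end

noncomputable section

/-! ### Part K : the hidden Markov system -/

lemma q_inj {k l : ℕ} {q : Matrix (Fin k) (Fin l) ℝ} (h : q.rank = k) (v : Fin k → ℝ)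
    (hv : ∀ e, ∑ i, q i e * v i = 0) : v = 0 := by
  have h1 : LinearIndependent ℝ q.row := by
    rw [linearIndependent_iff_card_eq_finrank_span, Set.finrank, ← Matrix.rank_eq_finrank_span_row, h]
    simp
  have h2 := Matrix.vecMul_injective_iff.mpr h1
  apply h2
  simp only [Matrix.zero_vecMul]
  funext e
  rw [Matrix.vecMul, dotProduct]
  rw [Pi.zero_apply, ← hv e]
  exact Finset.sum_congr rfl fun i _ => mul_comm _ _

/-- The system attached to the hidden Markov chain. -/
def hmmSys {k l : ℕ} (hk : 0 < k) (p : Matrix (Fin k) (Fin k) ℝ) (q : Matrix (Fin k) (Fin l) ℝ) (o : Fin l)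
    (hp : ∀ i j, 0 < p i j) (hq : ∀ i m, 0 < q i m) (hdet : p.det ≠ 0) (hrank : q.rank = k) : Sys k l where
  a s := Matrix.of fun i j => q j s * p i j
  o := o
  D s i := q i s / q i o
  Dpos s i := div_pos (hq _ _) (hq _ _)
  ha s := by
    ext i j
    rw [Matrix.mul_diagonal]
    have := (hq j o).ne'
    simp only [Matrix.of_apply]
    field_simp
  apos i j := mul_pos (hq _ _) (hp _ _)
  adet := by
    have : (Matrix.of fun i j => q j o * p i j) = p * Matrix.diagonal (fun j => q j o) := by
      ext i j
      rw [Matrix.mul_diagonal]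
      simp [mul_comm]
    rw [this, Matrix.det_mul, Matrix.det_diagonal]
    exact (mul_ne_zero hdet (Finset.prod_ne_zero_iff.mpr fun i _ => (hq i o).ne')).isUnit
  Dspan v hv := by
    have := q_inj hrank (fun i => v i / q i o) (fun e => by
      rw [← hv e]
      exact Finset.sum_congr rfl fun i _ => by ring)
    funext i
    have h2 := congrFun this i
    simp only [Pi.zero_apply] at h2 ⊢
    exact (div_eq_zero_iff.mp h2).resolve_right (hq i o).ne'
  kpos := hk

lemma iter_invShift {l : ℕ} (n : ℕ) (z : ℤ → Fin l) (t : ℤ) : (invShift^[n] z) t = z (t - n) := by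
  induction n generalizing t with
  | zero => simp
  | succ n ih =>
    rw [Function.iterate_succ_apply', invShift, ih]
    congr 1
    push_cast
    ring


lemma Lpow_succ {k l : ℕ} {p : Matrix (Fin k) (Fin k) ℝ} {q : Matrix (Fin k) (Fin l) ℝ} (S : Sys k l)
    (hS : ∀ s, S.a s = Matrix.of fun i j => q j s * p i j) (z : ℤ → Fin l) (n : ℕ) : Lpow p q (n + 1) z = S.wd (zw z n) * Lmat p q z := by
  induction n with
  | zero => simp [Lpow, zw, Sys.wd]
  | succ n ih =>
    rw [Lpow, ih, zw, Sys.wd, ← Matrix.mul_assoc]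
    congr 2
    rw [hS, Lmat]
    ext i j
    simp only [Matrix.of_apply]
    rw [iter_invShift]
    congr 3

lemma path_sum {k l : ℕ} {p : Matrix (Fin k) (Fin k) ℝ} {q : Matrix (Fin k) (Fin l) ℝ} (S : Sys k l)
    (hS : ∀ s, S.a s = Matrix.of fun i j => q j s * p i j) (z : ℤ → Fin l) (m : ℕ) (f : Fin k → ℝ) (a : Fin k) :
    ∑ x : Fin (m + 1) → Fin k, f (x 0) * p (x (Fin.last m)) a *
      ∏ j : Fin m, q (x j.succ) (z (((j : ℕ) : ℤ) - (m : ℤ))) * p (x j.castSucc) (x j.succ)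
      = ∑ i, f i * (S.wd (zw z m) * p) i a := by
  induction m generalizing f with
  | zero =>
    simp only [Finset.univ_eq_empty, Finset.prod_empty, mul_one, zw, Sys.wd, Matrix.one_mul]
    exact (Equiv.funUnique (Fin 1) (Fin k)).sum_comp (fun i => f i * p i a)
  | succ m ih =>
    rw [← (Fin.consEquiv (fun _ : Fin (m + 2) => Fin k)).sum_comp, Fintype.sum_prod_type,
      Finset.sum_comm]
    have h := ih (fun i => ∑ i', f i' * (q i (z (-((m : ℤ) + 1))) * p i' i))
    have h2 : ∑ i, f i * (S.wd (zw z (m + 1)) * p) i a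
        = ∑ i, (∑ i', f i' * (q i (z (-((m : ℤ) + 1))) * p i' i)) * (S.wd (zw z m) * p) i a := by
      rw [zw, Sys.wd, Matrix.mul_assoc]
      simp only [Finset.sum_mul]
      rw [Finset.sum_comm]
      refine Finset.sum_congr rfl fun i _ => ?_
      rw [Matrix.mul_apply, Finset.mul_sum]
      refine Finset.sum_congr rfl fun j _ => ?_
      rw [hS, Matrix.of_apply]
      ring
    rw [h2, ← h]
    refine Finset.sum_congr rfl fun x _ => ?_
    rw [Finset.sum_mul, Finset.sum_mul]
    refine Finset.sum_congr rfl fun i _ => ?_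
    rw [Fin.prod_univ_succ]
    have e1 : ((Fin.consEquiv fun _ : Fin (m + 2) => Fin k) (i, x)) 0 = i := rfl
    have e2 : ∀ j : Fin (m + 1), ((Fin.consEquiv fun _ : Fin (m + 2) => Fin k) (i, x)) j.succ = x j :=
      fun j => rfl
    have e3 : ((Fin.consEquiv fun _ : Fin (m + 2) => Fin k) (i, x)) (Fin.last (m + 1)) = x (Fin.last m) := rfl
    have e4 : (((0 : Fin (m + 1)) : ℕ) : ℤ) - ((m + 1 : ℕ) : ℤ) = -((m : ℤ) + 1) := by
      push_cast; simp
    have e5 : ∀ j : Fin m, (((j.succ : Fin (m + 1)) : ℕ) : ℤ) - ((m + 1 : ℕ) : ℤ) = ((j : ℕ) : ℤ) - (m : ℤ) := by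
      intro j; push_cast [Fin.val_succ]; ring
    have e6 : ∀ j : Fin m, ((Fin.consEquiv fun _ : Fin (m + 2) => Fin k) (i, x)) j.succ.castSucc
        = x j.castSucc := fun j => rfl
    have e7 : ((Fin.consEquiv fun _ : Fin (m + 2) => Fin k) (i, x)) (Fin.castSucc (0 : Fin (m + 1))) = i := rfl
    rw [e1, e3, e4, e7]
    simp only [e2, e5, e6]
    ring

lemma Delt_eq {k l : ℕ} {p : Matrix (Fin k) (Fin k) ℝ} {q : Matrix (Fin k) (Fin l) ℝ} (S : Sys k l)
    (hS : ∀ s, S.a s = Matrix.of fun i j => q j s * p i j) (hp : ∀ i, ∑ j, p i j = 1) (piv : Fin k → ℝ) (z : ℤ → Fin l) (m : ℕ) (e b c : Fin l) :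
    Delt p q piv (m + 1) e b c z =
      (∑ i, piv i * q i b * (S.wd (zw z m) *ᵥ (p *ᵥ fun a => q a e)) i)
        / (∑ i, piv i * q i b * (S.wd (zw z m) *ᵥ fun _ => 1) i)
      - (∑ i, piv i * q i c * (S.wd (zw z m) *ᵥ (p *ᵥ fun a => q a e)) i)
        / (∑ i, piv i * q i c * (S.wd (zw z m) *ᵥ fun _ => 1) i) := by
  have hs : ∀ a b, Spath p q piv (m + 1) a b z = ∑ i, piv i * q i b * (S.wd (zw z m) * p) i a := by
    intro a b
    rw [Spath]
    exact path_sum S hS z m (fun i => piv i * q i b) a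
  have h1 : ∀ (g : Fin k → ℝ) b, ∑ a, g a * Spath p q piv (m + 1) a b z
      = ∑ i, piv i * q i b * (S.wd (zw z m) *ᵥ (p *ᵥ g)) i := by
    intro g b
    simp only [hs, Finset.mul_sum]
    rw [Finset.sum_comm]
    refine Finset.sum_congr rfl fun i _ => ?_
    rw [Matrix.mulVec_mulVec, Matrix.mulVec, dotProduct, Finset.mul_sum]
    exact Finset.sum_congr rfl fun a _ => by ring
  have hone : p *ᵥ (fun _ => (1 : ℝ)) = fun _ => 1 := by
    funext i
    simp [Matrix.mulVec, dotProduct, hp]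
  have h2 : ∀ b, ∑ a, Spath p q piv (m + 1) a b z
      = ∑ i, piv i * q i b * (S.wd (zw z m) *ᵥ fun _ => 1) i := by
    intro b
    have := h1 (fun _ => 1) b
    rw [hone] at this
    simpa using this
  rw [Delt]
  simp only [Del, h2, mul_sub, Finset.sum_sub_distrib, mul_div_assoc']
  rw [← Finset.sum_div, ← Finset.sum_div, h1, h1]

end

noncomputable section

/-! ### Part M : conclusion -/

lemma exists_lower {ι κ : Type*} [Finite ι] [Finite κ] (f : ι → κ → ℝ) (h : ∀ i j, 0 < f i j) :
    ∃ δ, 0 < δ ∧ ∀ i j, δ ≤ f i j := by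
  rcases isEmpty_or_nonempty (ι × κ) with h0 | h0
  · exact ⟨1, one_pos, fun i j => (h0.false (i, j)).elim⟩
  · obtain ⟨s, hs⟩ := Finite.exists_min (fun s : ι × κ => f s.1 s.2)
    exact ⟨f s.1 s.2, h _ _, fun i j => hs (i, j)⟩

lemma piv_pos {k : ℕ} {p : Matrix (Fin k) (Fin k) ℝ} (hp : ∀ i j, 0 < p i j) {piv : Fin k → ℝ}
    (h0 : ∀ i, 0 ≤ piv i) (h1 : ∑ i, piv i = 1) (hinv : ∀ j, ∑ i, piv i * p i j = piv j) (j : Fin k) :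
    0 < piv j := by
  have : ∃ i, piv i ≠ 0 := by
    by_contra! h
    simp [h] at h1
  obtain ⟨i, hi⟩ := this
  rw [← hinv j]
  exact Finset.sum_pos' (fun i _ => mul_nonneg (h0 i) (hp i j).le)
    ⟨i, Finset.mem_univ _, mul_pos (lt_of_le_of_ne (h0 i) (Ne.symm hi)) (hp i j)⟩

lemma exists_out {k l : ℕ} {q : Matrix (Fin k) (Fin l) ℝ} (hq : ∀ i m, 0 < q i m) (hrank : q.rank = k)
    (s : Fin l) (v : Fin k → ℝ) (a : Fin l → ℝ) (W : Submodule ℝ (Fin k → ℝ))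
    (hW : Module.finrank ℝ W + 2 ≤ k) :
    ∃ e, (fun i => q i e / q i s) - a e • v ∉ W := by
  by_contra! h
  set U := W ⊔ Submodule.span ℝ {v} with hU
  have hUd : Module.finrank ℝ U < Module.finrank ℝ (Fin k → ℝ) := by
    have h1 := Submodule.finrank_add_le_finrank_add_finrank W (Submodule.span ℝ {v})
    have h2 := finrank_span_le_card (R := ℝ) ({v} : Set (Fin k → ℝ))
    simp only [Set.toFinset_singleton, Finset.card_singleton] at h2
    rw [Module.finrank_fin_fun, hU]
    omega
  have hUt : U < ⊤ := lt_top_iff_ne_top.mpr fun h => by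
    rw [h, finrank_top] at hUd
    exact lt_irrefl _ hUd
  obtain ⟨φ, hφ, hle⟩ := Submodule.exists_le_ker_of_lt_top U hUt
  have hmem : ∀ e, (fun i => q i e / q i s) ∈ U := by
    intro e
    have h1 : (fun i => q i e / q i s) = ((fun i => q i e / q i s) - a e • v) + a e • v := by simp
    rw [h1]
    exact Submodule.add_mem_sup (h e) (Submodule.smul_mem _ _ (Submodule.mem_span_singleton_self v))
  have hz := q_inj hrank (fun i => φ (Pi.single i 1) / q i s) (fun e => by
    have h1 : φ (fun i => q i e / q i s) = 0 := hle (hmem e)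
    rw [LinearMap.pi_apply_eq_sum_univ] at h1
    rw [← h1]
    refine Finset.sum_congr rfl fun i _ => ?_
    have h3 : (fun j => if i = j then (1 : ℝ) else 0) = Pi.single i 1 := by
      funext j
      rw [Pi.single_apply]
      simp only [eq_comm]
    rw [h3, smul_eq_mul]
    ring)
  apply hφ
  apply LinearMap.pi_ext'
  intro i
  ext
  have h2 := congrFun hz i
  simp only [Pi.zero_apply] at h2
  simpa using (div_eq_zero_iff.mp h2).resolve_right (hq i s).ne'

theorem main_thm
    (k l : ℕ) (hk : 0 < k) (hkl : k ≤ l)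
    (p : Matrix (Fin k) (Fin k) ℝ) (q : Matrix (Fin k) (Fin l) ℝ)
    (hp_row : ∀ i, ∑ j, p i j = 1)
    (hq_row : ∀ i, ∑ m, q i m = 1)
    (hH1p : ∀ i j, 0 < p i j)
    (hH1q : ∀ i m, 0 < q i m)
    (hH2p : p.det ≠ 0)
    (hH2q : q.rank = k)
    (piv : Fin k → ℝ)
    (hpiv_nonneg : ∀ i, 0 ≤ piv i)
    (hpiv_sum : ∑ i, piv i = 1)
    (hpiv_inv : ∀ j, ∑ i, piv i * p i j = piv j)
    (μ : Measure (ℤ → Fin l)) [IsProbabilityMeasure μ]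
    (hlaw : IsHMMLaw p q piv μ)
    (lam1 lam2 : ℝ) (hlam : lam2 < lam1)
    (V : (ℤ → Fin l) → Submodule ℝ (Fin k → ℝ))
    (hosel : ∀ᵐ z ∂μ,
      V z ≠ ⊤ ∧
      (∀ v ∈ V z, (Lmat p q z).mulVec v ∈ V (invShift z)) ∧
      (∀ w : Fin k → ℝ, w ∉ V z →
        Tendsto (fun n : ℕ => Real.log (enorm2 ((Lpow p q n z).mulVec w)) / n)
          atTop (nhds lam1)) ∧
      (∀ ξ : Fin k → ℝ, ξ ∈ V z → ξ ≠ 0 →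
        Filter.limsup (fun n : ℕ => Real.log (enorm2 ((Lpow p q n z).mulVec ξ)) / n)
          atTop ≤ lam2))
    (W : (ℤ → Fin l) → Submodule ℝ (Fin k → ℝ))
    (hsecond : ∀ᵐ z ∂μ,
      W z ≤ V z ∧
      Module.finrank ℝ (W z) + 2 ≤ k ∧
      (∀ v ∈ W z, (Lmat p q z).mulVec v ∈ W (invShift z)) ∧
      (∀ ξ : Fin k → ℝ, ξ ∈ V z → ξ ∉ W z →
        Tendsto (fun n : ℕ => Real.log (enorm2 ((Lpow p q n z).mulVec ξ)) / n)
          atTop (nhds lam2))) :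
    ∀ᵐ z ∂μ, ∃ (e b c : Fin l), taut p q piv z e b c = lam2 - lam1 := by
  have hl : 0 < l := lt_of_lt_of_le hk hkl
  set o : Fin l := ⟨0, hl⟩ with ho
  set S : Sys k l := hmmSys hk p q o hH1p hH1q hH2p hH2q with hSdef
  have hS : ∀ s, S.a s = Matrix.of fun i j => q j s * p i j := fun s => rfl
  have hpi := piv_pos hH1p hpiv_nonneg hpiv_sum hpiv_inv
  set κ : Fin k → ℝ := fun i => piv i * q i o with hκ
  have hκD : ∀ b i, κ i * S.D b i = piv i * q i b := by
    intro b i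
    show piv i * q i o * (q i b / q i o) = piv i * q i b
    have := (hH1q i o).ne'
    field_simp
  obtain ⟨c, hthin⟩ := S.exists_thin κ (fun i => mul_pos (hpi i) (hH1q i o)) o
  obtain ⟨δ, hδ0, hδ⟩ := exists_lower q hH1q
  obtain ⟨δ', hδ0', hδ'⟩ := exists_lower p hH1p
  obtain ⟨c0, hc0, hae⟩ := hmm_ae S hl hp_row hq_row hH1p hpiv_nonneg hpiv_sum hδ0 hδ hlaw
    (S.Xf κ o c) hthin
  have hall : ∀ᵐ z ∂μ, ∀ e : Fin l, wedge (p *ᵥ fun a => q a e) (fun _ => 1) ≠ 0 →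
      (∀ᶠ n in atTop, S.Xf κ o c (rho (Fin 2) (S.wd (zw z n)) *ᵥ
          wedge (p *ᵥ fun a => q a e) (fun _ => 1)) ≠ 0) ∧
        (∃ᶠ n in atTop, c0 * ‖rho (Fin 2) (S.wd (zw z n)) *ᵥ wedge (p *ᵥ fun a => q a e) (fun _ => 1)‖
          ≤ |S.Xf κ o c (rho (Fin 2) (S.wd (zw z n)) *ᵥ
              wedge (p *ᵥ fun a => q a e) (fun _ => 1))|) := by
    rw [ae_all_iff]
    intro e
    by_cases h : wedge (p *ᵥ fun a => q a e) (fun _ => 1) = 0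
    · exact Eventually.of_forall fun z hz => (hz h).elim
    · filter_upwards [hae _ _ h] with z hz _
      exact hz
  have hp1 : ∀ i j, p i j ≤ 1 := fun i j => by
    rw [← hp_row i]
    exact Finset.single_le_sum (f := fun j => p i j) (fun j _ => (hH1p i j).le) (Finset.mem_univ j)
  have hq1 : ∀ i j, q i j ≤ 1 := fun i j => by
    rw [← hq_row i]
    exact Finset.single_le_sum (f := fun j => q i j) (fun j _ => (hH1q i j).le) (Finset.mem_univ j)
  filter_upwards [hosel, hsecond, hall] with z ⟨hVt, _, hbig, hsmall⟩ ⟨_, hWd, _, hsec⟩ hz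
  let T : PosProd k :=
    { B := fun n => Lmat p q (invShift^[n] z)
      P := fun n => Lpow p q n z
      al := δ * δ'
      be := 1
      hal := mul_pos hδ0 hδ0'
      hl := fun n i j => mul_le_mul (hδ _ _) (hδ' _ _) hδ0'.le (hH1q _ _).le
      hu := fun n i j => mul_le_one₀ (hq1 _ _) (hH1p _ _).le (hp1 _ _)
      P0 := rfl
      Ps := fun n => rfl
      kpos := hk }
  have hTP : ∀ n, T.P n = Lpow p q n z := fun n => rfl
  have hTs : ∀ n, T.P (n + 1) = S.wd (zw z n) * Lmat p q z := fun n => Lpow_succ S hS z n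
  have hinj : ∀ n w, T.P n *ᵥ w = 0 → w = 0 := by
    intro n w hw
    cases n with
    | zero => simpa [T.P0] using hw
    | succ n =>
      have hd : IsUnit (T.P (n + 1)).det := by
        rw [hTs, Matrix.det_mul]
        exact (S.det_wd _).mul (by
          have := S.det_wd [z 0]
          simpa [Sys.wd, hS, Lmat] using this)
      exact Matrix.eq_zero_of_mulVec_eq_zero hd.ne_zero hw
  set v : Fin k → ℝ := fun i => 1 / q i (z 0) with hvdef
  have hv : ∀ i, 0 < v i := fun i => one_div_pos.mpr (hH1q _ _)
  have hvV : v ∉ V z := T.vnotin hinj hv hlam (V z) hVt hbig hsmall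
  have hdec : ∀ e : Fin l, ∃ a : ℝ, (fun i => q i e / q i (z 0)) - a • v ∈ V z :=
    fun e => T.decomp hinj hv (V z) hbig hvV _
  choose a ha using hdec
  obtain ⟨e, he⟩ := exists_out hH1q hH2q (z 0) v a (W z) hWd
  set f : Fin k → ℝ := fun i => q i e / q i (z 0) with hf
  set ξ : Fin k → ℝ := f - a e • v with hξdef
  have hξ0 : ξ ≠ 0 := fun h => he (h ▸ (W z).zero_mem)
  have hg1 := hbig v hvV
  have hg2 := hsec ξ (ha e) he
  have hLv : Lmat p q z *ᵥ v = fun _ => 1 := by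
    funext i
    rw [← hp_row i]
    simp only [Matrix.mulVec, dotProduct, Lmat, Matrix.of_apply, hvdef]
    refine Finset.sum_congr rfl fun j _ => ?_
    have := (hH1q j (z 0)).ne'
    field_simp
  have hLf : Lmat p q z *ᵥ f = p *ᵥ fun a => q a e := by
    funext i
    simp only [Matrix.mulVec, dotProduct, Lmat, Matrix.of_apply, hf]
    refine Finset.sum_congr rfl fun j _ => ?_
    have := (hH1q j (z 0)).ne'
    field_simp
  have hPv : ∀ n, T.P (n + 1) *ᵥ v = S.wd (zw z n) *ᵥ fun _ => 1 := fun n => by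
    rw [hTs, ← Matrix.mulVec_mulVec, hLv]
  have hPf : ∀ n, T.P (n + 1) *ᵥ f = S.wd (zw z n) *ᵥ (p *ᵥ fun a => q a e) := fun n => by
    rw [hTs, ← Matrix.mulVec_mulVec, hLf]
  have hw0 : ∀ n, wedge (T.P n *ᵥ ξ) (T.P n *ᵥ v) = wedge (T.P n *ᵥ f) (T.P n *ᵥ v) := by
    intro n
    funext i
    simp only [wedge, hξdef, Matrix.mulVec_sub, Matrix.mulVec_smul, Pi.sub_apply, Pi.smul_apply,
      smul_eq_mul]
    ring
  have hw1 : ∀ n, wedge (T.P (n + 1) *ᵥ ξ) (T.P (n + 1) *ᵥ v)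
      = rho (Fin 2) (S.wd (zw z n)) *ᵥ wedge (p *ᵥ fun a => q a e) (fun _ => 1) := by
    intro n
    rw [hw0, hPv, hPf, rho_wedge]
  have hY : wedge (p *ᵥ fun a => q a e) (fun _ => 1) ≠ 0 := by
    intro h
    obtain ⟨c1, hc1, hang⟩ := T.angle hinj hv hlam hg1 hξ0 hg2
    have h1 := hang 1
    rw [hw1 0, h, Matrix.mulVec_zero, norm_zero] at h1
    have hv0 : v ≠ 0 := fun h => hvV (h ▸ (V z).zero_mem)
    have hx : 0 < enorm2 (T.P 1 *ᵥ ξ) := PosProd.enorm2_pos fun h => hξ0 (hinj 1 _ h)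
    have hy : 0 < enorm2 (T.P 1 *ᵥ v) := PosProd.enorm2_pos fun h => hv0 (hinj 1 _ h)
    have := mul_pos hc1 (mul_pos hx hy)
    linarith
  obtain ⟨hz1, hz2⟩ := hz e hY
  refine ⟨e, o, c, ?_⟩
  have hmain := T.det_main hinj hv hlam hg1 hξ0 hg2 (S.Xf κ o c) (fun i => piv i * q i o)
    (fun i => piv i * q i c) (fun i => mul_pos (hpi i) (hH1q i o)) (fun i => mul_pos (hpi i) (hH1q i c))
    (by
      obtain ⟨N, hN⟩ := eventually_atTop.mp hz1
      refine eventually_atTop.mpr ⟨N + 1, fun n hn => ?_⟩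
      obtain ⟨m, rfl⟩ : ∃ m, n = m + 1 := ⟨n - 1, by omega⟩
      rw [hw1]
      exact hN m (by omega)) hc0
    (by
      rw [frequently_atTop] at hz2 ⊢
      intro N
      obtain ⟨m, hm, hm2⟩ := hz2 N
      refine ⟨m + 1, by omega, ?_⟩
      rw [hw1]
      exact hm2)
  rw [← hmain, taut]
  refine limsup_congr ?_
  filter_upwards [eventually_gt_atTop 0] with n hn
  obtain ⟨m, rfl⟩ : ∃ m, n = m + 1 := ⟨n - 1, by omega⟩
  congr 3
  rw [Delt_eq S hS hp_row, hw0, Sys.Xf_wedge]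
  simp only [hκD]
  rw [hPf, hPv]
  have hposv := T.pos hv (m + 1)
  rw [hPv] at hposv
  have d1 : ∑ i, piv i * q i o * (S.wd (zw z m) *ᵥ fun _ => 1) i ≠ 0 :=
    (Finset.sum_pos (fun i _ => mul_pos (mul_pos (hpi i) (hH1q _ _)) (hposv i))
      ⟨⟨0, hk⟩, Finset.mem_univ _⟩).ne'
  have d2 : ∑ i, piv i * q i c * (S.wd (zw z m) *ᵥ fun _ => 1) i ≠ 0 :=
    (Finset.sum_pos (fun i _ => mul_pos (mul_pos (hpi i) (hH1q _ _)) (hposv i))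
      ⟨⟨0, hk⟩, Finset.mem_univ _⟩).ne'
  rw [div_sub_div _ _ d1 d2]

end

/-- **Corollary (lower bound for the observed process).** Under (H1), (H2), the Oseledec
hypothesis and the second-space hypothesis, for `μ`-almost every `z` there exist
`e, b, c ∈ B` with `τ̃_z(e,b,c) = λ₂ - λ₁`. -/
theorem observed_loss_of_memory_lower_bound
    (k l : ℕ) (hk : 0 < k) (hkl : k ≤ l)
    (p : Matrix (Fin k) (Fin k) ℝ) (q : Matrix (Fin k) (Fin l) ℝ)
    (hp_row : ∀ i, ∑ j, p i j = 1)
    (hq_row : ∀ i, ∑ m, q i m = 1)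
    -- Hypothesis (H1)
    (hH1p : ∀ i j, 0 < p i j)
    (hH1q : ∀ i m, 0 < q i m)
    -- Hypothesis (H2)
    (hH2p : p.det ≠ 0)
    (hH2q : q.rank = k)
    -- invariant probability vector
    (piv : Fin k → ℝ)
    (hpiv_nonneg : ∀ i, 0 ≤ piv i)
    (hpiv_sum : ∑ i, piv i = 1)
    (hpiv_inv : ∀ j, ∑ i, piv i * p i j = piv j)
    -- the hidden Markov measure
    (μ : Measure (ℤ → Fin l)) [IsProbabilityMeasure μ]
    (herg : Ergodic shift μ)
    (hlaw : IsHMMLaw p q piv μ)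
    -- Oseledec hypothesis
    (lam1 lam2 : ℝ) (hlam : lam2 < lam1)
    (V : (ℤ → Fin l) → Submodule ℝ (Fin k → ℝ))
    (hosel : ∀ᵐ z ∂μ,
      V z ≠ ⊤ ∧
      (∀ v ∈ V z, (Lmat p q z).mulVec v ∈ V (invShift z)) ∧
      (∀ w : Fin k → ℝ, w ∉ V z →
        Tendsto (fun n : ℕ => Real.log (enorm2 ((Lpow p q n z).mulVec w)) / n)
          atTop (nhds lam1)) ∧
      (∀ ξ : Fin k → ℝ, ξ ∈ V z → ξ ≠ 0 →
        Filter.limsup (fun n : ℕ => Real.log (enorm2 ((Lpow p q n z).mulVec ξ)) / n)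
          atTop ≤ lam2))
    -- Second-space hypothesis
    (W : (ℤ → Fin l) → Submodule ℝ (Fin k → ℝ))
    (hsecond : ∀ᵐ z ∂μ,
      W z ≤ V z ∧
      Module.finrank ℝ (W z) + 2 ≤ k ∧
      (∀ v ∈ W z, (Lmat p q z).mulVec v ∈ W (invShift z)) ∧
      (∀ ξ : Fin k → ℝ, ξ ∈ V z → ξ ∉ W z →
        Tendsto (fun n : ℕ => Real.log (enorm2 ((Lpow p q n z).mulVec ξ)) / n)
          atTop (nhds lam2))) :
    ∀ᵐ z ∂μ, ∃ (e b c : Fin l), taut p q piv z e b c = lam2 - lam1 := by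
  exact main_thm k l hk hkl p q hp_row hq_row hH1p hH1q hH2p hH2q piv hpiv_nonneg hpiv_sum hpiv_inv μ
    hlaw lam1 lam2 hlam V hosel W hsecond

end
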